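/- Any two finite groups G and H, each of order 2^7 · 3 · 7^4 · 67 · 97^3 · 139 and each having prime graph degrees deg(2) = 3, deg(3) = 2, deg(7) = 3, deg(67) = 1, deg(97) = 2, deg(139) = 1, are isomorphic. -/

import Mathlib

/-- The degree of the prime `p` in the prime graph (Gruenberg–Kegel graph) `GK(G)` of the
group `G`: the number of primes `q ≠ p` such that `G` contains an element of order `p * q`
(two distinct primes being adjacent in `GK(G)` iff `G` has an element of order their
product). -/
noncomputable def gkDegree (G : Type*) [Group G] (p : ℕ) : ℕ :=
  Nat.card {q : ℕ // p ≠ q ∧ p.Prime ∧ q.Prime ∧ ∃ g : G, orderOf g = p * q}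

set_option linter.unusedSectionVars false

/-! ### Complex characters from the Wedderburn decomposition -/

section

open scoped Matrix

/-- A Wedderburn decomposition of the complex group algebra of `G`. -/
structure WedderburnSystem (G : Type*) [Group G] where
  /-- the number of simple components -/
  n : ℕ
  /-- the sizes of the matrix components -/
  d : Fin n → ℕ
  pos : ∀ i, NeZero (d i)
  /-- the isomorphism with a product of matrix algebras -/
  Ψ : MonoidAlgebra ℂ G ≃ₐ[ℂ] (Π i, Matrix (Fin (d i)) (Fin (d i)) ℂ)

theorem WedderburnSystem.nonempty (G : Type*) [Group G] [Finite G] :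
    Nonempty (WedderburnSystem G) := by
  have : Fintype G := Fintype.ofFinite G
  have : NeZero (Nat.card G : ℂ) := ⟨by simp⟩
  obtain ⟨n, d, hd, ⟨Ψ⟩⟩ :=
    IsSemisimpleRing.exists_algEquiv_pi_matrix_of_isAlgClosed ℂ (MonoidAlgebra ℂ G)
  exact ⟨⟨n, d, hd, Ψ⟩⟩

theorem trace_mulLeft_single {G : Type*} [Group G] [Fintype G] [DecidableEq G] (g : G) :
    LinearMap.trace ℂ _ (LinearMap.mulLeft ℂ (MonoidAlgebra.single g (1 : ℂ))) =
      if g = 1 then (Fintype.card G : ℂ) else 0 := by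
  let b : Module.Basis G ℂ (MonoidAlgebra ℂ G) :=
    Module.Basis.ofRepr (MonoidAlgebra.coeffLinearEquiv ℂ)
  rw [LinearMap.trace_eq_matrix_trace ℂ b, Matrix.trace]
  have : ∀ h : G, b h = MonoidAlgebra.single h 1 := fun h => rfl
  have key : ∀ h : G, ((LinearMap.toMatrix b b)
      (LinearMap.mulLeft ℂ (MonoidAlgebra.single g (1 : ℂ)))).diag h = if g = 1 then 1 else 0 := by
    intro h
    rw [Matrix.diag_apply, LinearMap.toMatrix_apply, this, LinearMap.mulLeft_apply,
      MonoidAlgebra.single_mul_single]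
    change (MonoidAlgebra.single (g * h) (1 * 1 : ℂ)).coeff h = _
    rw [MonoidAlgebra.coeff_single, Finsupp.single_apply]
    simp
  simp only [key]
  split_ifs <;> simp

theorem trace_mulLeft_pi {n : ℕ} {d : Fin n → ℕ}
    (x : Π i, Matrix (Fin (d i)) (Fin (d i)) ℂ) :
    LinearMap.trace ℂ _ (LinearMap.mulLeft ℂ x) = ∑ i, (d i : ℂ) * (x i).trace := by
  let b := Pi.basis (fun i => Matrix.stdBasis ℂ (Fin (d i)) (Fin (d i)))
  rw [LinearMap.trace_eq_matrix_trace ℂ b, Matrix.trace, Fintype.sum_sigma]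
  refine Finset.sum_congr rfl fun i _ => ?_
  rw [Fintype.sum_prod_type]
  have key : ∀ r s, ((LinearMap.toMatrix b b) (LinearMap.mulLeft ℂ x)).diag ⟨i, (r, s)⟩
      = x i r r := by
    intro r s
    rw [Matrix.diag_apply, LinearMap.toMatrix_apply]
    simp only [b, Pi.basis_repr, Pi.basis_apply, LinearMap.mulLeft_apply, Pi.mul_apply,
      Pi.single_eq_same, Matrix.stdBasis_eq_single]
    change (x i * (Matrix.single r s 1 : Matrix (Fin (d i)) (Fin (d i)) ℂ)) r s = _
    simp
  simp only [key]
  simp [Matrix.trace, Finset.mul_sum]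

namespace WedderburnSystem

variable {G : Type*} [Group G] (S : WedderburnSystem G)

/-- The `i`-th irreducible matrix representation. -/
noncomputable def ρ (i : Fin S.n) : G →* Matrix (Fin (S.d i)) (Fin (S.d i)) ℂ :=
  ((Pi.evalMonoidHom (fun i => Matrix (Fin (S.d i)) (Fin (S.d i)) ℂ) i).comp
    (S.Ψ : MonoidAlgebra ℂ G →* _)).comp (MonoidAlgebra.of ℂ G)

/-- The `i`-th irreducible character. -/
noncomputable def χ (i : Fin S.n) (g : G) : ℂ := (S.ρ i g).trace

theorem ρ_apply (i : Fin S.n) (g : G) : S.ρ i g = S.Ψ (MonoidAlgebra.single g 1) i := rfl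

theorem d_ne_zero (i : Fin S.n) : (S.d i : ℂ) ≠ 0 := by
  simpa using (S.pos i).out

theorem χ_one (i : Fin S.n) : S.χ i 1 = S.d i := by simp [χ]

theorem χ_conj (i : Fin S.n) (g x : G) : S.χ i (g * x * g⁻¹) = S.χ i x := by
  simp only [χ, map_mul]
  rw [Matrix.trace_mul_comm, ← mul_assoc, ← map_mul]
  simp

variable [Fintype G]

/-- The linear extension of the `i`-th representation to the group algebra. -/
noncomputable def ext (i : Fin S.n) (α : G → ℂ) : Matrix (Fin (S.d i)) (Fin (S.d i)) ℂ :=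
  ∑ g, α g • S.ρ i g

theorem ext_surjective (M : Π i, Matrix (Fin (S.d i)) (Fin (S.d i)) ℂ) :
    ∃ α : G → ℂ, ∀ i, S.ext i α = M i := by
  obtain ⟨a, rfl⟩ := S.Ψ.surjective M
  refine ⟨fun g => a.coeff g, fun i => ?_⟩
  conv_rhs => rw [← MonoidAlgebra.sum_coeff_single a, Finsupp.sum_fintype _ _ (by simp), map_sum,
    Finset.sum_apply]
  refine Finset.sum_congr rfl fun g _ => ?_
  rw [ρ_apply, ← Pi.smul_apply, ← map_smul]
  simp

theorem sum_d_mul_χ [DecidableEq G] (g : G) :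
    ∑ i, (S.d i : ℂ) * S.χ i g = if g = 1 then (Fintype.card G : ℂ) else 0 := by
  rw [← trace_mulLeft_single, ← LinearMap.trace_conj' _ S.Ψ.toLinearEquiv]
  rw [show (S.Ψ.toLinearEquiv.conj) (LinearMap.mulLeft ℂ (MonoidAlgebra.single g (1 : ℂ))) =
    LinearMap.mulLeft ℂ (S.Ψ (MonoidAlgebra.single g 1)) from ?_, trace_mulLeft_pi]
  · rfl
  · refine LinearMap.ext fun x => ?_
    simp [LinearEquiv.conj_apply]

theorem ext_mul_ρ_trace (i : Fin S.n) (α : G → ℂ) (h : G) :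
    (S.ext i α * S.ρ i h).trace = ∑ g, α g * S.χ i (g * h) := by
  simp [ext, Finset.sum_mul, Matrix.trace_sum, χ]

theorem ext_trace (i : Fin S.n) (α : G → ℂ) :
    (S.ext i α).trace = ∑ g, α g * S.χ i g := by
  simpa using S.ext_mul_ρ_trace i α 1

theorem inversion (α : G → ℂ) (h : G) :
    ∑ i, (S.d i : ℂ) * (S.ext i α * S.ρ i h⁻¹).trace = Fintype.card G * α h := by
  classical
  simp only [ext_mul_ρ_trace, Finset.mul_sum]
  rw [Finset.sum_comm]
  simp only [mul_left_comm _ (α _), ← Finset.mul_sum, sum_d_mul_χ, mul_inv_eq_one]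
  simp [mul_comm]

/-- Schur's lemma. -/
theorem eq_smul_one_of_commute {i : Fin S.n} {A : Matrix (Fin (S.d i)) (Fin (S.d i)) ℂ}
    (h1 : ∀ g, S.ρ i g * A = A * S.ρ i g) : A = (A.trace / S.d i) • 1 := by
  have h2 : ∀ M, M * A = A * M := by
    intro M
    obtain ⟨β, hβ⟩ := S.ext_surjective (Function.update 0 i M)
    have := hβ i
    rw [Function.update_self] at this
    rw [← this]
    have h3 : ∀ A, (∑ g, β g • S.ρ i g) * A = ∑ g, β g • (S.ρ i g * A) := fun A => by
      simp [Finset.sum_mul]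
    have h4 : ∀ A, A * (∑ g, β g • S.ρ i g) = ∑ g, β g • (A * S.ρ i g) := fun A => by
      simp [Finset.mul_sum]
    rw [show S.ext i β = ∑ g, β g • S.ρ i g from rfl, h3, h4]
    simp only [h1]
  have h3 : A ∈ Set.range (Matrix.scalar (Fin (S.d i))) :=
    Matrix.mem_range_scalar_of_commute_single fun a b _ => h2 _
  obtain ⟨c, hc⟩ := h3
  rw [← hc]
  have := S.d_ne_zero i
  simp [Matrix.trace, Matrix.scalar_apply, Matrix.smul_one_eq_diagonal, this]

theorem ext_class {α : G → ℂ} (hα : ∀ g x, α (g * x * g⁻¹) = α x) (i : Fin S.n) :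
    S.ext i α = ((∑ g, α g * S.χ i g) / S.d i) • 1 := by
  rw [← ext_trace]
  refine S.eq_smul_one_of_commute fun g => ?_
  simp only [ext, Finset.mul_sum, Finset.sum_mul, Matrix.mul_smul, Matrix.smul_mul, ← map_mul]
  refine Fintype.sum_equiv (MulAut.conj g).toEquiv _ _ fun x => ?_
  simp [hα]

theorem sum_conj_ρ (i : Fin S.n) (g : G) :
    ∑ x, S.ρ i (x * g * x⁻¹) = (Fintype.card G * S.χ i g / S.d i) • 1 := by
  have h : (∑ x, S.ρ i (x * g * x⁻¹)).trace = Fintype.card G * S.χ i g := by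
    rw [Matrix.trace_sum, Finset.sum_congr rfl fun x _ => show (S.ρ i (x * g * x⁻¹)).trace = S.χ i g
      from S.χ_conj i x g]
    simp
  rw [← h]
  refine S.eq_smul_one_of_commute fun y => ?_
  simp only [Finset.mul_sum, Finset.sum_mul, ← map_mul]
  refine Fintype.sum_equiv (Equiv.mulLeft y) _ _ fun x => ?_
  simp [mul_assoc]

/-- Structure-constant form of the second orthogonality relation. -/
theorem class_inversion {α : G → ℂ} (hα : ∀ g x, α (g * x * g⁻¹) = α x) (h : G) :
    ∑ i, (∑ g, α g * S.χ i g) * S.χ i h⁻¹ = Fintype.card G * α h := by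
  rw [← S.inversion]
  refine Finset.sum_congr rfl fun i _ => ?_
  rw [S.ext_class hα]
  have := S.d_ne_zero i
  simp only [Matrix.smul_mul, one_mul, Matrix.trace_smul, smul_eq_mul]
  rw [← χ]
  field_simp

theorem sum_χ_mul_χ_inv [DecidableEq G] (x y : G) :
    ∑ i, S.χ i x * S.χ i y⁻¹ = ((Finset.univ.filter fun g => g * x * g⁻¹ = y).card : ℂ) := by
  have h := S.class_inversion
    (α := fun z => ((Finset.univ.filter fun g => g * x * g⁻¹ = z).card : ℂ))
    (fun g z => by
      norm_cast
      refine Finset.card_equiv (Equiv.mulLeft g⁻¹) fun u => ?_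
      simp only [Finset.mem_filter, Finset.mem_univ, true_and, Equiv.coe_mulLeft, mul_inv_rev,
        inv_inv]
      constructor
      · intro h
        calc g⁻¹ * u * x * (u⁻¹ * g) = g⁻¹ * (u * x * u⁻¹) * g := by group
          _ = z := by rw [h]; group
      · intro h
        rw [← h]; group) y
  have h2 : ∀ i, ∑ z, ((Finset.univ.filter fun g => g * x * g⁻¹ = z).card : ℂ) * S.χ i z =
      Fintype.card G * S.χ i x := by
    intro i
    have : ∀ z, ((Finset.univ.filter fun g => g * x * g⁻¹ = z).card : ℂ) * S.χ i z =
        ∑ g ∈ Finset.univ.filter (fun g => g * x * g⁻¹ = z), S.χ i x := by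
      intro z
      rw [Finset.card_eq_sum_ones, Nat.cast_sum, Finset.sum_mul]
      refine Finset.sum_congr rfl fun g hg => ?_
      rw [← (Finset.mem_filter.1 hg).2, χ_conj]
      simp
    simp only [this]
    rw [Finset.sum_fiberwise]
    simp
  simp only [h2] at h
  have hc : (Fintype.card G : ℂ) ≠ 0 := by simp
  apply mul_left_cancel₀ hc
  simpa [mul_assoc, ← Finset.mul_sum] using h

theorem orthogonality (i j : Fin S.n) :
    ∑ g, S.χ i g⁻¹ * S.χ j g = if i = j then (Fintype.card G : ℂ) else 0 := by
  classical
  obtain ⟨α, hα⟩ := S.ext_surjective (Pi.single i 1)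
  have h1 : ∀ g, (Fintype.card G : ℂ) * α g = S.d i * S.χ i g⁻¹ := by
    intro g
    rw [← S.inversion, Finset.sum_eq_single i]
    · simp [hα, χ]
    · intro k _ hk
      simp [hα, Pi.single_eq_of_ne hk]
    · simp
  have h2 := S.ext_trace j α
  rw [hα] at h2
  have hd := S.d_ne_zero i
  apply mul_left_cancel₀ hd
  rw [Finset.mul_sum]
  simp only [← mul_assoc, ← h1]
  simp only [mul_assoc, ← Finset.mul_sum, ← h2]
  split_ifs with h
  · subst h; simp [mul_comm]
  · simp [Pi.single_eq_of_ne (Ne.symm h)]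

end WedderburnSystem

end

/-! ### Traces of matrices of finite order -/

section

section MatrixTrace

variable {d : ℕ}

theorem exists_trace_eq_natCast_of_isIdempotentElem {P : Matrix (Fin d) (Fin d) ℂ}
    (h : IsIdempotentElem P) : ∃ m : ℕ, P.trace = m := by
  have h' : IsIdempotentElem (Matrix.toLin' P) := h.map Matrix.toLinAlgEquiv'
  obtain ⟨p, hp⟩ := LinearMap.isProj_iff_isIdempotentElem _ |>.2 h'
  exact ⟨_, by rw [← Matrix.trace_toLin'_eq, hp.trace]⟩

theorem eq_zero_of_isIdempotentElem_of_trace {P : Matrix (Fin d) (Fin d) ℂ}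
    (h : IsIdempotentElem P) (h0 : P.trace = 0) : P = 0 := by
  have h' : IsIdempotentElem (Matrix.toLin' P) := h.map Matrix.toLinAlgEquiv'
  rw [← Matrix.trace_toLin'_eq, LinearMap.IsIdempotentElem.trace_eq_zero_iff h'] at h0
  simpa using h0

theorem isIdempotentElem_average {K : Type*} [Group K] [Fintype K]
    (r : K →* Matrix (Fin d) (Fin d) ℂ) (l : K →* ℂ) :
    IsIdempotentElem ((Fintype.card K : ℂ)⁻¹ • ∑ k, l k⁻¹ • r k) := by
  have hc : (Fintype.card K : ℂ) ≠ 0 := by simp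
  have h1 : ∀ x : K, (l x⁻¹ • r x) * ∑ k, l k⁻¹ • r k = ∑ k, l k⁻¹ • r k := by
    intro x
    rw [Finset.mul_sum]
    refine Fintype.sum_equiv (Equiv.mulLeft x) _ _ fun k => ?_
    simp [smul_smul, mul_comm]
  rw [IsIdempotentElem, smul_mul_smul_comm, Finset.sum_mul, Finset.sum_congr rfl fun x _ => h1 x]
  rw [Finset.sum_const, Finset.card_univ, ← Nat.cast_smul_eq_nsmul ℂ, smul_smul]
  congr 1
  field_simp

/-- The multiplicity of a linear character in a representation is a natural number. -/
theorem exists_multiplicity {K : Type*} [Group K] [Fintype K]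
    (r : K →* Matrix (Fin d) (Fin d) ℂ) (l : K →* ℂ) :
    ∃ m : ℕ, ∑ k, l k⁻¹ * (r k).trace = Fintype.card K * m := by
  obtain ⟨m, hm⟩ := exists_trace_eq_natCast_of_isIdempotentElem (isIdempotentElem_average r l)
  have hc : (Fintype.card K : ℂ) ≠ 0 := by simp
  refine ⟨m, ?_⟩
  rw [← hm]
  simp [Matrix.trace_sum, hc]

theorem sum_rep_eq_zero {K : Type*} [Group K] [Fintype K]
    (r : K →* Matrix (Fin d) (Fin d) ℂ) (h : ∑ k, (r k).trace = 0) : ∑ k, r k = 0 := by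
  have h1 := eq_zero_of_isIdempotentElem_of_trace (isIdempotentElem_average r 1)
    (by simp [Matrix.trace_sum, h])
  simpa using h1

/-- Traces of powers of a matrix of finite order. -/
theorem exists_trace_pow {n : ℕ} (hn : 0 < n) {A : Matrix (Fin d) (Fin d) ℂ} (hA : A ^ n = 1)
    {ζ : ℂ} (hζ : IsPrimitiveRoot ζ n) :
    ∃ m : ℕ → ℕ, ∀ k, (A ^ k).trace = ∑ j ∈ Finset.range n, m j * ζ ^ (j * k) := by
  have hn' : (n : ℂ) ≠ 0 := by exact_mod_cast hn.ne'
  have hζ0 : ζ ≠ 0 := hζ.ne_zero hn.ne'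
  have : NeZero n := ⟨hn.ne'⟩
  let P : ℕ → Matrix (Fin d) (Fin d) ℂ := fun j =>
    (n : ℂ)⁻¹ • ∑ k ∈ Finset.range n, (ζ ^ (j * k))⁻¹ • A ^ k
  have hPA : ∀ j, P j * A = ζ ^ j • P j := by
    intro j
    simp only [P, Matrix.smul_mul, smul_comm (ζ ^ j) (n : ℂ)⁻¹]
    congr 1
    have e : ∀ k, ζ ^ j • (ζ ^ (j * (k + 1)))⁻¹ • A ^ (k + 1) = ((ζ ^ (j * k))⁻¹ • A ^ k) * A := by
      intro k
      rw [smul_smul, Matrix.smul_mul, pow_succ A]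
      congr 1
      rw [mul_add, pow_add, mul_one]
      field_simp
    rw [Finset.sum_mul, Finset.smul_sum, ← Finset.sum_congr rfl fun k _ => e k]
    have h := Finset.sum_range_succ' (fun k => ζ ^ j • (ζ ^ (j * k))⁻¹ • A ^ k) n
    rw [Finset.sum_range_succ] at h
    have e2 : (ζ ^ (j * n))⁻¹ • A ^ n = (ζ ^ (j * 0))⁻¹ • A ^ 0 := by
      rw [hA, mul_comm, pow_mul, hζ.pow_eq_one]; simp
    rw [e2] at h
    exact (add_right_cancel h).symm
  have hPAk : ∀ j k, P j * A ^ k = ζ ^ (j * k) • P j := by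
    intro j k
    induction k with
    | zero => simp
    | succ k ih =>
      rw [pow_succ, ← mul_assoc, ih, Matrix.smul_mul, hPA, smul_smul, ← pow_add]
      congr 1
  have hidem : ∀ j, IsIdempotentElem (P j) := by
    intro j
    have : P j * P j = (n : ℂ)⁻¹ • ∑ k ∈ Finset.range n, (ζ ^ (j * k))⁻¹ • (P j * A ^ k) := by
      conv_lhs => enter [2]; simp only [P]
      rw [Matrix.mul_smul, Finset.mul_sum]
      simp
    rw [IsIdempotentElem, this]
    have e : ∀ k, (ζ ^ (j * k))⁻¹ • (P j * A ^ k) = P j := by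
      intro k
      rw [hPAk, smul_smul, inv_mul_cancel₀ (pow_ne_zero _ hζ0), one_smul]
    rw [Finset.sum_congr rfl fun k _ => e k, Finset.sum_const, Finset.card_range,
      ← Nat.cast_smul_eq_nsmul ℂ, smul_smul, inv_mul_cancel₀ hn', one_smul]
  have hsum : ∑ j ∈ Finset.range n, P j = 1 := by
    simp only [P]
    rw [← Finset.smul_sum, Finset.sum_comm]
    simp only [← Finset.sum_smul]
    rw [Finset.sum_eq_single 0]
    · simp [← Nat.cast_smul_eq_nsmul ℂ, smul_smul, hn']
    · intro k hk hk0
      rw [Finset.mem_range] at hk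
      have h1 : (ζ ^ k) ≠ 1 := hζ.pow_ne_one_of_pos_of_lt hk0 hk
      have h2 : ∑ j ∈ Finset.range n, (ζ ^ (j * k))⁻¹ = 0 := by
        have h3 : (ζ ^ k)⁻¹ ≠ 1 := by simpa using h1
        have h4 := geom_sum_eq h3 n
        rw [inv_pow, ← pow_mul, mul_comm, pow_mul, hζ.pow_eq_one] at h4
        simp only [one_pow, inv_one, sub_self, zero_div] at h4
        rw [← h4]
        refine Finset.sum_congr rfl fun j _ => ?_
        rw [mul_comm, pow_mul, inv_pow]
      rw [h2, zero_smul]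
    · intro h
      simp [hn.ne'] at h
  choose m hm using fun j => exists_trace_eq_natCast_of_isIdempotentElem (hidem j)
  refine ⟨m, fun k => ?_⟩
  conv_lhs => rw [← one_mul (A ^ k), ← hsum, Finset.sum_mul, Matrix.trace_sum]
  refine Finset.sum_congr rfl fun j _ => ?_
  rw [hPAk, Matrix.trace_smul, hm, smul_eq_mul, mul_comm]

theorem isIntegral_trace_of_pow_eq_one {n : ℕ} (hn : 0 < n) {A : Matrix (Fin d) (Fin d) ℂ}
    (hA : A ^ n = 1) : IsIntegral ℤ A.trace := by
  obtain ⟨m, hm⟩ := exists_trace_pow hn hA (Complex.isPrimitiveRoot_exp n hn.ne')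
  have h1 := hm 1
  rw [pow_one] at h1
  rw [h1]
  refine IsIntegral.sum _ fun j _ => IsIntegral.mul ?_ (IsIntegral.pow ?_ _)
  · exact_mod_cast (isIntegral_algebraMap (R := ℤ) (A := ℂ) (x := (m j : ℤ)))
  · exact (Complex.isPrimitiveRoot_exp n hn.ne').isIntegral hn

theorem trace_inv_eq_conj {n : ℕ} (hn : 0 < n) {A : Matrix (Fin d) (Fin d) ℂ} (hA : A ^ n = 1) :
    (A ^ (n - 1)).trace = (starRingEnd ℂ) A.trace := by
  have hζ := Complex.isPrimitiveRoot_exp n hn.ne'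
  obtain ⟨m, hm⟩ := exists_trace_pow hn hA hζ
  have h1 := hm 1
  rw [pow_one] at h1
  rw [h1, hm, map_sum]
  refine Finset.sum_congr rfl fun j _ => ?_
  rw [map_mul, map_natCast, map_pow, ← Complex.inv_eq_conj, mul_one, mul_comm j, pow_mul]
  · congr 2
    refine eq_inv_of_mul_eq_one_left ?_
    rw [← pow_succ, Nat.sub_add_cancel hn, hζ.pow_eq_one]
  · exact IsPrimitiveRoot.norm'_eq_one hζ hn.ne'

/-- An integral multiple of a character value all of whose conjugates are small vanishes. -/
theorem trace_eq_zero_of_small {n : ℕ} (hn : 0 < n) {A : Matrix (Fin d) (Fin d) ℂ}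
    (hA : A ^ n = 1) {c : ℕ} (hc : 0 < c) (hintegral : IsIntegral ℤ (A.trace / c))
    (hsmall : ∀ k, k.Coprime n → ‖(A ^ k).trace‖ < c) : A.trace = 0 := by
  have hζ := Complex.isPrimitiveRoot_exp n hn.ne'
  obtain ⟨m, hm⟩ := exists_trace_pow hn hA hζ
  have : NeZero n := ⟨hn.ne'⟩
  have : IsCyclotomicExtension {n} ℚ (CyclotomicField n ℚ) :=
    CyclotomicField.isCyclotomicExtension n ℚ
  have : NumberField (CyclotomicField n ℚ) := IsCyclotomicExtension.numberField {n} ℚ _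
  have hz := IsCyclotomicExtension.zeta_spec n ℚ (CyclotomicField n ℚ)
  set z := IsCyclotomicExtension.zeta n ℚ (CyclotomicField n ℚ)
  let x : CyclotomicField n ℚ := (∑ j ∈ Finset.range n, m j * z ^ j) / c
  have hc' : (c : ℂ) ≠ 0 := by exact_mod_cast hc.ne'
  have hσ : ∀ σ : CyclotomicField n ℚ →ₐ[ℚ] ℂ, ∃ k, k.Coprime n ∧ σ x = (A ^ k).trace / c := by
    intro σ
    have h1 : IsPrimitiveRoot (σ z) n := hz.map_of_injective σ.injective
    obtain ⟨k, -, hk, hk'⟩ := hζ.isPrimitiveRoot_iff.1 h1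
    refine ⟨k, hk, ?_⟩
    rw [hm]
    simp only [x, map_div₀, map_sum, map_mul, map_natCast, map_pow, ← hk']
    congr 1
    refine Finset.sum_congr rfl fun j _ => ?_
    rw [← pow_mul, mul_comm j]
  obtain ⟨σ0, hσ0⟩ : ∃ σ : CyclotomicField n ℚ →ₐ[ℚ] ℂ, σ x = A.trace / c := by
    have hmin : Polynomial.aeval (Complex.exp (2 * Real.pi * Complex.I / n)) (minpoly ℚ z) = 0 := by
      rw [← hz.minpoly_eq_cyclotomic_of_irreducible (Polynomial.cyclotomic.irreducible_rat hn),
        Polynomial.aeval_def, Polynomial.eval₂_eq_eval_map, Polynomial.map_cyclotomic]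
      exact hζ.isRoot_cyclotomic hn
    let pb := hz.powerBasis ℚ
    have h3 : pb.gen = z := by simp [pb]
    have h4 := pb.lift_gen (Complex.exp (2 * Real.pi * Complex.I / n)) (by simpa [pb] using hmin)
    generalize pb.lift (Complex.exp (2 * Real.pi * Complex.I / n)) _ = σ at h4
    refine ⟨σ, ?_⟩
    have h2 : σ z = Complex.exp (2 * Real.pi * Complex.I / n) := by rw [← h3, h4]
    have h1 := hm 1
    rw [pow_one] at h1
    rw [h1]
    simp only [x, map_div₀, map_sum, map_mul, map_natCast, map_pow, h2, mul_one]
  have hx : IsIntegral ℤ x := by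
    rw [← hσ0] at hintegral
    exact (isIntegral_algHom_iff (σ0.restrictScalars ℤ) σ0.injective).1 hintegral
  have hN : IsIntegral ℤ (Algebra.norm ℚ x) := Algebra.isIntegral_norm ℚ hx
  obtain ⟨N, hN⟩ := IsIntegrallyClosed.isIntegral_iff.1 hN
  have hprod := Algebra.norm_eq_prod_embeddings ℚ ℂ x
  by_contra hne
  have hx0 : x ≠ 0 := by
    intro h
    rw [h, map_zero] at hσ0
    exact hne (by field_simp at hσ0; simpa using hσ0.symm)
  have hlt : ‖∏ σ : CyclotomicField n ℚ →ₐ[ℚ] ℂ, σ x‖ < 1 := by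
    rw [norm_prod]
    have h1 : ∀ σ : CyclotomicField n ℚ →ₐ[ℚ] ℂ, ‖σ x‖ < 1 := by
      intro σ
      obtain ⟨k, hk, e⟩ := hσ σ
      rw [e, norm_div, Complex.norm_natCast, div_lt_one (by exact_mod_cast hc)]
      exact hsmall k hk
    calc ∏ σ : CyclotomicField n ℚ →ₐ[ℚ] ℂ, ‖σ x‖ < ∏ σ : CyclotomicField n ℚ →ₐ[ℚ] ℂ, (1 : ℝ) :=
          Finset.prod_lt_prod_of_nonempty (fun σ _ => by simpa using hx0) (fun σ _ => h1 σ)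
            ⟨σ0, Finset.mem_univ _⟩
      _ = 1 := by simp
  rw [← hprod, ← hN] at hlt
  have hN0 : N = 0 := by
    simp only [eq_intCast, map_intCast, Complex.norm_intCast] at hlt
    exact Int.abs_lt_one_iff.1 (by exact_mod_cast hlt)
  rw [hN0, map_zero] at hN
  exact hx0 (Algebra.norm_eq_zero_iff.1 hN.symm)

end MatrixTrace

end

/-! ### Character values -/

section

namespace WedderburnSystem

variable {G : Type*} [Group G] (S : WedderburnSystem G)

theorem ρ_pow_orderOf (i : Fin S.n) (g : G) : S.ρ i g ^ orderOf g = 1 := by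
  rw [← map_pow, pow_orderOf_eq_one, map_one]

variable [Fintype G]

theorem isIntegral_χ (i : Fin S.n) (g : G) : IsIntegral ℤ (S.χ i g) :=
  isIntegral_trace_of_pow_eq_one (orderOf_pos g) (S.ρ_pow_orderOf i g)

theorem χ_inv (i : Fin S.n) (g : G) : S.χ i g⁻¹ = (starRingEnd ℂ) (S.χ i g) := by
  rw [χ, χ, ← trace_inv_eq_conj (orderOf_pos g) (S.ρ_pow_orderOf i g), ← map_pow,
    inv_eq_of_mul_eq_one_left (a := g ^ (orderOf g - 1))]
  rw [← pow_succ, Nat.sub_add_cancel (orderOf_pos g), pow_orderOf_eq_one]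

theorem sum_norm_sq (g : G) :
    ∑ i, ‖S.χ i g‖ ^ 2 = Nat.card (Subgroup.centralizer {g}) := by
  classical
  have h := S.sum_χ_mul_χ_inv g g
  simp only [χ_inv, Complex.mul_conj, Complex.normSq_eq_norm_sq] at h
  have h2 : (Finset.univ.filter fun x => x * g * x⁻¹ = g).card =
      Nat.card (Subgroup.centralizer {g}) := by
    rw [Nat.card_eq_fintype_card, Fintype.card_subtype]
    congr 1
    ext x
    simp [Subgroup.mem_centralizer_singleton_iff, mul_inv_eq_iff_eq_mul]
  rw [h2] at h
  exact_mod_cast h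

/-- Central character values are algebraic integers. -/
theorem isIntegral_central {α : G → ℂ} (hα : ∀ g x, α (g * x * g⁻¹) = α x)
    (hintegral : ∀ g, IsIntegral ℤ (α g)) (i : Fin S.n) :
    IsIntegral ℤ ((∑ g, α g * S.χ i g) / S.d i) := by
  let O := integralClosure ℤ ℂ
  have key : IsIntegral O ((∑ g, α g * S.χ i g) / S.d i) := by
    refine isIntegral_of_smul_mem_submodule (Submodule.span O (Set.range (S.ρ i))) ?_
      (Submodule.fg_span (Set.finite_range _)) _ ?_
    · intro h
      have h1 : S.ρ i 1 ∈ Submodule.span O (Set.range (S.ρ i)) := Submodule.subset_span ⟨1, rfl⟩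
      rw [h, Submodule.mem_bot, map_one] at h1
      have := S.d_ne_zero i
      have h2 := congrArg Matrix.trace h1
      simp at h2
      exact this (by exact_mod_cast h2)
    · intro M hM
      have : ((∑ g, α g * S.χ i g) / S.d i) • M = S.ext i α * M := by
        rw [S.ext_class hα]; simp
      rw [this]
      clear this
      induction hM using Submodule.span_induction with
      | mem x hx =>
        obtain ⟨h, rfl⟩ := hx
        rw [ext, Finset.sum_mul]
        refine Submodule.sum_mem _ fun g _ => ?_
        rw [Matrix.smul_mul, ← map_mul]
        exact Submodule.smul_mem _ (⟨α g, hintegral g⟩ : O) (Submodule.subset_span ⟨_, rfl⟩)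
      | zero => simp
      | add x y _ _ hx hy => rw [mul_add]; exact add_mem hx hy
      | smul a x _ hx => rw [Matrix.mul_smul]; exact Submodule.smul_mem _ _ hx
  have : Algebra.IsIntegral ℤ O := integralClosure.AlgebraIsIntegral
  exact isIntegral_trans (R := ℤ) (A := O) _ key

theorem isIntegral_card_conj_mul_div [DecidableEq G] (i : Fin S.n) (z : G) :
    IsIntegral ℤ ((((Finset.univ.filter fun g => IsConj z g).card : ℂ) * S.χ i z) / S.d i) := by
  classical
  have h := S.isIntegral_central (α := fun g => if IsConj z g then 1 else 0) ?_ ?_ i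
  · convert h using 2
    simp only [ite_mul, one_mul, zero_mul, ← Finset.sum_filter]
    rw [Finset.sum_congr rfl (g := fun _ => S.χ i z), Finset.sum_const, nsmul_eq_mul]
    intro g hg
    obtain ⟨c, rfl⟩ := isConj_iff.1 (Finset.mem_filter.1 hg).2
    rw [χ_conj]
  · intro g x
    congr 1
    rw [eq_iff_iff]
    have : IsConj x (g * x * g⁻¹) := isConj_iff.2 ⟨g, rfl⟩
    exact ⟨fun h => h.trans this.symm, fun h => h.trans this⟩
  · intro g
    split_ifs
    exacts [isIntegral_one, isIntegral_zero]

theorem d_dvd_card (i : Fin S.n) : S.d i ∣ Fintype.card G := by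
  classical
  have h := S.isIntegral_central (α := fun g => S.χ i g⁻¹)
    (fun g x => by rw [← S.χ_conj i g x⁻¹]; congr 1; group) (fun g => S.isIntegral_χ i _) i
  rw [S.orthogonality, if_pos rfl] at h
  have hd := S.d_ne_zero i
  have h2 : ((Fintype.card G : ℂ) / S.d i) = algebraMap ℚ ℂ ((Fintype.card G : ℚ) / S.d i) := by
    simp
  rw [h2, isIntegral_algebraMap_iff (algebraMap ℚ ℂ).injective] at h
  obtain ⟨N, hN⟩ := IsIntegrallyClosed.isIntegral_iff.1 h
  have hd' : (S.d i : ℚ) ≠ 0 := by exact_mod_cast hd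
  rw [eq_div_iff hd'] at hN
  have : N * (S.d i : ℤ) = Fintype.card G := by
    simp only [eq_intCast] at hN
    exact_mod_cast hN
  exact_mod_cast Dvd.intro_left N this

theorem exists_trivial : ∃ i, ∀ g, S.χ i g = 1 := by
  classical
  have h := S.inversion (fun _ => 1) 1
  have hc : (Fintype.card G : ℂ) ≠ 0 := by simp
  obtain ⟨i, hi⟩ : ∃ i, S.ext i (fun _ => 1) ≠ 0 := by
    by_contra! hcon
    simp only [hcon, zero_mul, Matrix.trace_zero, mul_zero, Finset.sum_const_zero, mul_one] at h
    exact hc h.symm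
  have hclass := S.ext_class (α := fun _ => 1) (fun _ _ => rfl) i
  set c := (∑ g, 1 * S.χ i g) / (S.d i : ℂ)
  have hc0 : c ≠ 0 := by
    intro h0
    rw [h0, zero_smul] at hclass
    exact hi hclass
  have h1 : ∀ g, S.ρ i g = 1 := by
    intro g
    have e : S.ρ i g * S.ext i (fun _ => 1) = S.ext i (fun _ => 1) := by
      rw [ext, Finset.mul_sum]
      refine Fintype.sum_equiv (Equiv.mulLeft g) _ _ fun k => ?_
      simp
    rw [hclass, Matrix.mul_smul, mul_one] at e
    exact smul_right_injective _ hc0 e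
  have h2 : ∀ g, S.χ i g = S.d i := fun g => by simp [χ, h1]
  have h3 := S.orthogonality i i
  simp only [h2, if_true, Finset.sum_const, Finset.card_univ, nsmul_eq_mul] at h3
  have h4 : S.d i * S.d i = 1 := by
    have : (S.d i : ℂ) * S.d i = 1 := by
      apply mul_left_cancel₀ hc
      rw [h3, mul_one]
    exact_mod_cast this
  refine ⟨i, fun g => ?_⟩
  rw [h2, Nat.eq_one_of_mul_eq_one_left h4]
  simp

/-- The class-algebra structure constants in terms of characters. -/
theorem card_conj_mul_conj_eq [DecidableEq G] (g h z : G) :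
    ((Finset.univ.filter fun p : G × G =>
        (p.1 * g * p.1⁻¹) * (p.2 * h * p.2⁻¹) = z).card : ℂ) =
      Fintype.card G * ∑ i, S.χ i g * S.χ i h * S.χ i z⁻¹ / S.d i := by
  have hc : (Fintype.card G : ℂ) ≠ 0 := by simp
  have hfib := fun i => Finset.sum_fiberwise (Finset.univ : Finset (G × G))
    (fun p => (p.1 * g * p.1⁻¹) * (p.2 * h * p.2⁻¹))
    (fun p => S.χ i ((p.1 * g * p.1⁻¹) * (p.2 * h * p.2⁻¹)))
  have h1 := S.class_inversion (α := fun w => ((Finset.univ.filter fun p : G × G =>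
        (p.1 * g * p.1⁻¹) * (p.2 * h * p.2⁻¹) = w).card : ℂ)) (fun x w => by
      norm_cast
      refine Finset.card_equiv ((Equiv.mulLeft x⁻¹).prodCongr (Equiv.mulLeft x⁻¹)) fun u => ?_
      simp only [Finset.mem_filter, Finset.mem_univ, true_and, Equiv.prodCongr_apply, Prod.map_fst,
        Prod.map_snd, Equiv.coe_mulLeft, mul_inv_rev, inv_inv]
      have e : x⁻¹ * u.1 * g * (u.1⁻¹ * x) * (x⁻¹ * u.2 * h * (u.2⁻¹ * x)) =
        x⁻¹ * (u.1 * g * u.1⁻¹ * (u.2 * h * u.2⁻¹)) * x := by group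
      rw [e]
      constructor
      · intro h
        rw [h]; group
      · intro h
        rw [← h]; group) z
  have h2 : ∀ i, ∑ w, ((Finset.univ.filter fun p : G × G =>
        (p.1 * g * p.1⁻¹) * (p.2 * h * p.2⁻¹) = w).card : ℂ) * S.χ i w =
      Fintype.card G * (Fintype.card G * (S.χ i g * S.χ i h / S.d i)) := by
    intro i
    have e : ∀ w, ((Finset.univ.filter fun p : G × G =>
        (p.1 * g * p.1⁻¹) * (p.2 * h * p.2⁻¹) = w).card : ℂ) * S.χ i w =
        ∑ p ∈ Finset.univ.filter (fun p : G × G =>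
          (p.1 * g * p.1⁻¹) * (p.2 * h * p.2⁻¹) = w),
          S.χ i ((p.1 * g * p.1⁻¹) * (p.2 * h * p.2⁻¹)) := by
      intro w
      rw [Finset.card_eq_sum_ones, Nat.cast_sum, Finset.sum_mul]
      refine Finset.sum_congr rfl fun p hp => ?_
      rw [(Finset.mem_filter.1 hp).2]
      simp
    rw [Finset.sum_congr rfl fun w _ => e w, hfib]
    have e2 : (∑ x, S.ρ i (x * g * x⁻¹)) * (∑ y, S.ρ i (y * h * y⁻¹)) =
        ∑ p : G × G, S.ρ i ((p.1 * g * p.1⁻¹) * (p.2 * h * p.2⁻¹)) := by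
      rw [Finset.sum_mul_sum, Fintype.sum_prod_type]
      simp
    have e3 := congrArg Matrix.trace e2
    rw [Matrix.trace_sum, sum_conj_ρ, sum_conj_ρ, smul_mul_smul_comm, Matrix.trace_smul, mul_one,
      Matrix.trace_one, Fintype.card_fin] at e3
    have hd := S.d_ne_zero i
    refine e3.symm.trans ?_
    rw [smul_eq_mul]
    field_simp
  simp only [h2] at h1
  apply mul_left_cancel₀ hc
  rw [← h1, Finset.mul_sum, Finset.mul_sum]
  refine Finset.sum_congr rfl fun i _ => ?_
  ring

end WedderburnSystem

end

/-! ### Sylow counting and the prime graph -/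

section

section GroupTheory

open Subgroup

variable {G : Type*} [Group G] [Finite G]

theorem Subgroup.exists_card_normalizer_eq (H : Subgroup G) [IsCyclic H] :
    ∃ e, e ∣ (Nat.card H).totient ∧
      Nat.card (normalizer (H : Set G)) = Nat.card (centralizer (H : Set G)) * e := by
  have key := card_dvd_of_injective _ (QuotientGroup.kerLift_injective H.normalizerMonoidHom)
  rw [normalizerMonoidHom_ker, ← index, ← relIndex, IsCyclic.card_mulAut] at key
  refine ⟨_, key, ?_⟩
  rw [mul_comm, relIndex,
    ← Nat.card_congr (subgroupOfEquivOfLe (centralizer_le_normalizer (H : Set G))).toEquiv,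
    index_mul_card]

theorem Subgroup.card_mul_relIndex {H K : Subgroup G} (h : H ≤ K) :
    Nat.card H * H.relIndex K = Nat.card K := by
  rw [← relIndex_bot_left, relIndex_mul_relIndex _ _ _ bot_le h, relIndex_bot_left]

theorem Sylow.coe_eq_zpowers_of_orderOf {p : ℕ} [Fact p.Prime] {M : ℕ}
    (hcard : Nat.card G = p * M) (hM : ¬ p ∣ M) {x : G} (hx : orderOf x = p) :
    ∃ P : Sylow p G, (P : Subgroup G) = zpowers x := by
  have hM0 : M ≠ 0 := by rintro rfl; simp at hM
  have hp : p.Prime := Fact.out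
  refine ⟨Sylow.ofCard (zpowers x) ?_, Sylow.coe_ofCard _ _⟩
  rw [Nat.card_zpowers, hx, hcard, Nat.factorization_mul hp.ne_zero hM0]
  simp [hp.factorization, Nat.factorization_eq_zero_of_not_dvd hM]

omit [Finite G] in
theorem mem_centralizer_zpowers {x g : G} :
    g ∈ centralizer (zpowers x : Set G) ↔ g * x = x * g := by
  rw [zpowers_eq_closure, centralizer_closure, mem_centralizer_singleton_iff]

theorem exists_conj_zpowers {p : ℕ} [Fact p.Prime] {M : ℕ}
    (hcard : Nat.card G = p * M) (hM : ¬ p ∣ M) {x y : G} (hx : orderOf x = p)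
    (hy : orderOf y = p) : ∃ g : G, g * y * g⁻¹ ∈ zpowers x := by
  obtain ⟨P, hP⟩ := Sylow.coe_eq_zpowers_of_orderOf hcard hM hx
  obtain ⟨Q, hQ⟩ := Sylow.coe_eq_zpowers_of_orderOf hcard hM hy
  obtain ⟨g, hg⟩ := MulAction.exists_smul_eq G Q P
  refine ⟨g, ?_⟩
  rw [← hP, ← hg]
  exact smul_mem_pointwise_smul y (MulAut.conj g) (Q : Subgroup G) (hQ ▸ mem_zpowers y)

theorem Subgroup.exists_orderOf_mem {p : ℕ} (hp : p.Prime) {H : Subgroup G}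
    (h : p ∣ Nat.card H) : ∃ x ∈ H, orderOf x = p := by
  have := Fact.mk hp
  obtain ⟨x, hx⟩ := exists_prime_orderOf_dvd_card' p h
  exact ⟨x, x.2, by simpa using hx⟩

theorem commute_of_mem_zpowers {p : ℕ} [Fact p.Prime] {x y g : G} (hx : orderOf x = p)
    (hy : orderOf y = p) (hyx : y ∈ zpowers x) (hg : Commute g y) : Commute g x := by
  have h1 : zpowers y = zpowers x := by
    refine eq_of_le_of_card_ge (zpowers_le.2 hyx) ?_
    rw [Nat.card_zpowers, Nat.card_zpowers, hx, hy]
  obtain ⟨k, rfl⟩ := mem_zpowers_iff.1 (h1 ▸ mem_zpowers x)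
  exact hg.zpow_right k

theorem exists_card_centralizer_eq {p : ℕ} [hp : Fact p.Prime] {M : ℕ}
    (hcard : Nat.card G = p * M) (hM : ¬ p ∣ M) (hdeg : gkDegree G p = 1) {x : G}
    (hx : orderOf x = p) :
    ∃ r k, r.Prime ∧ r ≠ p ∧ 1 ≤ k ∧ Nat.card (centralizer {x}) = p * r ^ k := by
  rw [gkDegree, Nat.card_eq_one_iff_unique] at hdeg
  obtain ⟨⟨huniq⟩, ⟨r, hpr, -, hr, g, hg⟩⟩ := hdeg
  obtain ⟨m, hm⟩ : p ∣ Nat.card (centralizer {x}) := by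
    rw [← hx, ← Nat.card_zpowers]
    exact card_dvd_of_le (by simp [mem_centralizer_singleton_iff])
  have hpm : ¬ p ∣ m := by
    rintro ⟨l, rfl⟩
    have := card_subgroup_dvd_card (centralizer {x})
    rw [hm, hcard] at this
    exact hM ((dvd_mul_right p l).trans (Nat.dvd_of_mul_dvd_mul_left hp.out.pos this))
  have hm0 : m ≠ 0 := by rintro rfl; simp at hpm
  have hdvd : ∀ {s : ℕ}, s.Prime → s ∣ m → s = r := by
    intro s hs hsm
    have hps : p ≠ s := by rintro rfl; exact hpm hsm
    obtain ⟨y, hy, hys⟩ := exists_orderOf_mem hs (hm ▸ hsm.mul_left p)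
    have hxy : Commute x y := (mem_centralizer_singleton_iff.1 hy).symm
    have hord := hxy.orderOf_mul_eq_mul_orderOf_of_coprime
      (by rw [hx, hys]; exact (Nat.coprime_primes hp.out hs).2 hps)
    rw [hx, hys] at hord
    exact congrArg Subtype.val
      (huniq ⟨s, hps, hp.out, hs, x * y, hord⟩ ⟨r, hpr, hp.out, hr, g, hg⟩)
  have hrm : r ∣ m := by
    have h1 : orderOf (g ^ r) = p := by
      rw [orderOf_pow, hg, Nat.gcd_mul_left_left, Nat.mul_div_cancel _ hr.pos]
    have h2 : orderOf (g ^ p) = r := by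
      rw [orderOf_pow, hg, Nat.gcd_mul_right_left, Nat.mul_div_cancel_left _ hp.out.pos]
    obtain ⟨h, hh⟩ := exists_conj_zpowers hcard hM hx h1
    have h3 : Commute (h * g ^ p * h⁻¹) x := by
      refine commute_of_mem_zpowers hx ?_ hh ?_
      · rw [← MulAut.conj_apply, MulEquiv.orderOf_eq, h1]
      · rw [← MulAut.conj_apply, ← MulAut.conj_apply]
        exact ((Commute.refl g).pow_pow p r).map (MulAut.conj h)
    have h4 : r ∣ Nat.card (centralizer {x}) := by
      rw [← h2, ← MulEquiv.orderOf_eq (MulAut.conj h), ← Nat.card_zpowers]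
      refine card_dvd_of_le ?_
      rw [zpowers_le, mem_centralizer_singleton_iff]
      exact h3
    rw [hm] at h4
    exact (hr.dvd_mul.1 h4).resolve_left fun h =>
      hpr ((Nat.prime_dvd_prime_iff_eq hr hp.out).1 h).symm
  have hmr := Nat.eq_prime_pow_of_unique_prime_dvd hm0 hdvd
  refine ⟨r, _, hr, hpr.symm, ?_, hmr ▸ hm⟩
  rw [Nat.one_le_iff_ne_zero]
  intro h0
  rw [h0, pow_zero] at hmr
  exact hr.one_lt.ne' (Nat.dvd_one.1 (hmr ▸ hrm))

theorem exists_local_structure {p : ℕ} [hp : Fact p.Prime] {M : ℕ}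
    (hcard : Nat.card G = p * M) (hM : ¬ p ∣ M) (hdeg : gkDegree G p = 1) {x : G}
    (hx : orderOf x = p) :
    ∃ r k e s, r.Prime ∧ r ≠ p ∧ 1 ≤ k ∧ Nat.card (centralizer {x}) = p * r ^ k ∧
      Nat.card (normalizer (zpowers x : Set G)) = p * r ^ k * e ∧ e ∣ p - 1 ∧
      M = r ^ k * e * s ∧ s % p = 1 := by
  obtain ⟨r, k, hr, hrp, hk, hC⟩ := exists_card_centralizer_eq hcard hM hdeg hx
  obtain ⟨e, he, hN⟩ := (zpowers x).exists_card_normalizer_eq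
  have h1 : centralizer (zpowers x : Set G) = centralizer {x} := by
    ext g
    rw [mem_centralizer_zpowers, mem_centralizer_singleton_iff]
  rw [h1, hC] at hN
  rw [Nat.card_zpowers, hx, Nat.totient_prime hp.out] at he
  obtain ⟨P, hP⟩ := Sylow.coe_eq_zpowers_of_orderOf hcard hM hx
  have h2 := P.card_eq_index_normalizer
  have h3 := card_sylow_modEq_one p G
  rw [h2, ← Sylow.coe_coe, hP] at h3
  have h4 := card_mul_index (normalizer (zpowers x : Set G))
  rw [hN, hcard, mul_assoc, mul_assoc] at h4
  refine ⟨r, k, e, (normalizer (zpowers x : Set G)).index, hr, hrp, hk, hC, hN, he, ?_, ?_⟩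
  · rw [← Nat.eq_of_mul_eq_mul_left hp.out.pos h4, mul_assoc]
  · rw [h3, Nat.mod_eq_of_lt hp.out.one_lt]

theorem local_structure_numeric {r k e s : ℕ} (p : ℕ) {N : ℕ} (hr : r.Prime) (hrp : r ≠ p)
    (hk : 1 ≤ k)
    (he0 : p - 1 = 138 ∧ p = 139 ∧ N = 67 ∨ p - 1 = 66 ∧ p = 67 ∧ N = 139) (he : e ∣ p - 1)
    (hM : 2 ^ 7 * 3 * 7 ^ 4 * 97 ^ 3 * N = r ^ k * e * s) (hs : s % p = 1) :
    r ^ k = N ∧ e = 3 := by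
  have hdvd : r ∣ 2 ^ 7 * 3 * 7 ^ 4 * 97 ^ 3 * N := by
    rw [hM, mul_assoc]; exact (dvd_pow_self r (by omega)).mul_right _
  have hr' : r ∈ [2, 3, 7, 97, 67, 139] := by
    have hN : N.Prime := by rcases he0 with ⟨-, -, rfl⟩ | ⟨-, -, rfl⟩ <;> norm_num
    have hrN : r ∣ N → r = N := fun h => (Nat.prime_dvd_prime_iff_eq hr hN).1 h
    simp only [hr.dvd_mul] at hdvd
    have h2 : r ∣ 2 ^ 7 → r = 2 := fun h =>
      (Nat.prime_dvd_prime_iff_eq hr (by norm_num)).1 (hr.dvd_of_dvd_pow h)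
    have h3 : r ∣ 3 → r = 3 := fun h => (Nat.prime_dvd_prime_iff_eq hr (by norm_num)).1 h
    have h7 : r ∣ 7 ^ 4 → r = 7 := fun h =>
      (Nat.prime_dvd_prime_iff_eq hr (by norm_num)).1 (hr.dvd_of_dvd_pow h)
    have h97 : r ∣ 97 ^ 3 → r = 97 := fun h =>
      (Nat.prime_dvd_prime_iff_eq hr (by norm_num)).1 (hr.dvd_of_dvd_pow h)
    simp only [List.mem_cons, List.not_mem_nil, or_false]
    omega
  have hk8 : k < 8 := by
    by_contra! hk8
    have h8 : r ^ 8 ∣ 2 ^ 7 * 3 * 7 ^ 4 * 97 ^ 3 * N := by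
      rw [hM, mul_assoc]; exact (pow_dvd_pow r hk8).mul_right _
    simp only [List.mem_cons, List.not_mem_nil, or_false] at hr'
    rcases he0 with ⟨-, -, rfl⟩ | ⟨-, -, rfl⟩ <;>
      rcases hr' with rfl | rfl | rfl | rfl | rfl | rfl <;> revert h8 <;> norm_num
  have hpos : 0 < r ^ k * e := by
    rcases Nat.eq_zero_or_pos (r ^ k * e) with h | h
    · rw [h, zero_mul] at hM
      rcases he0 with ⟨-, -, rfl⟩ | ⟨-, -, rfl⟩ <;> norm_num at hM
    · exact h
  have hdvd' : r ^ k * e ∣ 2 ^ 7 * 3 * 7 ^ 4 * 97 ^ 3 * N := ⟨s, hM⟩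
  have hs' : (2 ^ 7 * 3 * 7 ^ 4 * 97 ^ 3 * N / (r ^ k * e)) % p = 1 := by
    rw [hM, Nat.mul_div_cancel_left _ hpos, hs]
  have check139 : ∀ r ∈ [2, 3, 7, 97, 67, 139], ∀ k < 8, ∀ e ∈ [1, 2, 3, 6, 23, 46, 69, 138],
      r ≠ 139 → 1 ≤ k → r ^ k * e ∣ 2 ^ 7 * 3 * 7 ^ 4 * 97 ^ 3 * 67 →
      (2 ^ 7 * 3 * 7 ^ 4 * 97 ^ 3 * 67 / (r ^ k * e)) % 139 = 1 → r ^ k = 67 ∧ e = 3 := by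
    decide +kernel
  have check67 : ∀ r ∈ [2, 3, 7, 97, 67, 139], ∀ k < 8, ∀ e ∈ [1, 2, 3, 6, 11, 22, 33, 66],
      r ≠ 67 → 1 ≤ k → r ^ k * e ∣ 2 ^ 7 * 3 * 7 ^ 4 * 97 ^ 3 * 139 →
      (2 ^ 7 * 3 * 7 ^ 4 * 97 ^ 3 * 139 / (r ^ k * e)) % 67 = 1 → r ^ k = 139 ∧ e = 3 := by
    decide +kernel
  have d138 : ∀ e < 139, e ∣ 138 → e ∈ [1, 2, 3, 6, 23, 46, 69, 138] := by decide +kernel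
  have d66 : ∀ e < 67, e ∣ 66 → e ∈ [1, 2, 3, 6, 11, 22, 33, 66] := by decide +kernel
  rcases he0 with ⟨h1, rfl, rfl⟩ | ⟨h1, rfl, rfl⟩ <;> rw [h1] at he
  · exact check139 r hr' k hk8 e (d138 e (by have := Nat.le_of_dvd (by norm_num) he; omega) he)
      hrp hk hdvd' hs'
  · exact check67 r hr' k hk8 e (d66 e (by have := Nat.le_of_dvd (by norm_num) he; omega) he)
      hrp hk hdvd' hs'

/-- The local structure of `G` at the primes `67` and `139`: a self-centralizing cyclic Hall
subgroup `T` of order `9313 = 67 * 139`. -/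
structure IsolatedHall (G : Type*) [Group G] (T : Subgroup G) : Prop where
  card_group : Nat.card G = 2 ^ 7 * 3 * 7 ^ 4 * 67 * 97 ^ 3 * 139
  cyclic : IsCyclic T
  card : Nat.card T = 9313
  mem_of_commute : ∀ t ∈ T, t ≠ 1 → ∀ g, Commute g t → g ∈ T
  card_normalizer : Nat.card (normalizer (T : Set G)) = 3 * 9313

theorem exists_isolatedHall (hG : Nat.card G = 2 ^ 7 * 3 * 7 ^ 4 * 67 * 97 ^ 3 * 139)
    (h67 : gkDegree G 67 = 1) (h139 : gkDegree G 139 = 1) : ∃ T : Subgroup G, IsolatedHall G T := by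
  have : Fact (Nat.Prime 67) := ⟨by norm_num⟩
  have : Fact (Nat.Prime 139) := ⟨by norm_num⟩
  have c139 : ∀ {x : G}, orderOf x = 139 → Nat.card (centralizer {x}) = 9313 ∧
      Nat.card (normalizer (zpowers x : Set G)) = 3 * 9313 := by
    intro x hx
    obtain ⟨r, k, e, s, hr, hrp, hk, hC, hN, he, hM, hs⟩ := exists_local_structure
      (M := 2 ^ 7 * 3 * 7 ^ 4 * 97 ^ 3 * 67) (by rw [hG]; norm_num) (by norm_num) h139 hx
    obtain ⟨h1, h2⟩ := local_structure_numeric 139 hr hrp hk (by norm_num) he hM hs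
    rw [hN, hC, h1, h2]; norm_num
  have c67 : ∀ {x : G}, orderOf x = 67 → Nat.card (centralizer {x}) = 9313 := by
    intro x hx
    obtain ⟨r, k, e, s, hr, hrp, hk, hC, hN, he, hM, hs⟩ := exists_local_structure
      (M := 2 ^ 7 * 3 * 7 ^ 4 * 97 ^ 3 * 139) (by rw [hG]; norm_num) (by norm_num) h67 hx
    obtain ⟨h1, h2⟩ := local_structure_numeric 67 hr hrp hk (by norm_num) he hM hs
    rw [hC, h1]
  obtain ⟨x, hx⟩ := exists_prime_orderOf_dvd_card' (G := G) 139 (by rw [hG]; norm_num)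
  have hCx := (c139 hx).1
  obtain ⟨y, hyC, hy⟩ := exists_orderOf_mem (p := 67) (by norm_num)
    (H := centralizer {x}) (by rw [hCx]; norm_num)
  have hyx : Commute y x := mem_centralizer_singleton_iff.1 hyC
  have hxy : orderOf (y * x) = 9313 := by
    rw [hyx.orderOf_mul_eq_mul_orderOf_of_coprime (by rw [hx, hy]; norm_num), hx, hy]
  let T := zpowers (y * x)
  have hT : Nat.card T = 9313 := by rw [Nat.card_zpowers, hxy]
  have hcyc : IsCyclic T := inferInstance
  have hcomm : ∀ a ∈ T, ∀ b ∈ T, Commute a b := by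
    intro a ha b hb
    obtain ⟨k, rfl⟩ := mem_zpowers_iff.1 ha
    obtain ⟨l, rfl⟩ := mem_zpowers_iff.1 hb
    exact ((Commute.refl (y * x)).zpow_zpow k l)
  have hTC : ∀ a ∈ T, Nat.card (centralizer {a}) = 9313 → centralizer {a} = T := by
    intro a ha h
    refine (eq_of_le_of_card_ge ?_ (by rw [h, hT])).symm
    exact fun b hb => mem_centralizer_singleton_iff.2 (hcomm b hb a ha)
  have hCall : ∀ t ∈ T, t ≠ 1 → ∀ g, Commute g t → g ∈ T := by
    intro t ht ht1 g hg
    have hord : orderOf t ∣ 9313 := by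
      rw [← hT]; exact orderOf_dvd_natCard T ht
    have hk : ∃ k, orderOf (t ^ k) = 139 ∨ orderOf (t ^ k) = 67 := by
      have h1 : orderOf t ≠ 1 := by rwa [Ne, orderOf_eq_one_iff]
      obtain ⟨p, hp, k, hk⟩ := Nat.exists_prime_and_dvd h1
      have h0 : k ≠ 0 := by rintro rfl; rw [mul_zero] at hk; rw [hk] at hord; norm_num at hord
      have h2 : orderOf (t ^ k) = p := by
        rw [orderOf_pow, hk, Nat.gcd_mul_left_left, Nat.mul_div_cancel _ (by omega)]
      have h3 : p ∣ 67 * 139 := (hk ▸ dvd_mul_right p k).trans hord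
      refine ⟨k, ?_⟩
      rw [h2]
      rcases hp.dvd_mul.1 h3 with h | h
      · right; exact (Nat.prime_dvd_prime_iff_eq hp (by norm_num)).1 h
      · left; exact (Nat.prime_dvd_prime_iff_eq hp (by norm_num)).1 h
    obtain ⟨k, hk⟩ := hk
    rw [← hTC (t ^ k) (pow_mem ht k) (hk.elim (fun h => (c139 h).1) c67)]
    exact mem_centralizer_singleton_iff.2 (hg.pow_right k)
  refine ⟨T, hG, hcyc, hT, hCall, ?_⟩
  have hxT : x ∈ T := by
    refine hCall (y * x) (mem_zpowers _) ?_ x ?_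
    · intro h
      rw [h, orderOf_one] at hxy
      norm_num at hxy
    · exact hyx.symm.mul_right (Commute.refl x)
  have hyT : y ∈ T := by
    simpa using mul_mem (mem_zpowers (y * x)) (inv_mem hxT)
  have hmem : ∀ n, n ∈ zpowers x ↔ n ∈ T ∧ n ^ 139 = 1 := by
    intro n
    constructor
    · intro hn
      obtain ⟨k, rfl⟩ := mem_zpowers_iff.1 hn
      exact ⟨zpow_mem hxT k, by rw [← zpow_natCast, zpow_comm, zpow_natCast, ← hx,
        pow_orderOf_eq_one, one_zpow]⟩
    · rintro ⟨hn, h1⟩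
      obtain ⟨k, rfl⟩ := mem_zpowers_iff.1 hn
      rw [← zpow_natCast, ← zpow_mul, ← orderOf_dvd_iff_zpow_eq_one, hxy] at h1
      obtain ⟨l, rfl⟩ : (67 : ℤ) ∣ k := by omega
      rw [zpow_mul, hyx.mul_zpow, ← Nat.cast_ofNat, zpow_natCast, zpow_natCast, ← hy,
        pow_orderOf_eq_one, one_mul]
      exact zpow_mem (pow_mem (mem_zpowers x) _) l
  rw [← (c139 hx).2]
  congr 2
  apply le_antisymm
  · intro g hg
    rw [mem_normalizer_iff] at hg ⊢
    intro n
    rw [hmem, hmem, ← hg, conj_pow, mul_inv_eq_one, mul_eq_left]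
  · rw [← hTC x hxT hCx, ← centralizer_closure, ← zpowers_eq_closure]
    intro g hg
    rw [mem_normalizer_iff] at hg ⊢
    have key : ∀ g n : G, (∀ h, h ∈ zpowers x ↔ g * h * g⁻¹ ∈ zpowers x) →
        n ∈ centralizer (zpowers x : Set G) → g * n * g⁻¹ ∈ centralizer (zpowers x : Set G) := by
      intro g n hg hn
      rw [mem_centralizer_iff] at hn ⊢
      intro h hh
      have h1 : g⁻¹ * h * g ∈ zpowers x := by
        rw [hg, show g * (g⁻¹ * h * g) * g⁻¹ = h by group]
        exact hh
      have := hn _ h1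
      calc h * (g * n * g⁻¹) = g * ((g⁻¹ * h * g) * n) * g⁻¹ := by group
        _ = _ := by rw [this]; group
    refine fun n => ⟨key g n hg, fun h => ?_⟩
    convert key g⁻¹ _ (fun h => ?_) h using 1
    · group
    · rw [hg (g⁻¹ * h * g⁻¹⁻¹)]
      have : g * (g⁻¹ * h * g⁻¹⁻¹) * g⁻¹ = h := by group
      rw [this]

theorem exists_commute_of_normalizer_le_centralizer {M : Type*} [Group M] [Finite M] {p r : ℕ}
    [hp : Fact p.Prime] [hr : Fact r.Prime] (hpr : p ≠ r) (P : Sylow p M)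
    (hP : normalizer (P : Set M) ≤ centralizer (P : Set M)) (hpM : p ∣ Nat.card M)
    (hmod : ¬ r ^ (Nat.card M).factorization r ≡ 1 [MOD p]) :
    ∃ x y : M, orderOf x = p ∧ y ≠ 1 ∧ Commute x y ∧ ∃ k, y ^ r ^ k = 1 := by
  set K := (MonoidHom.transferSylow P hP).ker with hK
  have hcomp := MonoidHom.ker_transferSylow_isComplement' P hP
  obtain ⟨Q⟩ : Nonempty (Sylow r K) := inferInstance
  let N := normalizer ((Q : Subgroup K).map K.subtype : Set M)
  have hN : N ⊔ K = ⊤ := Sylow.normalizer_sup_eq_top Q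
  have hPM : p ∣ Nat.card P := P.dvd_card_of_dvd_card hpM
  have hPN : p ∣ Nat.card N := by
    have h1 : K.relIndex N = Nat.card P := by
      rw [← hcomp.symm.index_eq_card, ← hK, ← relIndex_top_right, ← hN, relIndex_sup_right]
    exact hPM.trans (h1 ▸ K.relIndex_dvd_card N)
  obtain ⟨x, hx⟩ := exists_prime_orderOf_dvd_card' p hPN
  have hQ : Nat.card ((Q : Subgroup K).map K.subtype) = r ^ (Nat.card M).factorization r := by
    rw [card_map_of_injective K.subtype_injective, Q.card_eq_multiplicity, ← hcomp.card_mul_card,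
      ← hK,
      Nat.factorization_mul Nat.card_pos.ne' Nat.card_pos.ne']
    rw [Sylow.card_eq_multiplicity, hp.out.factorization_pow]
    simp [hpr.symm]
  let φ : zpowers x →* MulAut ((Q : Subgroup K).map K.subtype) :=
    (normalizerMonoidHom _).comp (zpowers x).subtype
  let := MulAction.compHom ((Q : Subgroup K).map K.subtype) φ
  have hpg : IsPGroup p (zpowers x) := IsPGroup.of_card (n := 1) (by
    rw [Nat.card_zpowers, hx, pow_one])
  have hfix := hpg.card_modEq_card_fixedPoints ((Q : Subgroup K).map K.subtype)
  rw [hQ] at hfix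
  by_contra! hcon
  refine hmod (hfix.trans ?_)
  have : Nat.card (MulAction.fixedPoints (zpowers x) ((Q : Subgroup K).map K.subtype)) = 1 := by
    rw [Nat.card_eq_one_iff_unique]
    have hone : ∀ y ∈ MulAction.fixedPoints (zpowers x) ((Q : Subgroup K).map K.subtype),
        y = 1 := by
      intro y hy
      by_contra hne
      have h1 := hy ⟨x, mem_zpowers x⟩
      have h2 : (x : M) * y * (x : M)⁻¹ = y := congrArg Subtype.val h1
      obtain ⟨k, hk⟩ := IsPGroup.iff_orderOf.1 (Q.2.map K.subtype) y
      refine hcon x y (by simpa using hx) (by simpa using hne) (mul_inv_eq_iff_eq_mul.1 h2) k ?_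
      rw [← hk]
      exact_mod_cast pow_orderOf_eq_one y
    refine ⟨⟨fun a b => Subtype.ext ((hone a a.2).trans (hone b b.2).symm)⟩,
      ⟨1, fun g => map_one (φ g)⟩⟩
  rw [this]

/-- `g` has no nontrivial conjugate in `T`. -/
def RegularFor (T : Subgroup G) (g : G) : Prop := ∀ x, x * g * x⁻¹ ∈ T → g = 1

namespace IsolatedHall

variable {T : Subgroup G} (hT : IsolatedHall G T)
include hT

theorem exists_orderOf_eq {p : ℕ} (hp : p = 67 ∨ p = 139) : ∃ x ∈ T, orderOf x = p := by
  refine exists_orderOf_mem ?_ ?_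
  · rcases hp with rfl | rfl <;> norm_num
  · rw [hT.card]; rcases hp with rfl | rfl <;> norm_num

theorem exists_conj_mem {y : G} (hy : orderOf y = 67 ∨ orderOf y = 139) :
    ∃ x, x * y * x⁻¹ ∈ T := by
  obtain ⟨x, hx, hxy⟩ := hT.exists_orderOf_eq hy
  have hle : zpowers x ≤ T := (zpowers_le).2 hx
  rcases hy with hy | hy
  · have : Fact (Nat.Prime 67) := ⟨by norm_num⟩
    obtain ⟨g, hg⟩ := exists_conj_zpowers (M := 2 ^ 7 * 3 * 7 ^ 4 * 97 ^ 3 * 139)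
      (by rw [hT.card_group]; norm_num) (by norm_num) (hxy.trans hy) hy
    exact ⟨g, hle hg⟩
  · have : Fact (Nat.Prime 139) := ⟨by norm_num⟩
    obtain ⟨g, hg⟩ := exists_conj_zpowers (M := 2 ^ 7 * 3 * 7 ^ 4 * 97 ^ 3 * 67)
      (by rw [hT.card_group]; norm_num) (by norm_num) (hxy.trans hy) hy
    exact ⟨g, hle hg⟩

theorem conj_mem_of_commute {x g t : G} (ht : x * t * x⁻¹ ∈ T) (ht1 : t ≠ 1)
    (hg : Commute g t) : x * g * x⁻¹ ∈ T := by
  refine hT.mem_of_commute _ ht ?_ _ ?_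
  · rwa [Ne, conj_eq_one_iff]
  · exact hg.map (MulAut.conj x)

theorem orderOf_mem {t : G} (ht : t ∈ T) : orderOf t ∣ 9313 := by
  rw [← hT.card]; exact orderOf_dvd_natCard T ht

theorem coprime_card_centralizer {g : G} (hg : RegularFor T g) (hg1 : g ≠ 1) :
    (Nat.card (centralizer {g})).Coprime 9313 := by
  have key : ∀ p : ℕ, p.Prime → (p = 67 ∨ p = 139) → p.Coprime (Nat.card (centralizer {g})) := by
    intro p hp h67
    rw [hp.coprime_iff_not_dvd]
    intro hdvd
    obtain ⟨y, hy, hyp⟩ := exists_orderOf_mem hp hdvd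
    obtain ⟨x, hx⟩ := hT.exists_conj_mem (y := y) (by rwa [hyp])
    refine hg1 (hg x (hT.conj_mem_of_commute hx ?_ (mem_centralizer_singleton_iff.1 hy).symm))
    rintro rfl
    rw [orderOf_one] at hyp
    exact hp.one_lt.ne hyp
  rw [show 9313 = 67 * 139 by norm_num]
  exact ((key 67 (by norm_num) (by simp)).mul_left (key 139 (by norm_num) (by simp))).symm

theorem regularFor_of_coprime {g : G} (hg : (orderOf g).Coprime 9313) : RegularFor T g := by
  intro x hx
  have h1 := hT.orderOf_mem hx
  rw [← MulAut.conj_apply, MulEquiv.orderOf_eq] at h1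
  exact orderOf_eq_one_iff.1 (Nat.eq_one_of_dvd_coprimes hg dvd_rfl h1)

theorem commute {a b : G} (ha : a ∈ T) (hb : b ∈ T) : Commute a b := by
  have := hT.cyclic
  let := IsCyclic.commGroup (α := T)
  exact congrArg Subtype.val (mul_comm (⟨a, ha⟩ : T) ⟨b, hb⟩)

theorem mem_normalizer_of_conj {t g : G} (ht : t ∈ T) (ht1 : t ≠ 1) (h : g * t * g⁻¹ ∈ T) :
    g ∈ normalizer (T : Set G) := by
  rw [mem_normalizer_iff]
  intro a
  constructor
  · exact fun ha => hT.conj_mem_of_commute h ht1 (hT.commute ha ht)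
  · intro ha
    have := hT.conj_mem_of_commute (x := g⁻¹) (t := g * t * g⁻¹) (g := g * a * g⁻¹)
      (by convert ht using 1; group) (by rwa [Ne, conj_eq_one_iff]) (hT.commute ha h)
    convert this using 1; group

theorem le_of_normal {N : Subgroup G} [N.Normal] (hN : 9313 ∣ Nat.card N) : T ≤ N := by
  have key : ∀ p : ℕ, p.Prime → (p = 67 ∨ p = 139) → p ∣ Nat.card (N ⊓ T : Subgroup G) := by
    intro p hp h67
    obtain ⟨y, hy, hyp⟩ := exists_orderOf_mem (H := N) hp (dvd_trans (by
      rcases h67 with rfl | rfl <;> norm_num) hN)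
    obtain ⟨x, hx⟩ := hT.exists_conj_mem (y := y) (by rwa [hyp])
    rw [← hyp, ← MulEquiv.orderOf_eq (MulAut.conj x)]
    exact orderOf_dvd_natCard _ (mem_inf.2 ⟨Subgroup.Normal.conj_mem ‹_› y hy x, hx⟩)
  have h1 : 67 * 139 ∣ Nat.card (N ⊓ T : Subgroup G) :=
    Nat.Coprime.mul_dvd_of_dvd_of_dvd (by norm_num) (key 67 (by norm_num) (by simp))
      (key 139 (by norm_num) (by simp))
  have h2 : N ⊓ T = T := eq_of_le_of_card_ge inf_le_right (by
    rw [hT.card]; exact Nat.le_of_dvd Nat.card_pos h1)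
  exact inf_eq_right.1 h2

theorem normalizer_sup_eq_top {N : Subgroup G} [N.Normal] (hN : 9313 ∣ Nat.card N) :
    normalizer (T : Set G) ⊔ N = ⊤ := by
  have := Fact.mk (show Nat.Prime 139 by norm_num)
  have hTN := hT.le_of_normal hN
  obtain ⟨x, hx, hx139⟩ := hT.exists_orderOf_eq (p := 139) (by simp)
  obtain ⟨P, hP⟩ := Sylow.coe_eq_zpowers_of_orderOf (M := 2 ^ 7 * 3 * 7 ^ 4 * 97 ^ 3 * 67)
      (by rw [hT.card_group]; norm_num) (by norm_num) hx139
  have h1 := Sylow.normalizer_sup_eq_top' (N := N) P (by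
    rw [hP, zpowers_le]; exact hTN hx)
  have h2 : normalizer (P : Set G) ≤ normalizer (T : Set G) := by
    rw [← Sylow.coe_coe, hP]
    intro g hg
    refine hT.mem_normalizer_of_conj hx ?_ ?_
    · rintro rfl; simp at hx139
    · exact (zpowers_le.2 hx) ((mem_normalizer_iff.1 hg x).1 (mem_zpowers x))
  exact top_le_iff.1 (h1 ▸ sup_le_sup_right h2 N)

theorem relIndex_normalizer : T.relIndex (normalizer (T : Set G)) = 3 := by
  have h := card_mul_relIndex (le_normalizer (H := T))
  rw [hT.card, hT.card_normalizer] at h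
  omega

theorem index_dvd_of_normal {N : Subgroup G} [N.Normal] (hN : 9313 ∣ Nat.card N) :
    N.index ∣ 3 := by
  rw [← relIndex_top_right, ← hT.normalizer_sup_eq_top hN, relIndex_sup_right,
    ← hT.relIndex_normalizer]
  exact relIndex_dvd_of_le_left (normalizer (T : Set G)) (hT.le_of_normal hN)

theorem inf_normalizer_of_index {N : Subgroup G} [N.Normal] (hN : 9313 ∣ Nat.card N)
    (h3 : N.index = 3) : N ⊓ normalizer (T : Set G) = T := by
  have h1 : N.relIndex (normalizer (T : Set G)) = 3 := by
    rw [← h3, ← relIndex_top_right, ← hT.normalizer_sup_eq_top hN, relIndex_sup_right]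
  have h2 := card_mul_relIndex (inf_le_right (a := N) (b := normalizer (T : Set G)))
  rw [inf_relIndex_right, h1, hT.card_normalizer] at h2
  refine (eq_of_le_of_card_ge (le_inf (hT.le_of_normal hN) le_normalizer) ?_).symm
  rw [hT.card]
  omega

theorem eq_top_of_normal {N : Subgroup G} [N.Normal] (hN : 9313 ∣ Nat.card N) : N = ⊤ := by
  rcases (Nat.dvd_prime (by norm_num)).1 (hT.index_dvd_of_normal hN) with h | h
  · exact index_eq_one.1 h
  exfalso
  have := Fact.mk (show Nat.Prime 139 by norm_num)
  have := Fact.mk (show Nat.Prime 7 by norm_num)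
  have hTN := hT.le_of_normal hN
  have hinf := hT.inf_normalizer_of_index hN h
  have hcard := N.card_mul_index
  rw [h, hT.card_group] at hcard
  have hcard' : Nat.card N = 7 ^ 4 * (2 ^ 7 * 67 * 97 ^ 3 * 139) := by omega
  obtain ⟨x, hx, hx139⟩ := hT.exists_orderOf_eq (p := 139) (by simp)
  have hx139' : orderOf (⟨x, hTN hx⟩ : N) = 139 := by rw [← hx139]; exact orderOf_mk x _
  obtain ⟨P, hP⟩ := Sylow.coe_eq_zpowers_of_orderOf (M := 2 ^ 7 * 7 ^ 4 * 97 ^ 3 * 67)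
      (by rw [hcard']; norm_num) (by norm_num) hx139'
  have hzT : ∀ n ∈ zpowers (⟨x, hTN hx⟩ : N), (n : G) ∈ T := by
    intro n hn
    obtain ⟨k, rfl⟩ := mem_zpowers_iff.1 hn
    exact zpow_mem hx k
  have hPT : normalizer (P : Set N) ≤ centralizer (P : Set N) := by
    rw [← Sylow.coe_coe, hP]
    intro g hg
    have hgT : (g : G) ∈ T := by
      rw [← hinf]
      refine ⟨g.2, hT.mem_normalizer_of_conj hx ?_ ?_⟩
      · rintro rfl; simp at hx139
      · exact hzT _ ((mem_normalizer_iff.1 hg _).1 (mem_zpowers _))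
    rw [mem_centralizer_iff]
    intro a ha
    exact Subtype.ext (hT.commute (hzT a ha) hgT)
  have hfac : (Nat.card N).factorization 7 = 4 := by
    have := Nat.factorization_eq_zero_of_not_dvd (show ¬ 7 ∣ 2 ^ 7 * 67 * 97 ^ 3 * 139 by norm_num)
    rw [hcard', Nat.factorization_mul (by norm_num) (by norm_num), Finsupp.add_apply, this,
      Nat.Prime.factorization_pow (by norm_num)]
    simp
  obtain ⟨a, b, ha, hb, hab, k, hk⟩ := exists_commute_of_normalizer_le_centralizer (r := 7)
    (by norm_num) P hPT (by rw [hcard']; norm_num) (by rw [hfac]; decide)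
  obtain ⟨g, hg⟩ := hT.exists_conj_mem (y := (a : G)) (Or.inr (by
    rw [← ha]
    exact (orderOf_mk _ a.2).symm))
  have ha1 : (a : G) ≠ 1 := by
    intro h1
    rw [show a = 1 from Subtype.ext h1, orderOf_one] at ha
    norm_num at ha
  have h1 := hT.orderOf_mem (hT.conj_mem_of_commute (g := (b : G)) hg ha1
    (congrArg Subtype.val hab.symm.eq))
  rw [← MulAut.conj_apply, MulEquiv.orderOf_eq] at h1
  have h2 : orderOf (b : G) ∣ 7 ^ k := orderOf_dvd_of_pow_eq_one (by
    exact_mod_cast congrArg Subtype.val hk)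
  have h3 : orderOf (b : G) = 1 := Nat.eq_one_of_dvd_coprimes
    (Nat.Coprime.pow_left k (by norm_num : Nat.Coprime 7 9313)) h2 h1
  exact hb (Subtype.ext (orderOf_eq_one_iff.1 h3))

end IsolatedHall

end GroupTheory

end

/-! ### The isolated Hall subgroup of order `9313` -/

section

open Subgroup Finset

/-- An injective parametrization of `T` by the integers modulo `9313`. -/
structure HallParam {G : Type*} [Group G] (T : Subgroup G) (τ : ZMod 9313 → G) : Prop where
  map_add : ∀ a b, τ (a + b) = τ a * τ b
  inj : Function.Injective τ
  mem_iff : ∀ g, g ∈ T ↔ ∃ k, τ k = g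

theorem IsolatedHall.exists_param {G : Type*} [Group G] [Finite G] {T : Subgroup G}
    (hT : IsolatedHall G T) : ∃ τ, HallParam T τ := by
  have := hT.cyclic
  have h := hT.card
  let e : Multiplicative (ZMod 9313) ≃* T := h ▸ zmodCyclicMulEquiv (G := T) inferInstance
  refine ⟨fun k => e (Multiplicative.ofAdd k), fun a b => ?_, fun a b hab => ?_, fun g => ?_⟩
  · rw [ofAdd_add, map_mul, Subgroup.coe_mul]
  · exact Multiplicative.ofAdd.injective (e.injective (Subtype.ext hab))
  · constructor
    · intro hg
      exact ⟨(e.symm ⟨g, hg⟩).toAdd, by simp⟩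
    · rintro ⟨k, rfl⟩
      exact SetLike.coe_mem _

theorem sum_stdAddChar_mul {j : ZMod 9313} (hj : j ≠ 0) :
    ∑ k, (ZMod.stdAddChar (j * k) : ℂ) = 0 := by
  have := AddChar.sum_mulShift j (ZMod.isPrimitive_stdAddChar 9313)
  rw [if_neg hj, Nat.cast_zero] at this
  simpa only [mul_comm] using this

namespace HallParam

variable {G : Type*} [Group G] {T : Subgroup G} {τ : ZMod 9313 → G} (hτ : HallParam T τ)
include hτ

theorem map_zero : τ 0 = 1 := by
  have := hτ.map_add 0 0
  rwa [add_zero, left_eq_mul] at this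

theorem map_neg (k : ZMod 9313) : τ (-k) = (τ k)⁻¹ := by
  rw [eq_inv_iff_mul_eq_one, ← hτ.map_add, neg_add_cancel, hτ.map_zero]

theorem mem (k : ZMod 9313) : τ k ∈ T := (hτ.mem_iff _).2 ⟨k, rfl⟩

theorem eq_one_iff {k : ZMod 9313} : τ k = 1 ↔ k = 0 := by
  rw [← hτ.map_zero, hτ.inj.eq_iff]

theorem map_nat_mul (m : ℕ) (k : ZMod 9313) : τ (m * k) = τ k ^ m := by
  induction m with
  | zero => simp [hτ.map_zero]
  | succ m ih => rw [Nat.cast_succ, add_mul, one_mul, hτ.map_add, ih, pow_succ]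

theorem exists_mul {g : G} (hg : g ∈ normalizer (T : Set G)) :
    ∃ u, ∀ k, g * τ k * g⁻¹ = τ (u * k) := by
  obtain ⟨u, hu⟩ := (hτ.mem_iff _).1 ((mem_normalizer_iff.1 hg _).1 (hτ.mem 1))
  refine ⟨u, fun k => ?_⟩
  obtain ⟨m, rfl⟩ := ZMod.natCast_zmod_surjective k
  rw [mul_comm, hτ.map_nat_mul, hu, conj_pow, ← hτ.map_nat_mul, mul_one]

theorem card_stabilizer [Fintype G] [DecidableEq G] (hT : IsolatedHall G T) {u : G → ZMod 9313}
    (hu : ∀ g ∈ normalizer (T : Set G), ∀ k, g * τ k * g⁻¹ = τ (u g * k))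
    {j l : ZMod 9313} (hl : l ≠ 0) [DecidablePred (· ∈ normalizer (T : Set G))] :
    #{g | g ∈ normalizer (T : Set G) ∧ u g * l = j} = 0 ∨
    #{g | g ∈ normalizer (T : Set G) ∧ u g * l = j} = 9313 := by
  classical
  rcases Finset.eq_empty_or_nonempty {g | g ∈ normalizer (T : Set G) ∧ u g * l = j} with h | ⟨h, hh⟩
  · left; rw [h, card_empty]
  right
  simp only [Finset.mem_filter, Finset.mem_univ, true_and] at hh
  have hcard : #{t | t ∈ T} = 9313 := by
    rw [← hT.card, Nat.card_eq_fintype_card]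
    exact (Fintype.card_subtype _).symm
  refine Eq.trans ?_ hcard
  symm
  refine Finset.card_equiv (Equiv.mulLeft h) fun t => ?_
  simp only [Finset.mem_filter, Finset.mem_univ, true_and, Equiv.coe_mulLeft]
  constructor
  · intro ht
    have hht : h * t ∈ normalizer (T : Set G) := mul_mem hh.1 (le_normalizer ht)
    refine ⟨hht, ?_⟩
    rw [← hh.2, ← hτ.inj.eq_iff, ← hu _ hht, ← hu _ hh.1]
    have := (hT.commute ht (hτ.mem l)).eq
    calc h * t * τ l * (h * t)⁻¹ = h * (t * τ l) * t⁻¹ * h⁻¹ := by group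
      _ = _ := by rw [this]; group
  · rintro ⟨hht, h2⟩
    rw [← hh.2, ← hτ.inj.eq_iff, ← hu _ hht, ← hu _ hh.1] at h2
    refine hT.mem_of_commute _ (hτ.mem l) (by rwa [Ne, hτ.eq_one_iff]) t ?_
    have h3 : h * (t * τ l * t⁻¹) * h⁻¹ = h * τ l * h⁻¹ := by rw [← h2]; group
    have h4 := mul_left_cancel (mul_right_cancel h3)
    exact mul_inv_eq_iff_eq_mul.1 h4

open ZMod in
theorem exists_multiplicities [Fintype G] (S : WedderburnSystem G) :
    ∃ m : Fin S.n → ZMod 9313 → ℕ, ∀ i j,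
      ∑ k, stdAddChar (-(j * k)) * S.χ i (τ k) = 9313 * (m i j : ℂ) := by
  have key : ∀ i j, ∃ m : ℕ, ∑ k, stdAddChar (-(j * k)) * S.χ i (τ k) = 9313 * (m : ℂ) := by
    intro i j
    let r : Multiplicative (ZMod 9313) →* Matrix (Fin (S.d i)) (Fin (S.d i)) ℂ :=
      { toFun := fun k => S.ρ i (τ k.toAdd)
        map_one' := by rw [toAdd_one, hτ.map_zero, map_one]
        map_mul' := fun a b => by rw [toAdd_mul, hτ.map_add, map_mul] }
    let l : Multiplicative (ZMod 9313) →* ℂ := (AddChar.mulShift stdAddChar j).toMonoidHom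
    obtain ⟨m, hm⟩ := exists_multiplicity r l
    refine ⟨m, ?_⟩
    rw [Fintype.card_multiplicative, ZMod.card] at hm
    refine Eq.trans ?_ hm
    refine Fintype.sum_equiv Multiplicative.ofAdd _ _ fun k => ?_
    rw [← mul_neg]
    rfl
  choose m hm using key
  exact ⟨m, hm⟩

end HallParam

/-- The multiplicities of the linear characters of `T` in the irreducible representations of
`G`. -/
structure Multiplicities {G : Type*} [Group G] {T : Subgroup G} {τ : ZMod 9313 → G}
    (S : WedderburnSystem G) (hT : IsolatedHall G T) (hτ : HallParam T τ)
    (m : Fin S.n → ZMod 9313 → ℕ) : Prop where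
  sum_eq : ∀ i j, ∑ k, ZMod.stdAddChar (-(j * k)) * S.χ i (τ k) = 9313 * (m i j : ℂ)

namespace Multiplicities

variable {G : Type*} [Group G] [Fintype G] {T : Subgroup G} {τ : ZMod 9313 → G}
  {S : WedderburnSystem G} {hT : IsolatedHall G T} {hτ : HallParam T τ}
  {m : Fin S.n → ZMod 9313 → ℕ} (hm : Multiplicities S hT hτ m)
include hm

open ZMod

theorem diff_eq (i : Fin S.n) (j : ZMod 9313) :
    9313 * ((m i 0 : ℂ) - m i j) = ∑ k, (1 - stdAddChar (-(j * k))) * S.χ i (τ k) := by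
  rw [mul_sub, ← hm.sum_eq, ← hm.sum_eq, ← Finset.sum_sub_distrib]
  simp [sub_mul]

theorem diff_eq_inv (i : Fin S.n) (j : ZMod 9313) :
    9313 * ((m i 0 : ℂ) - m i j) = ∑ k, (1 - stdAddChar (j * k)) * S.χ i (τ k)⁻¹ := by
  rw [hm.diff_eq]
  refine Fintype.sum_equiv (Equiv.neg _) _ _ fun k => ?_
  rw [Equiv.neg_apply, hτ.map_neg, inv_inv, mul_neg]

theorem sum_diff_mul_χ {g : G} (hg : RegularFor T g) (j : ZMod 9313) :
    ∑ i, ((m i 0 : ℂ) - m i j) * S.χ i g = 0 := by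
  classical
  have h : ∑ i, (9313 * ((m i 0 : ℂ) - m i j)) * S.χ i g = 0 := by
    simp only [hm.diff_eq_inv, Finset.sum_mul]
    rw [Finset.sum_comm]
    refine Finset.sum_eq_zero fun k _ => ?_
    by_cases hk : k = 0
    · simp [hk]
    · simp only [mul_assoc, ← Finset.mul_sum]
      have h1 := S.sum_χ_mul_χ_inv g (τ k)
      rw [Finset.sum_congr rfl fun i _ => mul_comm _ _, h1, Finset.card_eq_zero.2, Nat.cast_zero,
        mul_zero]
      rw [Finset.filter_eq_empty_iff]
      intro x _ hx
      have := hg x (hx ▸ hτ.mem k)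
      rw [this, mul_one, mul_inv_cancel, eq_comm, hτ.eq_one_iff] at hx
      exact hk hx
  simp only [mul_assoc, ← Finset.mul_sum] at h
  simpa using h

theorem exists_sum_diff_mul_diff : ∃ c : ZMod 9313 → ZMod 9313 → ℕ,
    (∀ j l, j ≠ 0 → l ≠ 0 → ∑ i, ((m i 0 : ℂ) - m i j) * ((m i 0 : ℂ) - m i l) = 3 + c j l) ∧
    (∀ j l, l ≠ 0 → c j l = 0 ∨ c j l = 1) ∧ (∀ l, l ≠ 0 → c l l = 1) ∧
    ∀ l, l ≠ 0 → ∀ J : Finset (ZMod 9313), ∑ j ∈ J, c j l ≤ 3 := by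
  classical
  have h1 : ∀ g : G, ∃ u : ZMod 9313, g ∈ normalizer (T : Set G) →
      ∀ k, g * τ k * g⁻¹ = τ (u * k) := by
    intro g
    by_cases hg : g ∈ normalizer (T : Set G)
    · exact (hτ.exists_mul hg).imp fun _ h _ => h
    · exact ⟨0, fun h => absurd h hg⟩
  choose u hu using h1
  have hN : #{g | g ∈ normalizer (T : Set G)} = 3 * 9313 := by
    rw [← hT.card_normalizer, Nat.card_eq_fintype_card]
    exact (Fintype.card_subtype _).symm
  have hstab := fun (j l : ZMod 9313) (hl : l ≠ 0) => hτ.card_stabilizer hT hu (j := j) hl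
  refine ⟨fun j l => #{g | g ∈ normalizer (T : Set G) ∧ u g * l = j} / 9313, ?_, ?_, ?_, ?_⟩
  rotate_left
  · intro j l hl
    dsimp only
    rcases hstab j l hl with h | h <;> rw [h] <;> simp
  · intro l hl
    dsimp only
    rcases hstab l l hl with h | h
    · rw [Finset.card_eq_zero, Finset.filter_eq_empty_iff] at h
      refine absurd ⟨one_mem _, ?_⟩ (h (Finset.mem_univ 1))
      have := hu 1 (one_mem _) l
      rw [one_mul, inv_one, mul_one, hτ.inj.eq_iff] at this
      exact this.symm
    · rw [h]
  · intro l hl J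
    have h1 : ∀ j ∈ J, #{g | g ∈ normalizer (T : Set G) ∧ u g * l = j} / 9313 * 9313 =
        #{g | g ∈ normalizer (T : Set G) ∧ u g * l = j} := by
      intro j _
      rcases hstab j l hl with h | h <;> rw [h]
    refine Nat.le_of_mul_le_mul_right ?_ (show 0 < 9313 by norm_num)
    rw [Finset.sum_mul, Finset.sum_congr rfl h1, ← hN]
    calc _ = ∑ j ∈ J, #{g ∈ ({g | g ∈ normalizer (T : Set G)} : Finset G) | u g * l = j} := by
          simp only [Finset.filter_filter]
      _ ≤ ∑ j, #{g ∈ ({g | g ∈ normalizer (T : Set G)} : Finset G) | u g * l = j} :=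
          Finset.sum_le_sum_of_subset (Finset.subset_univ J)
      _ = _ := (Finset.card_eq_sum_card_fiberwise (fun _ _ => Finset.mem_univ _)).symm
  intro j l hj hl
  have h2 : 9313 * 9313 * ∑ i, ((m i 0 : ℂ) - m i j) * ((m i 0 : ℂ) - m i l) =
      ∑ g, ∑ k, ∑ k', if g * τ k * g⁻¹ = τ k' then
        (1 - stdAddChar (-(j * k))) * (1 - stdAddChar (l * k')) else (0 : ℂ) := by
    calc _ = ∑ i, (9313 * ((m i 0 : ℂ) - m i j)) * (9313 * ((m i 0 : ℂ) - m i l)) := by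
          rw [Finset.mul_sum]; refine Finset.sum_congr rfl fun i _ => by ring
      _ = ∑ i, ∑ k, ∑ k', ((1 - stdAddChar (-(j * k))) * (1 - stdAddChar (l * k'))) *
            (S.χ i (τ k) * S.χ i (τ k')⁻¹) := by
          refine Finset.sum_congr rfl fun i _ => ?_
          rw [hm.diff_eq, hm.diff_eq_inv, Finset.sum_mul_sum]
          refine Finset.sum_congr rfl fun k _ => Finset.sum_congr rfl fun k' _ => by ring
      _ = ∑ k, ∑ k', ((1 - stdAddChar (-(j * k))) * (1 - stdAddChar (l * k'))) *
            ∑ i, (S.χ i (τ k) * S.χ i (τ k')⁻¹) := by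
          rw [Finset.sum_comm]
          refine Finset.sum_congr rfl fun k _ => ?_
          rw [Finset.sum_comm]
          refine Finset.sum_congr rfl fun k' _ => by rw [Finset.mul_sum]
      _ = _ := by
          conv_rhs => rw [Finset.sum_comm]
          refine Finset.sum_congr rfl fun k _ => ?_
          conv_rhs => rw [Finset.sum_comm]
          refine Finset.sum_congr rfl fun k' _ => ?_
          rw [S.sum_χ_mul_χ_inv, ← Finset.sum_filter, Finset.sum_const, nsmul_eq_mul, mul_comm]
  have h3 : ∀ g, (∑ k, ∑ k', if g * τ k * g⁻¹ = τ k' then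
        (1 - stdAddChar (-(j * k))) * (1 - stdAddChar (l * k')) else (0 : ℂ)) =
      (if g ∈ normalizer (T : Set G) then 9313 else 0) +
      if g ∈ normalizer (T : Set G) ∧ u g * l = j then 9313 else 0 := by
    intro g
    by_cases hg : g ∈ normalizer (T : Set G)
    · have hul : u g * l ≠ 0 := by
        intro h
        have := hu g hg l
        rw [h, hτ.map_zero, conj_eq_one_iff, hτ.eq_one_iff] at this
        exact hl this
      simp only [hu g hg, hτ.inj.eq_iff, Finset.sum_ite_eq, Finset.mem_univ, if_true, hg, true_and]
      have h4 : ∀ k, (1 - stdAddChar (-(j * k))) * (1 - stdAddChar (l * (u g * k))) =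
          (1 : ℂ) - stdAddChar (-j * k) - stdAddChar ((u g * l) * k) +
            stdAddChar ((u g * l - j) * k) := by
        intro k
        rw [sub_mul _ _ k, sub_eq_add_neg (u g * l * k), AddChar.map_add_eq_mul, neg_mul,
          mul_left_comm l, mul_assoc (u g)]
        ring
      simp only [h4, Finset.sum_add_distrib, Finset.sum_sub_distrib]
      rw [sum_stdAddChar_mul hul, sum_stdAddChar_mul (neg_ne_zero.2 hj)]
      by_cases h5 : u g * l = j
      · simp [h5, ZMod.card]
      · rw [sum_stdAddChar_mul (sub_ne_zero.2 h5)]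
        simp [h5, ZMod.card]
    · simp only [hg, false_and, if_false, add_zero]
      refine Finset.sum_eq_zero fun k _ => Finset.sum_eq_zero fun k' _ => ?_
      split_ifs with h4
      · by_cases hk : k = 0
        · simp [hk]
        · refine absurd (hT.mem_normalizer_of_conj (hτ.mem k) ?_ (h4 ▸ hτ.mem k')) hg
          rwa [Ne, hτ.eq_one_iff]
      · rfl
  simp only [h3] at h2
  simp only [Finset.sum_add_distrib, ← Finset.sum_filter, Finset.sum_const, hN] at h2
  beta_reduce
  rcases hstab j l hl with h4 | h4
  · rw [h4] at h2 ⊢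
    norm_num at h2 ⊢
    linear_combination h2 / 86731969
  · rw [h4] at h2 ⊢
    norm_num at h2 ⊢
    linear_combination h2 / 86731969

end Multiplicities

theorem exists_common_pair {α : Type*} [DecidableEq α] (F : Finset (Finset α))
    (h3 : ∀ A ∈ F, #A = 3) (h2 : ∀ A ∈ F, ∀ B ∈ F, A ≠ B → #(A ∩ B) = 2) (h5 : 5 ≤ #F) :
    ∃ P : Finset α, #P = 2 ∧ ∀ A ∈ F, P ⊆ A := by
  obtain ⟨A, hA, B, hB, hAB⟩ := Finset.one_lt_card.1 (show 1 < #F by omega)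
  refine ⟨A ∩ B, h2 A hA B hB hAB, ?_⟩
  by_contra! hcon
  obtain ⟨C, hC, hPC⟩ := hcon
  have hW : #(A ∪ B) = 4 := by
    have := Finset.card_union_add_card_inter A B
    rw [h3 A hA, h3 B hB, h2 A hA B hB hAB] at this
    omega
  have two_le : ∀ D ∈ F, ∀ E ∈ F, 2 ≤ #(D ∩ E) := by
    intro D hD E hE
    by_cases h : D = E
    · rw [h, Finset.inter_self, h3 E hE]; norm_num
    · rw [h2 D hD E hE h]
  have key : ∀ D ∈ F, ¬ D ⊆ A ∪ B → D ∩ (A ∪ B) = A ∩ B := by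
    intro D hD hDW
    have h1 : #(D ∩ (A ∪ B)) ≤ 2 := by
      have : #(D ∩ (A ∪ B)) < #D := Finset.card_lt_card
        ⟨Finset.inter_subset_left, fun h => hDW (h.trans Finset.inter_subset_right)⟩
      rw [h3 D hD] at this
      omega
    have hDA : D ∩ A = D ∩ (A ∪ B) := Finset.eq_of_subset_of_card_le
      (Finset.inter_subset_inter_left Finset.subset_union_left) (h1.trans (two_le D hD A hA))
    have hDB : D ∩ B = D ∩ (A ∪ B) := Finset.eq_of_subset_of_card_le
      (Finset.inter_subset_inter_left Finset.subset_union_right) (h1.trans (two_le D hD B hB))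
    refine Finset.eq_of_subset_of_card_le (Finset.subset_inter ?_ ?_) ?_
    · rw [← hDA]; exact Finset.inter_subset_right
    · rw [← hDB]; exact Finset.inter_subset_right
    · rw [h2 A hA B hB hAB, ← hDA]; exact two_le D hD A hA
  have hCW : C ⊆ A ∪ B := by
    by_contra h
    exact hPC (key C hC h ▸ Finset.inter_subset_left)
  have hall : F ⊆ Finset.powersetCard 3 (A ∪ B) := by
    intro D hD
    rw [Finset.mem_powersetCard]
    refine ⟨?_, h3 D hD⟩
    by_contra h
    have h4 := key D hD h
    have h5 : C ∩ D ⊆ A ∩ B := by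
      rw [← h4]
      exact fun x hx => by
        rw [Finset.mem_inter] at hx ⊢
        exact ⟨hx.2, hCW hx.1⟩
    have h6 := Finset.eq_of_subset_of_card_le h5 (by rw [h2 A hA B hB hAB]; exact two_le C hC D hD)
    exact hPC (h6 ▸ Finset.inter_subset_left)
  have := Finset.card_le_card hall
  rw [Finset.card_powersetCard, hW] at this
  have h4 : Nat.choose 4 3 = 4 := rfl
  omega

theorem sum_sq_eq_three_entries {I : Type*} {s : Finset I} {v : I → ℤ}
    (h : ∑ i ∈ s, v i * v i ≤ 3) {i : I}
    (hi : i ∈ s) : v i = 0 ∨ v i = 1 ∨ v i = -1 := by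
  have h1 : v i * v i ≤ 3 := (Finset.single_le_sum (f := fun i => v i * v i)
    (fun j _ => mul_self_nonneg _) hi).trans h
  have h2 : v i < 2 := by nlinarith
  have h3 : -2 < v i := by nlinarith
  omega

/-- A family of integral vectors of squared length four, all with coordinate one at `t`, whose
inner products are three or four, and which takes each value at most three times: all but one of
the coordinates are constant. -/
theorem exists_common_coordinates {I K : Type*} [Fintype I] [DecidableEq I] [DecidableEq K]
    (J : Finset K) (hJ : 13 ≤ #J) (t : I) (v : K → I → ℤ) (hvt : ∀ j ∈ J, v j t = 1) (c : K → K → ℕ)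
    (hc : ∀ j ∈ J, ∀ l ∈ J, ∑ i, v j i * v l i = 3 + c j l)
    (hc01 : ∀ j, ∀ l ∈ J, c j l = 0 ∨ c j l = 1) (hcl : ∀ l ∈ J, c l l = 1)
    (hcJ : ∀ l ∈ J, ∑ j ∈ J, c j l ≤ 3) :
    ∃ (i₁ i₂ : I) (s₁ s₂ : ℤ) (θ : K → I) (δ : K → ℤ), i₁ ≠ t ∧ i₂ ≠ t ∧ i₁ ≠ i₂ ∧
      (s₁ = 1 ∨ s₁ = -1) ∧ (s₂ = 1 ∨ s₂ = -1) ∧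
      (∀ j ∈ J, θ j ≠ t ∧ θ j ≠ i₁ ∧ θ j ≠ i₂ ∧ (δ j = 1 ∨ δ j = -1) ∧
        ∀ i, v j i = (if i = t then 1 else 0) + (if i = i₁ then s₁ else 0) +
          (if i = i₂ then s₂ else 0) + if i = θ j then δ j else 0) ∧
      #J ≤ 3 * #(J.image fun j => (θ j, δ j)) := by
  set s : Finset I := univ.erase t with hs
  have hts : ∀ i, i ∈ s ↔ i ≠ t := by simp [hs]
  have hcs : ∀ j ∈ J, ∀ l ∈ J, ∑ i ∈ s, v j i * v l i = 2 + c j l := by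
    intro j hj l hl
    have h := hc j hj l hl
    rw [← Finset.add_sum_erase _ _ (mem_univ t), hvt j hj, hvt l hl] at h
    rw [hs]; omega
  have hsq : ∀ j ∈ J, ∑ i ∈ s, v j i * v j i = 3 := by
    intro j hj
    rw [hcs j hj j hj, hcl j hj]; norm_num
  have hval : ∀ j ∈ J, ∀ i ∈ s, v j i = 0 ∨ v j i = 1 ∨ v j i = -1 := fun j hj i hi =>
    sum_sq_eq_three_entries (hsq j hj).le hi
  let A : K → Finset (I × ℤ) := fun j => (s.filter fun i => v j i ≠ 0).image fun i => (i, v j i)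
  have memA : ∀ j i a, (i, a) ∈ A j ↔ i ≠ t ∧ v j i = a ∧ a ≠ 0 := by
    intro j i a
    simp only [A, Finset.mem_image, Finset.mem_filter, hts, Prod.mk.injEq]
    constructor
    · rintro ⟨i', ⟨h1, h2⟩, rfl, rfl⟩
      exact ⟨h1, rfl, h2⟩
    · rintro ⟨h1, rfl, h2⟩
      exact ⟨i, ⟨h1, h2⟩, rfl, rfl⟩
  have cardA : ∀ j, #(A j) = #(s.filter fun i => v j i ≠ 0) := fun j =>
    Finset.card_image_of_injective _ fun a b h => (Prod.mk.inj h).1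
  have hA3 : ∀ j ∈ J, #(A j) = 3 := by
    intro j hj
    have h : ((#(A j) : ℕ) : ℤ) = 3 := by
      rw [cardA, ← hsq j hj, Finset.card_filter]
      push_cast
      refine Finset.sum_congr rfl fun i hi => ?_
      rcases hval j hj i hi with h | h | h <;> simp [h]
    exact_mod_cast h
  have hinter : ∀ j l, A j ∩ A l =
      (s.filter fun i => v j i = v l i ∧ v j i ≠ 0).image fun i => (i, v j i) := by
    intro j l
    ext ⟨i, a⟩
    simp only [Finset.mem_inter, memA, Finset.mem_image, Finset.mem_filter, hts, Prod.mk.injEq]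
    constructor
    · rintro ⟨⟨h1, rfl, h2⟩, _, h3, _⟩
      exact ⟨i, ⟨h1, h3.symm, h2⟩, rfl, rfl⟩
    · rintro ⟨i', ⟨h1, h2, h3⟩, rfl, rfl⟩
      exact ⟨⟨h1, rfl, h3⟩, h1, h2.symm, h3⟩
  have hA2 : ∀ j ∈ J, ∀ l ∈ J, #(A j ∩ A l) = 2 + c j l := by
    intro j hj l hl
    have h0 : ((#(A j ∩ A l) : ℕ) : ℤ) = ∑ i ∈ s, if v j i = v l i ∧ v j i ≠ 0 then 1 else 0 := by
      rw [hinter, Finset.card_image_of_injective _ fun a b h => (Prod.mk.inj h).1,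
        Finset.card_filter]
      push_cast
      rfl
    have h1 : (2 + c j l : ℤ) ≤ #(A j ∩ A l) := by
      rw [← hcs j hj l hl, h0]
      refine Finset.sum_le_sum fun i hi => ?_
      rcases hval j hj i hi with h | h | h <;> rcases hval l hl i hi with h' | h' | h' <;>
        simp [h, h']
    have h2 : (4 * #(A j ∩ A l) : ℤ) ≤ 2 * (2 + c j l) + 3 + 3 := by
      rw [← hcs j hj l hl, ← hsq j hj]
      nth_rewrite 2 [hsq j hj]
      rw [← hsq l hl, h0, Finset.mul_sum, Finset.mul_sum, ← Finset.sum_add_distrib,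
        ← Finset.sum_add_distrib]
      refine Finset.sum_le_sum fun i hi => ?_
      rcases hval j hj i hi with h | h | h <;> rcases hval l hl i hi with h' | h' | h' <;>
        simp [h, h']
    rcases hc01 j l hl with h | h <;> rw [h] at h1 h2 ⊢ <;> push_cast at h1 h2 <;> omega
  have hAeq : ∀ j ∈ J, ∀ l ∈ J, A j = A l → c j l = 1 := by
    intro j hj l hl h
    have := hA2 j hj l hl
    rw [h, Finset.inter_self, hA3 l hl] at this
    omega
  have hfib : #J ≤ 3 * #(J.image A) := by
    refine Finset.card_le_mul_card_image J 3 fun a ha => ?_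
    obtain ⟨l, hl, rfl⟩ := Finset.mem_image.1 ha
    refine le_trans ?_ (hcJ l hl)
    rw [Finset.card_filter]
    refine Finset.sum_le_sum fun j hj => ?_
    split_ifs with h
    · rw [hAeq j hj l hl h]
    · exact Nat.zero_le _
  obtain ⟨P, hP2, hP⟩ := exists_common_pair (J.image A)
    (by simp only [Finset.mem_image]; rintro _ ⟨j, hj, rfl⟩; exact hA3 j hj)
    (by
      simp only [Finset.mem_image]
      rintro _ ⟨j, hj, rfl⟩ _ ⟨l, hl, rfl⟩ hne
      rw [hA2 j hj l hl]
      rcases hc01 j l hl with h | h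
      · rw [h]
      · have h1 := hA2 j hj l hl
        rw [h] at h1
        refine absurd ?_ hne
        have h3 := Finset.eq_of_subset_of_card_le (Finset.inter_subset_left (s₁ := A j) (s₂ := A l))
          (by rw [h1, hA3 j hj])
        have h4 := Finset.eq_of_subset_of_card_le
          (Finset.inter_subset_right (s₁ := A j) (s₂ := A l))
          (by rw [h1, hA3 l hl])
        exact h3.symm.trans h4)
    (by omega)
  obtain ⟨⟨i₁, s₁⟩, ⟨i₂, s₂⟩, hp12, rfl⟩ := Finset.card_eq_two.1 hP2
  obtain ⟨j₀, hj₀⟩ : J.Nonempty := Finset.card_pos.1 (by omega)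
  have hmem : ∀ j ∈ J, ((i₁, s₁) ∈ A j) ∧ ((i₂, s₂) ∈ A j) := fun j hj => by
    have := hP _ (Finset.mem_image_of_mem A hj)
    simpa [Finset.insert_subset_iff] using this
  have hex : ∀ j, ∃ q : I × ℤ, j ∈ J →
      A j = {(i₁, s₁), (i₂, s₂), q} ∧ q ≠ (i₁, s₁) ∧ q ≠ (i₂, s₂) := by
    intro j
    by_cases hj : j ∈ J
    · obtain ⟨q, hq⟩ := Finset.card_eq_one.1 (show #(A j \ {(i₁, s₁), (i₂, s₂)}) = 1 by
        rw [Finset.card_sdiff_of_subset (hP _ (Finset.mem_image_of_mem A hj)), hA3 j hj, hP2])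
      refine ⟨q, fun _ => ⟨?_, ?_⟩⟩
      · rw [← Finset.sdiff_union_of_subset (hP _ (Finset.mem_image_of_mem A hj)), hq]
        ext; simp; tauto
      · have : q ∈ A j \ {(i₁, s₁), (i₂, s₂)} := by rw [hq]; simp
        simp only [Finset.mem_sdiff, Finset.mem_insert, Finset.mem_singleton, not_or] at this
        exact this.2
    · exact ⟨(i₁, s₁), fun h => absurd h hj⟩
  choose q hq using hex
  have h01 := (memA _ _ _).1 (hmem j₀ hj₀).1
  have h02 := (memA _ _ _).1 (hmem j₀ hj₀).2
  have hne12 : i₁ ≠ i₂ := by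
    rintro rfl
    exact hp12 (by rw [← h01.2.1, ← h02.2.1])
  have hqA : ∀ j ∈ J, q j ∈ A j := fun j hj => by rw [(hq j hj).1]; simp
  refine ⟨i₁, i₂, s₁, s₂, fun j => (q j).1, fun j => (q j).2, h01.1, h02.1, hne12, ?_, ?_, ?_, ?_⟩
  · have := hval j₀ hj₀ i₁ ((hts _).2 h01.1)
    rw [h01.2.1] at this
    exact this.resolve_left h01.2.2
  · have := hval j₀ hj₀ i₂ ((hts _).2 h02.1)
    rw [h02.2.1] at this
    exact this.resolve_left h02.2.2
  · intro j hj
    have h1 := (memA _ _ _).1 (hmem j hj).1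
    have h2 := (memA _ _ _).1 (hmem j hj).2
    have h3 := (memA _ _ _).1 (show ((q j).1, (q j).2) ∈ A j from hqA j hj)
    have hne1 : (q j).1 ≠ i₁ := fun h => (hq j hj).2.1 (Prod.ext h (by rw [← h3.2.1, h, h1.2.1]))
    have hne2 : (q j).1 ≠ i₂ := fun h => (hq j hj).2.2 (Prod.ext h (by rw [← h3.2.1, h, h2.2.1]))
    refine ⟨h3.1, hne1, hne2, ?_, fun i => ?_⟩
    · have := hval j hj _ ((hts _).2 h3.1)
      rw [h3.2.1] at this
      exact this.resolve_left h3.2.2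
    · by_cases hit : i = t
      · subst hit
        rw [hvt j hj, if_pos rfl, if_neg h1.1.symm, if_neg h2.1.symm, if_neg h3.1.symm]; norm_num
      by_cases hi1 : i = i₁
      · subst hi1
        rw [if_neg hit, if_pos rfl, if_neg hne12, if_neg hne1.symm, h1.2.1]; norm_num
      by_cases hi2 : i = i₂
      · subst hi2
        rw [if_neg hit, if_neg hi1, if_pos rfl, if_neg hne2.symm, h2.2.1]; norm_num
      by_cases hi3 : i = (q j).1
      · rw [if_neg hit, if_neg hi1, if_neg hi2, if_pos hi3, hi3, h3.2.1]; norm_num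
      · rw [if_neg hit, if_neg hi1, if_neg hi2, if_neg hi3]
        by_contra h
        have : (i, v j i) ∈ A j := (memA _ _ _).2 ⟨hit, rfl, by simpa using h⟩
        rw [(hq j hj).1] at this
        simp only [Finset.mem_insert, Finset.mem_singleton] at this
        rcases this with h | h | h
        · exact hi1 (congrArg Prod.fst h)
        · exact hi2 (congrArg Prod.fst h)
        · exact hi3 (congrArg Prod.fst h)
  · refine hfib.trans (Nat.mul_le_mul_left 3 ?_)
    have : J.image A = (J.image fun j => ((q j).1, (q j).2)).image
        fun q => {(i₁, s₁), (i₂, s₂), q} := by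
      rw [Finset.image_image]
      exact Finset.image_congr fun j hj => (hq j hj).1
    rw [this]
    exact Finset.card_image_le

end

/-! ### Multiplicities of characters on the Hall subgroup -/

section

open Subgroup Finset

namespace Multiplicities

variable {G : Type*} [Group G] [Fintype G] {T : Subgroup G} {τ : ZMod 9313 → G}
  {S : WedderburnSystem G} {hT : IsolatedHall G T} {hτ : HallParam T τ}
  {m : Fin S.n → ZMod 9313 → ℕ} (hm : Multiplicities S hT hτ m)
include hm

open ZMod

theorem χ_param (i : Fin S.n) (k : ZMod 9313) :
    S.χ i (τ k) = ∑ j, (m i j : ℂ) * stdAddChar (j * k) := by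
  have h : ∀ j, 9313 * ((m i j : ℂ) * stdAddChar (j * k)) =
      ∑ k', stdAddChar (j * (k - k')) * S.χ i (τ k') := by
    intro j
    rw [← mul_assoc, ← hm.sum_eq, Finset.sum_mul]
    refine Finset.sum_congr rfl fun k' _ => ?_
    rw [mul_sub, sub_eq_add_neg, AddChar.map_add_eq_mul]
    ring
  have h2 : 9313 * ∑ j, (m i j : ℂ) * stdAddChar (j * k) = 9313 * S.χ i (τ k) := by
    rw [Finset.mul_sum, Finset.sum_congr rfl fun j _ => h j, Finset.sum_comm,
      Finset.sum_eq_single k]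
    · simp [ZMod.card]
    · intro k' _ hk
      have := sum_stdAddChar_mul (sub_ne_zero.2 hk.symm)
      rw [← Finset.sum_mul, Finset.sum_congr rfl fun j _ => by rw [mul_comm j], this, zero_mul]
    · simp
  exact (mul_left_cancel₀ (by norm_num) h2).symm

theorem d_eq (i : Fin S.n) : (S.d i : ℂ) = ∑ j, (m i j : ℂ) := by
  have := hm.χ_param i 0
  simpa [hτ.map_zero, S.χ_one] using this

theorem χ_param_of_ne (i : Fin S.n) {k : ZMod 9313} (hk : k ≠ 0) :
    S.χ i (τ k) = -∑ j ∈ univ.erase 0, ((m i 0 : ℂ) - m i j) * stdAddChar (j * k) := by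
  have h1 : ∑ j : ZMod 9313, (stdAddChar (j * k) : ℂ) = 0 := by
    rw [← sum_stdAddChar_mul hk]
    exact Finset.sum_congr rfl fun j _ => by rw [mul_comm]
  have h2 := Finset.add_sum_erase univ
    (fun j => ((m i 0 : ℂ) - m i j) * stdAddChar (j * k)) (mem_univ 0)
  rw [hm.χ_param, eq_neg_iff_add_eq_zero]
  simp only [sub_self, zero_mul, zero_add] at h2
  rw [h2, ← Finset.sum_add_distrib]
  simp only [sub_mul, add_sub_cancel]
  rw [← Finset.mul_sum, h1, mul_zero]

theorem trivial_eq {t : Fin S.n} (ht : ∀ g, S.χ t g = 1) {j : ZMod 9313} (hj : j ≠ 0) :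
    (m t 0 : ℤ) - m t j = 1 := by
  have h0 := hm.sum_eq t 0
  have h1 := hm.sum_eq t j
  simp only [ht, mul_one, zero_mul, neg_zero, AddChar.map_zero_eq_one] at h0 h1
  have h2 := sum_stdAddChar_mul (neg_ne_zero.2 hj)
  simp only [neg_mul] at h2
  rw [h2] at h1
  simp [ZMod.card] at h0 h1
  rw [h1]
  have : m t 0 = 1 := by exact_mod_cast (h0 : _)
  rw [this]; rfl

end Multiplicities

/-- The constant part of the exceptional coordinates of the restrictions to `T`: `t` is the
trivial character, `i₁` and `i₂` are constant with signs on `T`, and the characters `θ j` are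
the exceptional ones. -/
structure ExceptionalSystem {G : Type*} [Group G] {T : Subgroup G} {τ : ZMod 9313 → G}
    (S : WedderburnSystem G) {hT : IsolatedHall G T} {hτ : HallParam T τ}
    {m : Fin S.n → ZMod 9313 → ℕ} (hm : Multiplicities S hT hτ m) (t i₁ i₂ : Fin S.n) (s₁ s₂ : ℤ)
    (θ : ZMod 9313 → Fin S.n) (δ : ZMod 9313 → ℤ) : Prop where
  trivial : ∀ g, S.χ t g = 1
  ne₁ : i₁ ≠ t
  ne₂ : i₂ ≠ t
  ne₁₂ : i₁ ≠ i₂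
  sign₁ : s₁ = 1 ∨ s₁ = -1
  sign₂ : s₂ = 1 ∨ s₂ = -1
  ne_θ : ∀ j ≠ 0, θ j ≠ t ∧ θ j ≠ i₁ ∧ θ j ≠ i₂
  sign_δ : ∀ j ≠ 0, δ j = 1 ∨ δ j = -1
  diff_eq : ∀ j ≠ 0, ∀ i, (m i 0 : ℂ) - m i j = (if i = t then 1 else 0) +
    (if i = i₁ then (s₁ : ℂ) else 0) + (if i = i₂ then (s₂ : ℂ) else 0) +
    if i = θ j then (δ j : ℂ) else 0
  card_le : 3104 ≤ #((univ.erase 0).image fun j => (θ j, δ j))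

theorem Multiplicities.exists_exceptionalSystem {G : Type*} [Group G] [Fintype G] {T : Subgroup G}
    {τ : ZMod 9313 → G} {S : WedderburnSystem G} {hT : IsolatedHall G T} {hτ : HallParam T τ}
    {m : Fin S.n → ZMod 9313 → ℕ} (hm : Multiplicities S hT hτ m) :
    ∃ t i₁ i₂ s₁ s₂ θ δ, ExceptionalSystem S hm t i₁ i₂ s₁ s₂ θ δ := by
  obtain ⟨t, ht⟩ := S.exists_trivial
  obtain ⟨c, hc, hc01, hcl, hcJ⟩ := hm.exists_sum_diff_mul_diff
  have hJ : #((univ : Finset (ZMod 9313)).erase 0) = 9312 := by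
    rw [card_erase_of_mem (mem_univ _), card_univ, ZMod.card]
  have hne : ∀ j : ZMod 9313, j ∈ (univ : Finset (ZMod 9313)).erase 0 → j ≠ 0 := fun j hj =>
    Finset.ne_of_mem_erase hj
  obtain ⟨i₁, i₂, s₁, s₂, θ, δ, h1, h2, h3, h4, h5, h6, h7⟩ := exists_common_coordinates
    (univ.erase 0) (by rw [hJ]; norm_num) t (fun j i => (m i 0 : ℤ) - m i j)
    (fun j hj => hm.trivial_eq ht (hne j hj)) c
    (fun j hj l hl => by
      have := hc j l (hne j hj) (hne l hl)
      exact_mod_cast this)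
    (fun j l hl => hc01 j l (hne l hl)) (fun l hl => hcl l (hne l hl))
    (fun l hl => hcJ l (hne l hl) _)
  have h6' := fun j (hj : j ≠ 0) => h6 j (Finset.mem_erase.2 ⟨hj, mem_univ _⟩)
  refine ⟨t, i₁, i₂, s₁, s₂, θ, δ, ht, h1, h2, h3, h4, h5,
    fun j hj => ⟨(h6' j hj).1, (h6' j hj).2.1, (h6' j hj).2.2.1⟩, fun j hj => (h6' j hj).2.2.2.1,
    fun j hj i => ?_, ?_⟩
  · have := congrArg (Int.cast : ℤ → ℂ) ((h6' j hj).2.2.2.2 i)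
    push_cast at this
    exact this
  · rw [hJ] at h7
    omega

namespace ExceptionalSystem

open ZMod

variable {G : Type*} [Group G] [Fintype G] {T : Subgroup G} {τ : ZMod 9313 → G}
  {S : WedderburnSystem G} {hT : IsolatedHall G T} {hτ : HallParam T τ}
  {m : Fin S.n → ZMod 9313 → ℕ} {hm : Multiplicities S hT hτ m} {t i₁ i₂ : Fin S.n} {s₁ s₂ : ℤ}
  {θ : ZMod 9313 → Fin S.n} {δ : ZMod 9313 → ℤ} (h : ExceptionalSystem S hm t i₁ i₂ s₁ s₂ θ δ)
include h

theorem sum_diff_mul {j : ZMod 9313} (hj : j ≠ 0) (F : Fin S.n → ℂ) :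
    ∑ i, ((m i 0 : ℂ) - m i j) * F i = F t + s₁ * F i₁ + s₂ * F i₂ + δ j * F (θ j) := by
  simp [h.diff_eq j hj, add_mul, Finset.sum_add_distrib, ite_mul]

theorem relation {g : G} (hg : RegularFor T g) {j : ZMod 9313} (hj : j ≠ 0) :
    1 + s₁ * S.χ i₁ g + s₂ * S.χ i₂ g + δ j * S.χ (θ j) g = 0 := by
  rw [← h.trivial g, ← h.sum_diff_mul hj fun i => S.χ i g]
  exact hm.sum_diff_mul_χ hg j

theorem degree_relation {j : ZMod 9313} (hj : j ≠ 0) :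
    1 + s₁ * (S.d i₁ : ℤ) + s₂ * S.d i₂ + δ j * S.d (θ j) = 0 := by
  have := h.relation (g := 1) (fun _ _ => rfl) hj
  simp only [S.χ_one] at this
  exact_mod_cast this

theorem χ_fst {k : ZMod 9313} (hk : k ≠ 0) : S.χ i₁ (τ k) = s₁ := by
  rw [hm.χ_param_of_ne i₁ hk]
  have h1 : ∀ j ∈ univ.erase (0 : ZMod 9313), ((m i₁ 0 : ℂ) - m i₁ j) * stdAddChar (j * k) =
      s₁ * stdAddChar (k * j) := by
    intro j hj
    have hj := Finset.ne_of_mem_erase hj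
    rw [h.diff_eq j hj, if_neg h.ne₁, if_pos rfl, if_neg h.ne₁₂, if_neg (h.ne_θ j hj).2.1.symm,
      mul_comm k]
    ring
  have h2 := Finset.add_sum_erase univ (fun j => (stdAddChar (k * j) : ℂ)) (mem_univ 0)
  rw [sum_stdAddChar_mul hk] at h2
  rw [Finset.sum_congr rfl h1, ← Finset.mul_sum]
  simp only [mul_zero, AddChar.map_zero_eq_one] at h2
  linear_combination (-s₁ : ℂ) * h2

theorem symm : ExceptionalSystem S hm t i₂ i₁ s₂ s₁ θ δ where
  trivial := h.trivial
  ne₁ := h.ne₂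
  ne₂ := h.ne₁
  ne₁₂ := h.ne₁₂.symm
  sign₁ := h.sign₂
  sign₂ := h.sign₁
  ne_θ j hj := ⟨(h.ne_θ j hj).1, (h.ne_θ j hj).2.2, (h.ne_θ j hj).2.1⟩
  sign_δ := h.sign_δ
  diff_eq j hj i := by rw [h.diff_eq j hj i]; ring
  card_le := h.card_le

theorem exists_degree : ∃ k : ℤ, (S.d i₁ : ℤ) = 9313 * k + s₁ := by
  refine ⟨m i₁ 0 - s₁, ?_⟩
  have h1 := hm.d_eq i₁
  rw [← Finset.add_sum_erase univ _ (mem_univ 0)] at h1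
  have h2 : ∀ j ∈ univ.erase (0 : ZMod 9313), (m i₁ j : ℂ) = m i₁ 0 - s₁ := by
    intro j hj
    have hj := Finset.ne_of_mem_erase hj
    have := h.diff_eq j hj i₁
    rw [if_neg h.ne₁, if_pos rfl, if_neg h.ne₁₂, if_neg (h.ne_θ j hj).2.1.symm] at this
    linear_combination -this
  rw [Finset.sum_congr rfl h2, Finset.sum_const, card_erase_of_mem (mem_univ _), card_univ,
    ZMod.card, nsmul_eq_mul] at h1
  have h3 : ((S.d i₁ : ℤ) : ℂ) = ((9313 * (m i₁ 0 - s₁) + s₁ : ℤ) : ℂ) := by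
    push_cast
    rw [h1]; push_cast; ring
  exact_mod_cast h3

theorem δ_eq {j l : ZMod 9313} (hj : j ≠ 0) (hl : l ≠ 0) : δ j = δ l := by
  have h1 := h.degree_relation hj
  have h2 := h.degree_relation hl
  have h3 : (0 : ℤ) < S.d (θ j) := by have := (S.pos (θ j)).pos; exact_mod_cast this
  have h4 : (0 : ℤ) < S.d (θ l) := by have := (S.pos (θ l)).pos; exact_mod_cast this
  rcases h.sign_δ j hj with h5 | h5 <;> rcases h.sign_δ l hl with h6 | h6 <;> rw [h5] at h1 ⊢ <;>
    rw [h6] at h2 ⊢ <;> exfalso <;> linarith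

theorem χ_θ {g : G} (hg : RegularFor T g) {j l : ZMod 9313} (hj : j ≠ 0) (hl : l ≠ 0) :
    S.χ (θ j) g = S.χ (θ l) g := by
  have h1 := h.relation hg hj
  have h2 := h.relation hg hl
  rw [h.δ_eq hj hl] at h1
  have h3 : (δ l : ℂ) ≠ 0 := by rcases h.sign_δ l hl with h6 | h6 <;> rw [h6] <;> norm_num
  exact mul_left_cancel₀ h3 (by linear_combination h1 - h2)

theorem d_θ {j l : ZMod 9313} (hj : j ≠ 0) (hl : l ≠ 0) : S.d (θ j) = S.d (θ l) := by
  have := h.χ_θ (g := 1) (fun _ _ => rfl) hj hl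
  simp only [S.χ_one] at this
  exact_mod_cast this

theorem norm_sq_le {g : G} (hg : RegularFor T g) {e : ZMod 9313} (he : e ≠ 0) :
    1 + ‖S.χ i₁ g‖ ^ 2 + ‖S.χ i₂ g‖ ^ 2 + 3104 * ‖S.χ (θ e) g‖ ^ 2 ≤
      Nat.card (centralizer {g}) := by
  obtain ⟨Θ, hΘ⟩ : ∃ Θ : Finset (Fin S.n), Θ = (univ.erase (0 : ZMod 9313)).image θ := ⟨_, rfl⟩
  have hΘc : 3104 ≤ #Θ := by
    refine h.card_le.trans ?_
    have : (univ.erase (0 : ZMod 9313)).image (fun j => (θ j, δ j)) =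
        Θ.image fun i => (i, δ e) := by
      rw [hΘ, Finset.image_image]
      exact Finset.image_congr fun j hj => by
        simp only [Function.comp_apply, h.δ_eq (Finset.ne_of_mem_erase hj) he]
    rw [this]
    exact Finset.card_image_le
  have hnot : ∀ i ∈ Θ, i ≠ t ∧ i ≠ i₁ ∧ i ≠ i₂ := by
    intro i hi
    obtain ⟨j, hj, rfl⟩ := Finset.mem_image.1 (hΘ ▸ hi)
    exact h.ne_θ j (Finset.ne_of_mem_erase hj)
  have hθ : ∑ i ∈ Θ, ‖S.χ i g‖ ^ 2 = #Θ * ‖S.χ (θ e) g‖ ^ 2 := by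
    rw [← nsmul_eq_mul, ← Finset.sum_const]
    refine Finset.sum_congr rfl fun i hi => ?_
    obtain ⟨j, hj, rfl⟩ := Finset.mem_image.1 (hΘ ▸ hi)
    rw [h.χ_θ hg (Finset.ne_of_mem_erase hj) he]
  rw [← S.sum_norm_sq g]
  calc _ ≤ 1 + ‖S.χ i₁ g‖ ^ 2 + ‖S.χ i₂ g‖ ^ 2 + #Θ * ‖S.χ (θ e) g‖ ^ 2 := by
        gcongr; exact_mod_cast hΘc
    _ = ∑ i ∈ insert t (insert i₁ (insert i₂ Θ)), ‖S.χ i g‖ ^ 2 := by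
        rw [Finset.sum_insert, Finset.sum_insert, Finset.sum_insert, hθ, h.trivial]
        · simp; ring
        · exact fun hi => (hnot _ hi).2.2 rfl
        · simp only [Finset.mem_insert, not_or]
          exact ⟨h.ne₁₂, fun hi => (hnot _ hi).2.1 rfl⟩
        · simp only [Finset.mem_insert, not_or]
          exact ⟨h.ne₁.symm, h.ne₂.symm, fun hi => (hnot _ hi).1 rfl⟩
    _ ≤ _ := Finset.sum_le_sum_of_subset_of_nonneg (Finset.subset_univ _) fun _ _ _ => by positivity

theorem sum_eq {g g' : G} (hg : RegularFor T g) (hg' : RegularFor T g')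
    {e : ZMod 9313} (he : e ≠ 0) :
    ∑ i, S.χ i g * S.χ i g' * S.χ i (τ e)⁻¹ / S.d i = 1 + s₁ * (S.χ i₁ g * S.χ i₁ g' / S.d i₁) +
      s₂ * (S.χ i₂ g * S.χ i₂ g' / S.d i₂) + δ e * (S.χ (θ e) g * S.χ (θ e) g' / S.d (θ e)) := by
  have ht : S.d t = 1 := by
    have := h.trivial 1
    rw [S.χ_one] at this
    exact_mod_cast this
  have hneg : -e ≠ 0 := neg_ne_zero.2 he
  rw [← hτ.map_neg]
  have h1 : ∀ i, S.χ i g * S.χ i g' * S.χ i (τ (-e)) / S.d i =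
      -∑ j ∈ univ.erase 0, (stdAddChar (-e * j) : ℂ) *
        (((m i 0 : ℂ) - m i j) * (S.χ i g * S.χ i g' / S.d i)) := by
    intro i
    rw [hm.χ_param_of_ne i hneg, mul_neg, neg_div, Finset.mul_sum, Finset.sum_div]
    refine congrArg _ (Finset.sum_congr rfl fun j _ => ?_)
    rw [mul_comm j (-e)]; ring
  rw [Finset.sum_congr rfl fun i _ => h1 i, Finset.sum_neg_distrib, Finset.sum_comm]
  have h2 : ∀ j ∈ univ.erase (0 : ZMod 9313), (∑ i, (stdAddChar (-e * j) : ℂ) *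
        (((m i 0 : ℂ) - m i j) * (S.χ i g * S.χ i g' / S.d i))) = stdAddChar (-e * j) *
      (1 + s₁ * (S.χ i₁ g * S.χ i₁ g' / S.d i₁) + s₂ * (S.χ i₂ g * S.χ i₂ g' / S.d i₂) +
        δ e * (S.χ (θ e) g * S.χ (θ e) g' / S.d (θ e))) := by
    intro j hj
    have hj := Finset.ne_of_mem_erase hj
    rw [← Finset.mul_sum, h.sum_diff_mul hj fun i => S.χ i g * S.χ i g' / S.d i,
      h.χ_θ hg hj he, h.χ_θ hg' hj he, h.d_θ hj he,
      h.δ_eq hj he, h.trivial, h.trivial, ht]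
    simp
  rw [Finset.sum_congr rfl h2, ← Finset.sum_mul]
  have h3 := Finset.add_sum_erase univ (fun j => (stdAddChar (-e * j) : ℂ)) (mem_univ 0)
  rw [sum_stdAddChar_mul hneg] at h3
  simp only [mul_zero, AddChar.map_zero_eq_one] at h3
  rw [eq_neg_of_add_eq_zero_right h3]
  ring

end ExceptionalSystem

end

/-! ### Degrees of the exceptional characters -/

section

open Subgroup Finset

theorem exists_exponents {d : ℕ} (hd : d ∣ 2 ^ 7 * 3 * 7 ^ 4 * 97 ^ 3) :
    ∃ (a : Fin 8) (b : Fin 2) (c : Fin 5) (e : Fin 4),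
      d = 2 ^ (a : ℕ) * 3 ^ (b : ℕ) * 7 ^ (c : ℕ) * 97 ^ (e : ℕ) := by
  obtain ⟨x, w, hx, hw, rfl⟩ := (Nat.dvd_mul).1 hd
  obtain ⟨y, v, hy, hv, rfl⟩ := (Nat.dvd_mul).1 hx
  obtain ⟨z, u, hz, hu, rfl⟩ := (Nat.dvd_mul).1 hy
  obtain ⟨a, ha, rfl⟩ := (Nat.dvd_prime_pow Nat.prime_two).1 hz
  obtain ⟨b, hb, rfl⟩ := (Nat.dvd_prime_pow Nat.prime_three).1 ((pow_one 3).symm ▸ hu)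
  obtain ⟨c, hc, rfl⟩ := (Nat.dvd_prime_pow (by norm_num : Nat.Prime 7)).1 hv
  obtain ⟨e, he, rfl⟩ := (Nat.dvd_prime_pow (by norm_num : Nat.Prime 97)).1 hw
  exact ⟨⟨a, by omega⟩, ⟨b, by omega⟩, ⟨c, by omega⟩, ⟨e, by omega⟩, rfl⟩

theorem degree_cases {d : ℕ} (hd : d ∣ 2 ^ 7 * 3 * 7 ^ 4 * 97 ^ 3) {s : ℤ} (hs : s = 1 ∨ s = -1)
    (hk : ∃ k : ℤ, (d : ℤ) = 9313 * k + s) (hle : d < 10 ^ 8) :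
    s * d = 1 ∨ s * d = -912673 ∨ s * d = -9312 ∨ s * d = -307328 := by
  obtain ⟨k, hk⟩ := hk
  have key : ∀ (a : Fin 8) (b : Fin 2) (c : Fin 5) (e : Fin 4),
      2 ^ (a : ℕ) * 3 ^ (b : ℕ) * 7 ^ (c : ℕ) * 97 ^ (e : ℕ) < 10 ^ 8 →
      (2 ^ (a : ℕ) * 3 ^ (b : ℕ) * 7 ^ (c : ℕ) * 97 ^ (e : ℕ) % 9313 = 1 →
        2 ^ (a : ℕ) * 3 ^ (b : ℕ) * 7 ^ (c : ℕ) * 97 ^ (e : ℕ) = 1) ∧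
      (2 ^ (a : ℕ) * 3 ^ (b : ℕ) * 7 ^ (c : ℕ) * 97 ^ (e : ℕ) % 9313 = 9312 →
        2 ^ (a : ℕ) * 3 ^ (b : ℕ) * 7 ^ (c : ℕ) * 97 ^ (e : ℕ) = 912673 ∨
        2 ^ (a : ℕ) * 3 ^ (b : ℕ) * 7 ^ (c : ℕ) * 97 ^ (e : ℕ) = 9312 ∨
        2 ^ (a : ℕ) * 3 ^ (b : ℕ) * 7 ^ (c : ℕ) * 97 ^ (e : ℕ) = 307328) := by
    decide +kernel
  obtain ⟨a, b, c, e, h⟩ := exists_exponents hd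
  have := key a b c e
  rw [← h] at this
  obtain ⟨h1, h2⟩ := this hle
  rcases hs with rfl | rfl
  · left
    have := h1 (by omega)
    omega
  · right
    have := h2 (by omega)
    omega

theorem dvd_of_dvd_of_coprime {d : ℕ} (hd : d ∣ 2 ^ 7 * 3 * 7 ^ 4 * 67 * 97 ^ 3 * 139)
    (h : d.Coprime 9313) : d ∣ 2 ^ 7 * 3 * 7 ^ 4 * 97 ^ 3 := by
  have : 2 ^ 7 * 3 * 7 ^ 4 * 67 * 97 ^ 3 * 139 = (2 ^ 7 * 3 * 7 ^ 4 * 97 ^ 3) * 9313 := by norm_num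
  rw [this] at hd
  exact h.dvd_of_dvd_mul_right hd

/-- The two nontrivial characters with constant signs on `T`, with their degrees and the two
consequences of orthogonality for them: a bound on centralizers and a class multiplication
formula. -/
structure ExceptionalPair {G : Type*} [Group G] [Fintype G] [DecidableEq G] (S : WedderburnSystem G)
    (T : Subgroup G) (a b : Fin S.n) : Prop where
  d_fst : S.d a = 97 ^ 3
  d_snd : S.d b = 9312
  norm_sq_le : ∀ {g}, RegularFor T g →
    1 + ‖S.χ a g‖ ^ 2 + ‖S.χ b g‖ ^ 2 + 3104 * ‖S.χ a g + S.χ b g - 1‖ ^ 2 ≤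
      Nat.card (centralizer {g})
  exists_classMul : ∀ {g h}, RegularFor T g → RegularFor T h → ∃ f : ℕ,
    (f * Nat.card (centralizer {g}) * Nat.card (centralizer {h}) : ℂ) = Nat.card G *
      (1 - S.χ b g * S.χ b h / 9312 - S.χ a g * S.χ a h / 97 ^ 3 +
        (S.χ a g + S.χ b g - 1) * (S.χ a h + S.χ b h - 1) / 921984)

theorem card_filter_conj_eq {G : Type*} [Group G] [Fintype G] [DecidableEq G] {g y : G}
    (h : IsConj g y) : #{x | x * g * x⁻¹ = y} = Nat.card (centralizer {g}) := by
  obtain ⟨c, hc⟩ := isConj_iff.1 h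
  have : Nat.card (centralizer {g}) = #{x | x * g = g * x} := by
    rw [← Fintype.card_subtype, ← Nat.card_eq_fintype_card]
    exact Nat.card_congr (Equiv.subtypeEquivRight fun x => mem_centralizer_singleton_iff)
  rw [this]
  symm
  refine Finset.card_equiv (Equiv.mulLeft c) fun x => ?_
  simp only [Finset.mem_filter, Finset.mem_univ, true_and, Equiv.coe_mulLeft]
  rw [← hc, mul_inv_rev, show c * x * g * (x⁻¹ * c⁻¹) = c * (x * g * x⁻¹) * c⁻¹ by group,
    mul_left_inj, mul_right_inj, mul_inv_eq_iff_eq_mul]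

theorem exists_card_conj_mul_conj {G : Type*} [Group G] [Fintype G] [DecidableEq G] (g h z : G) :
    ∃ f : ℕ, #{p : G × G | p.1 * g * p.1⁻¹ * (p.2 * h * p.2⁻¹) = z} =
      f * Nat.card (centralizer {g}) * Nat.card (centralizer {h}) := by
  set s : Finset (G × G) := {p : G × G | p.1 * g * p.1⁻¹ * (p.2 * h * p.2⁻¹) = z} with hs
  refine ⟨#(s.image fun p => (p.1 * g * p.1⁻¹, p.2 * h * p.2⁻¹)), ?_⟩
  rw [Finset.card_eq_sum_card_image (fun p => (p.1 * g * p.1⁻¹, p.2 * h * p.2⁻¹)) s, mul_assoc,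
    Finset.card_eq_sum_ones, Finset.sum_mul]
  refine Finset.sum_congr rfl fun y hy => ?_
  obtain ⟨q, hq, rfl⟩ := Finset.mem_image.1 hy
  rw [one_mul, ← card_filter_conj_eq (isConj_iff.2 ⟨q.1, rfl⟩),
    ← card_filter_conj_eq (isConj_iff.2 ⟨q.2, rfl⟩), ← Finset.card_product]
  congr 1
  ext p
  simp only [hs, Finset.mem_filter, Finset.mem_univ, true_and, Finset.mem_product, Prod.mk.injEq]
    at hq ⊢
  constructor
  · rintro ⟨_, h⟩
    exact h
  · rintro ⟨h1, h2⟩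
    exact ⟨by rw [h1, h2, hq], h1, h2⟩

namespace ExceptionalSystem

variable {G : Type*} [Group G] [Fintype G] {T : Subgroup G} {τ : ZMod 9313 → G}
  {S : WedderburnSystem G} {hT : IsolatedHall G T} {hτ : HallParam T τ}
  {m : Fin S.n → ZMod 9313 → ℕ} {hm : Multiplicities S hT hτ m} {t i₁ i₂ : Fin S.n} {s₁ s₂ : ℤ}
  {θ : ZMod 9313 → Fin S.n} {δ : ZMod 9313 → ℤ} (h : ExceptionalSystem S hm t i₁ i₂ s₁ s₂ θ δ)
include h

theorem card_group : Fintype.card G = 2 ^ 7 * 3 * 7 ^ 4 * 67 * 97 ^ 3 * 139 := by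
  rw [← Nat.card_eq_fintype_card, hT.card_group]

theorem degree_sq_le {e : ZMod 9313} (he : e ≠ 0) :
    1 + S.d i₁ ^ 2 + S.d i₂ ^ 2 + 3104 * S.d (θ e) ^ 2 ≤ 921984 * 912673 * 9313 := by
  have := h.norm_sq_le (g := 1) (fun _ _ => rfl) he
  simp only [S.χ_one, Complex.norm_natCast] at this
  have hc : Nat.card (centralizer {(1 : G)}) = Nat.card G := by
    have : centralizer {(1 : G)} = ⊤ := by
      ext x; simp [mem_centralizer_singleton_iff]
    rw [this, Subgroup.card_top]
  rw [hc, hT.card_group] at this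
  have h2 : 1 + S.d i₁ ^ 2 + S.d i₂ ^ 2 + 3104 * S.d (θ e) ^ 2 ≤
    2 ^ 7 * 3 * 7 ^ 4 * 67 * 97 ^ 3 * 139 := by exact_mod_cast this
  exact h2.trans (by norm_num)

theorem degree_fst_cases {e : ZMod 9313} (he : e ≠ 0) :
    s₁ * S.d i₁ = 1 ∨ s₁ * S.d i₁ = -912673 ∨ s₁ * S.d i₁ = -9312 ∨ s₁ * S.d i₁ = -307328 := by
  have hk := h.exists_degree
  refine degree_cases (dvd_of_dvd_of_coprime (h.card_group ▸ S.d_dvd_card i₁) ?_) h.sign₁ hk ?_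
  · obtain ⟨k, hk⟩ := hk
    rw [← Nat.isCoprime_iff_coprime, hk]
    rcases h.sign₁ with hs | hs <;> rw [hs]
    · exact ⟨1, -k, by push_cast; ring⟩
    · exact ⟨-1, k, by push_cast; ring⟩
  · have := h.degree_sq_le he
    nlinarith

theorem degree_fst_ne_one : ¬ s₁ * S.d i₁ = 1 := by
  intro h1
  have hd : S.d i₁ = 1 ∧ s₁ = 1 := by
    rcases h.sign₁ with hs | hs <;> rw [hs] at h1 <;> omega
  have hle : T ≤ (S.ρ i₁).ker := by
    intro g hg
    obtain ⟨k, rfl⟩ := (hτ.mem_iff g).1 hg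
    have h2 : S.χ i₁ (τ k) = 1 := by
      by_cases hk : k = 0
      · rw [hk, hτ.map_zero, S.χ_one, hd.1]; norm_num
      · rw [h.χ_fst hk, hd.2]; norm_num
    rw [MonoidHom.mem_ker]
    have hsub : Subsingleton (Fin (S.d i₁)) := by rw [hd.1]; infer_instance
    have := S.pos i₁
    ext x y
    rw [Subsingleton.elim x 0, Subsingleton.elim y 0]
    have h3 : S.χ i₁ (τ k) = S.ρ i₁ (τ k) 0 0 := by
      rw [WedderburnSystem.χ, Matrix.trace, Fintype.sum_eq_single 0]
      · rfl
      · intro x hx; exact absurd (Subsingleton.elim x 0) hx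
    rw [← h3, h2]; simp
  have htop := hT.eq_top_of_normal (N := (S.ρ i₁).ker) (hT.card ▸ Subgroup.card_dvd_of_le hle)
  have h2 : ∀ g, S.χ i₁ g = 1 := by
    intro g
    have : g ∈ (S.ρ i₁).ker := htop ▸ mem_top g
    rw [WedderburnSystem.χ, MonoidHom.mem_ker.1 this, ← map_one (S.ρ i₁)]
    exact (S.χ_one i₁).trans (by rw [hd.1]; norm_num)
  have h3 := S.orthogonality i₁ t
  rw [if_neg h.ne₁] at h3
  simp [h2, h.trivial] at h3

theorem degrees {e : ZMod 9313} (he : e ≠ 0) :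
    s₁ = -1 ∧ s₂ = -1 ∧ δ e = 1 ∧ S.d (θ e) = 921984 ∧
      (S.d i₁ = 97 ^ 3 ∧ S.d i₂ = 9312 ∨ S.d i₁ = 9312 ∧ S.d i₂ = 97 ^ 3) := by
  have h1 := (h.degree_fst_cases he).resolve_left h.degree_fst_ne_one
  have h2 := (h.symm.degree_fst_cases he).resolve_left h.symm.degree_fst_ne_one
  have h3 := h.degree_relation he
  have h4 : S.d (θ e) ∣ 921984 * 912673 * 9313 := by
    have := S.d_dvd_card (θ e)
    rw [h.card_group] at this
    exact this.trans (by norm_num)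
  have hp : 0 < S.d (θ e) := (S.pos _).pos
  have hδ : δ e = 1 := (h.sign_δ e he).resolve_right fun hδ => by
    rw [hδ] at h3; omega
  have hs₁ : s₁ = -1 := h.sign₁.resolve_left fun hs => by rw [hs] at h1; omega
  have hs₂ : s₂ = -1 := h.sign₂.resolve_left fun hs => by rw [hs] at h2; omega
  rw [hδ] at h3
  rw [hs₁] at h1 h3
  rw [hs₂] at h2 h3
  refine ⟨hs₁, hs₂, hδ, ?_⟩
  have hD : (S.d (θ e) = 921984 ∨ S.d (θ e) = 1825345 ∨ S.d (θ e) = 1220000 ∨ S.d (θ e) = 18623 ∨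
      S.d (θ e) = 316639 ∨ S.d (θ e) = 614655) ∧ (S.d (θ e) = 921984 →
      (S.d i₁ = 97 ^ 3 ∧ S.d i₂ = 9312 ∨ S.d i₁ = 9312 ∧ S.d i₂ = 97 ^ 3)) := by omega
  rcases hD.1 with h5 | h5 | h5 | h5 | h5 | h5
  · exact ⟨h5, hD.2 h5⟩
  all_goals rw [h5] at h4; norm_num at h4

theorem exceptionalPair [DecidableEq G] {e : ZMod 9313} (he : e ≠ 0) (hd : S.d i₁ = 97 ^ 3) :
    ExceptionalPair S T i₁ i₂ := by
  obtain ⟨h1, h2, h3, h4, h5⟩ := h.degrees he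
  have hd2 : S.d i₂ = 9312 := by omega
  have hθ : ∀ g, RegularFor T g → S.χ (θ e) g = S.χ i₁ g + S.χ i₂ g - 1 := by
    intro g hg
    have := h.relation hg he
    rw [h1, h2, h3] at this
    push_cast at this
    linear_combination this
  refine ⟨hd, hd2, fun {g} hg => ?_, fun {g g'} hg hg' => ?_⟩
  · rw [← hθ g hg]
    exact h.norm_sq_le hg he
  · obtain ⟨f, hf⟩ := exists_card_conj_mul_conj g g' (τ e)
    refine ⟨f, ?_⟩
    have := S.card_conj_mul_conj_eq g g' (τ e)
    rw [hf, h.sum_eq hg hg' he, hθ g hg, hθ g' hg', h1, h2, h3, h4, hd, hd2] at this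
    push_cast at this
    rw [this, Nat.card_eq_fintype_card]
    ring

end ExceptionalSystem

theorem IsolatedHall.exists_exceptionalPair {G : Type*} [Group G] [Fintype G] [DecidableEq G]
    {T : Subgroup G} (hT : IsolatedHall G T) :
    ∃ (S : WedderburnSystem G) (a b : Fin S.n), ExceptionalPair S T a b := by
  obtain ⟨S⟩ := WedderburnSystem.nonempty G
  obtain ⟨τ, hτ⟩ := hT.exists_param
  obtain ⟨m, hm⟩ := hτ.exists_multiplicities S
  have hm : Multiplicities S hT hτ m := ⟨hm⟩
  obtain ⟨t, i₁, i₂, s₁, s₂, θ, δ, h⟩ := hm.exists_exceptionalSystem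
  obtain ⟨e, he⟩ : ∃ e : ZMod 9313, e ≠ 0 := by
    have : Fact (1 < 9313) := ⟨by norm_num⟩
    exact exists_ne 0
  rcases (h.degrees he).2.2.2.2 with h5 | h5
  · exact ⟨S, i₁, i₂, h.exceptionalPair he h5.1⟩
  · exact ⟨S, i₂, i₁, h.symm.exceptionalPair he h5.2⟩

end

/-! ### Rationality of character values -/

section

open Subgroup Finset

theorem exists_int_of_mem_fieldRange {x : ℂ} (hx : x ∈ (algebraMap ℚ ℂ).fieldRange)
    (hi : IsIntegral ℤ x) : ∃ n : ℤ, x = n := by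
  obtain ⟨r, rfl⟩ := hx
  rw [isIntegral_algebraMap_iff (algebraMap ℚ ℂ).injective] at hi
  obtain ⟨n, rfl⟩ := IsIntegrallyClosed.isIntegral_iff.1 hi
  exact ⟨n, by simp⟩

theorem card_isConj_mul_card_centralizer {G : Type*} [Group G] [Fintype G] [DecidableEq G] (z : G) :
    #{y | IsConj z y} * Nat.card (centralizer {z}) = Nat.card G := by
  have h1 : ({y | IsConj z y} : Finset G) = univ.image fun x => x * z * x⁻¹ := by
    ext y; simp [isConj_iff]
  rw [Nat.card_eq_fintype_card (α := G), ← Finset.card_univ,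
    Finset.card_eq_sum_card_image (fun x => x * z * x⁻¹) univ, h1, Finset.card_eq_sum_ones,
    Finset.sum_mul]
  refine Finset.sum_congr rfl fun y hy => ?_
  obtain ⟨x, -, rfl⟩ := Finset.mem_image.1 hy
  rw [one_mul, card_filter_conj_eq (isConj_iff.2 ⟨x, rfl⟩)]

theorem WedderburnSystem.exists_sum_zpowers {G : Type*} [Group G] [Fintype G]
    (S : WedderburnSystem G) (i : Fin S.n) (H : Subgroup G) [Fintype H] :
    ∃ m : ℕ, ∑ h : H, S.χ i h = Nat.card H * (m : ℂ) := by
  obtain ⟨m, hm⟩ := exists_multiplicity ((S.ρ i).comp H.subtype) 1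
  refine ⟨m, ?_⟩
  rw [Nat.card_eq_fintype_card, ← hm]
  simp [WedderburnSystem.χ]

theorem norm_lt_of_norm_sq_le {a b : ℂ} {N : ℝ} (hN : N ≤ 921984 * 912673)
    (h : 1 + ‖a‖ ^ 2 + ‖b‖ ^ 2 + 3104 * ‖a + b - 1‖ ^ 2 ≤ N) : ‖a‖ < 912673 := by
  have h1 : ‖a‖ ≤ ‖a + b - 1‖ + ‖b‖ + 1 := by
    calc ‖a‖ = ‖(a + b - 1) - b + 1‖ := by ring_nf
      _ ≤ ‖(a + b - 1) - b‖ + ‖(1 : ℂ)‖ := norm_add_le _ _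
      _ ≤ _ := by rw [norm_one]; gcongr; exact norm_sub_le _ _
  by_contra! hcon
  have h2 : ‖a + b - 1‖ ≤ 16500 := by
    by_contra! h3
    nlinarith [sq_nonneg ‖b‖, sq_nonneg ‖a‖]
  have h3 : ‖b‖ ≤ 92300 := by
    by_contra! h3
    nlinarith [sq_nonneg ‖a + b - 1‖]
  linarith

namespace ExceptionalPair

variable {G : Type*} [Group G] [Fintype G] [DecidableEq G] {T : Subgroup G} {S : WedderburnSystem G}
  {a b : Fin S.n} (hE : ExceptionalPair S T a b) (hT : IsolatedHall G T)
include hE hT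

theorem card_centralizer_dvd {g : G} (hg : RegularFor T g) (hg1 : g ≠ 1) :
    Nat.card (centralizer {g}) ∣ 921984 * 912673 := by
  refine (hT.coprime_card_centralizer hg hg1).dvd_of_dvd_mul_right ?_
  have := Subgroup.card_subgroup_dvd_card (centralizer {g})
  rw [hT.card_group] at this
  exact this.trans (by norm_num)

theorem χ_fst_eq_zero_of_dvd {z : G} (hz : ∀ k, k.Coprime (orderOf z) → RegularFor T (z ^ k))
    (hz1 : z ≠ 1) (hc : 97 ^ 3 ∣ Nat.card (centralizer {z})) : S.χ a z = 0 := by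
  have hcl := card_isConj_mul_card_centralizer z
  have hintegral := S.isIntegral_card_conj_mul_div a z
  have hcop : (#{y | IsConj z y}).Coprime (97 ^ 3) := by
    refine Nat.Coprime.pow_right _ ((Nat.Prime.coprime_iff_not_dvd (by norm_num)).2 ?_).symm
    intro h
    have := Nat.mul_dvd_mul h hc
    rw [hcl, hT.card_group] at this
    norm_num at this
  obtain ⟨u, v, huv⟩ := Nat.isCoprime_iff_coprime.2 hcop
  have hA : IsIntegral ℤ ((S.ρ a z).trace / ((97 ^ 3 : ℕ) : ℂ)) := by
    change IsIntegral ℤ (S.χ a z / ((97 ^ 3 : ℕ) : ℂ))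
    have h1 : S.χ a z / ((97 ^ 3 : ℕ) : ℂ) = u • ((#{y | IsConj z y} : ℂ) * S.χ a z / S.d a) +
        v • S.χ a z := by
      have := congrArg (Int.cast : ℤ → ℂ) huv
      rw [hE.d_fst]
      push_cast at this ⊢
      rw [zsmul_eq_mul, zsmul_eq_mul]
      field_simp
      linear_combination (-S.χ a z) * this
    rw [h1]
    exact (hintegral.smul u).add ((S.isIntegral_χ a z).smul v)
  refine trace_eq_zero_of_small (orderOf_pos z) (S.ρ_pow_orderOf a z) (by norm_num) hA
    fun k hk => ?_
  rw [← map_pow]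
  refine (norm_lt_of_norm_sq_le ?_ (hE.norm_sq_le (hz k hk))).trans_eq (by norm_num)
  have hzk : z ^ k ≠ 1 := fun h => by
    have h2 : orderOf z ∣ k := orderOf_dvd_of_pow_eq_one h
    have : orderOf z = 1 := Nat.eq_one_of_dvd_coprimes hk h2 dvd_rfl
    exact hz1 (orderOf_eq_one_iff.1 this)
  have := Nat.le_of_dvd (by norm_num) (hE.card_centralizer_dvd hT (hz k hk) hzk)
  exact_mod_cast this

theorem mem_fieldRange_of_χ_fst_eq_zero {g h : G} (hg : RegularFor T g) (hh : RegularFor T h)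
    (hag : S.χ a g = 0) (hah : S.χ a h = 0) :
    (9507 * S.χ b g + 97) * (9507 * S.χ b h + 97) ∈ (algebraMap ℚ ℂ).fieldRange := by
  obtain ⟨f, hf⟩ := hE.exists_classMul hg hh
  rw [hag, hah] at hf
  have hG : (Nat.card G : ℂ) ≠ 0 := by simp
  refine ⟨9507 * (921985 * 97 - 89432448 * ((f * Nat.card (centralizer {g}) *
    Nat.card (centralizer {h}) : ℕ) / (Nat.card G : ℚ))) + 97 ^ 2, ?_⟩
  simp only [eq_ratCast]
  push_cast
  rw [hf]
  field_simp
  ring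

theorem exists_mul_eq_of_χ_fst_eq_zero {u : G} (hu : RegularFor T u)
    (hc : 97 ^ 3 ∣ Nat.card (centralizer {u})) (ha : S.χ a u = 0) {n : ℤ} (hn : S.χ b u = n) :
    n = -97 := by
  obtain ⟨f, hf⟩ := hE.exists_classMul hu hu
  obtain ⟨c, hc⟩ := hc
  rw [ha, hn, hT.card_group, hc] at hf
  have hf2 : (97 ^ 4 * (f * c ^ 2) : ℤ) = 9313 * (89432545 - 194 * n - 9507 * n ^ 2) := by
    have : ((97 ^ 4 * (f * c ^ 2) : ℤ) : ℂ) =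
        ((9313 * (89432545 - 194 * n - 9507 * n ^ 2) : ℤ) : ℂ) := by
      push_cast at hf ⊢
      linear_combination hf / 97 ^ 2
    exact_mod_cast this
  have hp : Prime (97 : ℤ) := by norm_num
  have h1 : (97 : ℤ) ∣ n ^ 2 := by
    have h2 : (97 : ℤ) * (97 ^ 3 * (f * c ^ 2)) = 9313 * (89432545 - 194 * n - 9507 * n ^ 2) := by
      rw [← hf2]; ring
    omega
  obtain ⟨β, rfl⟩ := hp.dvd_of_dvd_pow h1
  have hf3 : 97 ^ 2 * (f * c ^ 2) = 9313 * ((1 + β) * (9505 - 9507 * β)) := by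
    refine mul_left_cancel₀ (show (97 ^ 2 : ℤ) ≠ 0 by norm_num) ?_
    linear_combination hf2
  have h4 : (97 : ℤ) ∣ (1 + β) * (9505 - 9507 * β) := by
    have h5 : (97 : ℤ) ∣ 9313 * ((1 + β) * (9505 - 9507 * β)) := by
      rw [← hf3]; exact ⟨97 * (f * c ^ 2), by ring⟩
    exact (hp.dvd_or_dvd h5).resolve_left (by norm_num)
  have h5 : (97 : ℤ) ∣ 1 + β := by
    rcases hp.dvd_or_dvd h4 with h | h
    · exact h
    · omega
  have h6 : 0 ≤ (1 + β) * (9505 - 9507 * β) := by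
    have : (0 : ℤ) ≤ 97 ^ 2 * (f * c ^ 2) := by positivity
    linarith
  have h7 : -1 ≤ β := by
    by_contra! h; nlinarith
  have h8 : β < 1 := by
    by_contra! h; nlinarith
  omega

section Sylow

variable {U : Subgroup G} (hU : Nat.card U = 97 ^ 3)
include hU

omit hE [Fintype G] [DecidableEq G] in
theorem regularFor_of_mem [Finite G] {u : G} (hu : u ∈ U) : RegularFor T u := by
  have h := Subgroup.orderOf_dvd_natCard U hu
  rw [hU] at h
  exact hT.regularFor_of_coprime (Nat.Coprime.coprime_dvd_left h (by norm_num))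

omit hE hT [Fintype G] [DecidableEq G] in
theorem dvd_card_centralizer [Finite G] {z : G} (hz : z ∈ U ⊓ centralizer (U : Set G)) :
    97 ^ 3 ∣ Nat.card (centralizer {z}) := by
  rw [← hU]
  refine Subgroup.card_dvd_of_le fun u hu => ?_
  rw [mem_centralizer_singleton_iff]
  exact (mem_centralizer_iff.1 (mem_inf.1 hz).2 u hu)

theorem χ_fst_eq_zero {z : G} (hz : z ∈ U ⊓ centralizer (U : Set G)) (hz1 : z ≠ 1) :
    S.χ a z = 0 :=
  hE.χ_fst_eq_zero_of_dvd hT (fun k _ => regularFor_of_mem hT hU (pow_mem (mem_inf.1 hz).1 k)) hz1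
    (dvd_card_centralizer hU hz)

theorem χ_snd_of_orderOf {z : G} (hz : z ∈ U ⊓ centralizer (U : Set G)) (hz1 : orderOf z = 97) :
    S.χ b z = -97 := by
  have hreg : ∀ g ∈ U ⊓ centralizer (U : Set G), RegularFor T g := fun g hg =>
    regularFor_of_mem hT hU (mem_inf.1 hg).1
  have hle : zpowers z ≤ U ⊓ centralizer (U : Set G) := by rwa [zpowers_le]
  have hne : z ≠ 1 := by rintro rfl; simp at hz1
  let F : Subfield ℂ := (algebraMap ℚ ℂ).fieldRange
  obtain ⟨m, hm⟩ := S.exists_sum_zpowers b (zpowers z)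
  rw [Nat.card_zpowers, hz1, ← Finset.add_sum_erase univ _ (mem_univ (1 : zpowers z)),
    OneMemClass.coe_one, S.χ_one, hE.d_snd] at hm
  have hsum : ∑ h ∈ univ.erase (1 : zpowers z), (9507 * S.χ b h + 97) =
      9507 * (97 * (m : ℂ) - 9312) + 96 * 97 := by
    rw [Finset.sum_add_distrib, ← Finset.mul_sum, Finset.sum_const, card_erase_of_mem (mem_univ _),
      card_univ, ← Nat.card_eq_fintype_card, Nat.card_zpowers, hz1, nsmul_eq_mul]
    push_cast at hm ⊢
    linear_combination 9507 * hm
  have hmem : (9507 * S.χ b z + 97) * (9507 * (97 * (m : ℂ) - 9312) + 96 * 97) ∈ F := by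
    rw [← hsum, Finset.mul_sum]
    refine sum_mem fun h hh => ?_
    have h1 : (h : G) ≠ 1 := fun h1 => Finset.ne_of_mem_erase hh (Subtype.ext h1)
    exact hE.mem_fieldRange_of_χ_fst_eq_zero hT (hreg z hz) (hreg h (hle h.2))
      (hE.χ_fst_eq_zero hT hU hz hne) (hE.χ_fst_eq_zero hT hU (hle h.2) h1)
  have hne0 : (9507 * (97 * (m : ℂ) - 9312) + 96 * 97) ≠ 0 := by
    have : ((9507 * (97 * (m : ℤ) - 9312) + 96 * 97 : ℤ) : ℂ) ≠ ((0 : ℤ) : ℂ) :=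
      Int.cast_injective.ne (by omega)
    push_cast at this
    convert this using 2
    norm_num
  have hF : ∀ n : ℕ, (n : ℂ) ∈ F := fun n => natCast_mem F n
  have hlit : (9507 * (97 * (m : ℂ) - 9312) + 96 * 97) ∈ F := by
    have := F.add_mem (F.mul_mem (hF 9507) (F.sub_mem (F.mul_mem (hF 97) (hF m)) (hF 9312)))
      (F.mul_mem (hF 96) (hF 97))
    exact_mod_cast this
  have h1 : S.χ b z ∈ F := by
    have h2 := F.div_mem (F.sub_mem (F.div_mem hmem hlit) (hF 97)) (hF 9507)
    rw [mul_div_cancel_right₀ _ hne0] at h2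
    convert h2 using 1
    push_cast
    ring
  obtain ⟨n, hn⟩ := exists_int_of_mem_fieldRange h1 (S.isIntegral_χ b z)
  rw [hn, hE.exists_mul_eq_of_χ_fst_eq_zero hT (hreg z hz) (dvd_card_centralizer hU hz)
    (hE.χ_fst_eq_zero hT hU hz hne) hn]
  norm_num

omit hE hT [Fintype G] [DecidableEq G] in
theorem exists_orderOf_mem_center [Finite G] :
    ∃ z ∈ U ⊓ centralizer (U : Set G), orderOf z = 97 := by
  have : Fact (Nat.Prime 97) := ⟨by norm_num⟩
  have hp : IsPGroup 97 U := IsPGroup.of_card hU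
  have : Nontrivial U := by
    rw [← Finite.one_lt_card_iff_nontrivial, hU]; norm_num
  have := hp.center_nontrivial
  have h2 : 97 ∣ Nat.card (Subgroup.center U) := by
    obtain ⟨n, hn, h⟩ := (hp.to_subgroup (Subgroup.center U)).nontrivial_iff_card.1 this
    rw [h]
    exact dvd_pow_self _ hn.ne'
  obtain ⟨z, hz⟩ := exists_prime_orderOf_dvd_card' 97 h2
  refine ⟨z, mem_inf.2 ⟨z.1.2, ?_⟩, by rw [Subgroup.orderOf_coe, Subgroup.orderOf_coe, hz]⟩
  rw [mem_centralizer_iff]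
  intro u hu
  exact congrArg Subtype.val (Subgroup.mem_center_iff.1 z.2 ⟨u, hu⟩)

theorem χ_snd {z : G} (hz : z ∈ U ⊓ centralizer (U : Set G)) (hz1 : z ≠ 1) : S.χ b z = -97 := by
  have hreg : ∀ g ∈ U ⊓ centralizer (U : Set G), RegularFor T g := fun g hg =>
    regularFor_of_mem hT hU (mem_inf.1 hg).1
  obtain ⟨w, hw, hw1⟩ := exists_orderOf_mem_center hU
  have hne : w ≠ 1 := by rintro rfl; simp at hw1
  let F : Subfield ℂ := (algebraMap ℚ ℂ).fieldRange
  have hmem : _ ∈ F := hE.mem_fieldRange_of_χ_fst_eq_zero hT (hreg z hz) (hreg w hw)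
    (hE.χ_fst_eq_zero hT hU hz hz1) (hE.χ_fst_eq_zero hT hU hw hne)
  rw [hE.χ_snd_of_orderOf hT hU hw hw1] at hmem
  have hF : ∀ n : ℤ, (n : ℂ) ∈ F := fun n => intCast_mem F n
  have h1 : S.χ b z ∈ F := by
    have h2 := F.div_mem (F.sub_mem (F.div_mem hmem (hF (9507 * -97 + 97))) (hF 97)) (hF 9507)
    convert h2 using 1
    push_cast
    norm_num
  obtain ⟨n, hn⟩ := exists_int_of_mem_fieldRange h1 (S.isIntegral_χ b z)
  rw [hn, hE.exists_mul_eq_of_χ_fst_eq_zero hT (hreg z hz) (dvd_card_centralizer hU hz)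
    (hE.χ_fst_eq_zero hT hU hz hz1) hn]
  norm_num

theorem card_center : Nat.card (U ⊓ centralizer (U : Set G) : Subgroup G) = 97 := by
  classical
  set X : Subgroup G := U ⊓ centralizer (U : Set G) with hX
  obtain ⟨w, hw, hw1⟩ := exists_orderOf_mem_center hU
  have h1 : 97 ∣ Nat.card X := hw1 ▸ Subgroup.orderOf_dvd_natCard X hw
  obtain ⟨m, hm⟩ := S.exists_sum_zpowers b X
  rw [← Finset.add_sum_erase univ _ (mem_univ (1 : X)), OneMemClass.coe_one, S.χ_one,
    hE.d_snd, Finset.sum_congr rfl fun h hh => hE.χ_snd hT hU h.2 fun h1 =>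
      Finset.ne_of_mem_erase hh (Subtype.ext h1), Finset.sum_const, card_erase_of_mem (mem_univ _),
    card_univ, ← Nat.card_eq_fintype_card, nsmul_eq_mul] at hm
  have h0 : 0 < Nat.card X := Nat.card_pos
  obtain ⟨c, hc⟩ := h1
  have h2 : (9312 : ℤ) - 97 * (Nat.card X - 1) = Nat.card X * m := by
    rw [Nat.cast_sub h0] at hm
    have : ((9312 - 97 * (Nat.card X - 1) : ℤ) : ℂ) = ((Nat.card X * m : ℤ) : ℂ) := by
      push_cast at hm ⊢
      linear_combination hm
    exact_mod_cast this
  have h3 : (0 : ℤ) ≤ Nat.card X * m := by positivity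
  omega

end Sylow

end ExceptionalPair

end

/-! ### Extraspecial groups and character values -/

section

open Subgroup Finset
open scoped commutatorElement

section ExtraSpecial

variable {P : Type*} [Group P] {p : ℕ} [hp : Fact p.Prime] (hP : Nat.card P = p ^ 3)
  (hZ : Nat.card (center P) = p)
include hP hZ

theorem commutator_mem_center_of_card (g h : P) : ⁅g, h⁆ ∈ center P := by
  have hfin : Finite P := Nat.finite_of_card_ne_zero (hP ▸ pow_ne_zero 3 hp.out.ne_zero)
  have h1 : Nat.card (P ⧸ center P) = p ^ 2 := by
    have := Subgroup.card_mul_index (center P)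
    rw [hZ, hP, Subgroup.index] at this
    exact Nat.eq_of_mul_eq_mul_left hp.out.pos (this.trans (by ring))
  have := IsPGroup.isMulCommutative_of_card_eq_prime_sq h1
  rw [← QuotientGroup.eq_one_iff, ← QuotientGroup.mk'_apply, map_commutatorElement,
    commutatorElement_eq_one_iff_mul_comm]
  exact this.is_comm.comm _ _

/-- The homomorphism `g ↦ ⁅g, u⁆` into the center of a group of class two. -/
def commutatorHom (hc : ∀ g h : P, ⁅g, h⁆ ∈ center P) (u : P) : P →* center P where
  toFun g := ⟨⁅g, u⁆, hc g u⟩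
  map_one' := Subtype.ext (commutatorElement_one_left u)
  map_mul' g h := Subtype.ext <| by
    have := (mem_center_iff.1 (hc h u)) g
    simp only [Subgroup.coe_mul]
    calc ⁅g * h, u⁆ = (g * ⁅h, u⁆) * u * g⁻¹ * u⁻¹ := by simp only [commutatorElement_def]; group
      _ = ⁅h, u⁆ * ⁅g, u⁆ := by rw [this]; simp only [commutatorElement_def]; group
      _ = _ := ((mem_center_iff.1 (hc h u)) _).symm

theorem range_commutatorHom (hc : ∀ g h : P, ⁅g, h⁆ ∈ center P) {u : P} (hu : u ∉ center P) :
    (commutatorHom hc u).range = ⊤ := by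
  have : Fact (Nat.card (center P)).Prime := ⟨hZ ▸ hp.out⟩
  refine ((commutatorHom hc u).range.eq_bot_or_eq_top_of_prime_card).resolve_left fun h => ?_
  refine hu (mem_center_iff.2 fun g => ?_)
  have h1 : commutatorHom hc u g = 1 := by
    rw [← Subgroup.mem_bot, ← h]; exact ⟨g, rfl⟩
  exact commutatorElement_eq_one_iff_mul_comm.1 (congrArg Subtype.val h1)

theorem exists_conj_eq_mul_of_card {u x : P} (hu : u ∉ center P) (hx : x ∈ center P) :
    ∃ g : P, g * u * g⁻¹ = u * x := by
  have hc := commutator_mem_center_of_card hP hZ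
  have := range_commutatorHom hP hZ hc hu
  obtain ⟨g, hg⟩ : (⟨x, hx⟩ : center P) ∈ (commutatorHom hc u).range := this ▸ mem_top _
  refine ⟨g, ?_⟩
  have h1 : ⁅g, u⁆ = x := congrArg Subtype.val hg
  rw [mem_center_iff.1 hx u, ← h1, commutatorElement_def]
  group

theorem card_centralizer_of_card {u : P} (hu : u ∉ center P) :
    Nat.card (centralizer {u}) = p ^ 2 := by
  have hc := commutator_mem_center_of_card hP hZ
  have h1 := range_commutatorHom hP hZ hc hu
  have h2 : (commutatorHom hc u).ker = centralizer {u} := by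
    ext g
    rw [MonoidHom.mem_ker, mem_centralizer_singleton_iff, ← commutatorElement_eq_one_iff_mul_comm]
    exact Subtype.ext_iff
  have h3 := Subgroup.card_mul_index (commutatorHom hc u).ker
  rw [Subgroup.index_ker, h1, Subgroup.card_top, hZ, hP, h2] at h3
  exact Nat.eq_of_mul_eq_mul_right hp.out.pos (h3.trans (by ring))

end ExtraSpecial

section SubgroupCenter

variable {G : Type*} [Group G] {U : Subgroup G}

theorem mem_center_subgroup_iff {u : U} : u ∈ center U ↔ (u : G) ∈ U ⊓ centralizer (U : Set G) := by
  rw [Subgroup.mem_inf, mem_centralizer_iff, mem_center_iff]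
  constructor
  · exact fun h => ⟨u.2, fun g hg => congrArg Subtype.val (h ⟨g, hg⟩)⟩
  · exact fun h g => Subtype.ext (h.2 g g.2)

theorem card_center_subgroup :
    Nat.card (center U) = Nat.card (U ⊓ centralizer (U : Set G) : Subgroup G) :=
  Nat.card_congr
    { toFun := fun u => ⟨u.1, mem_center_subgroup_iff.1 u.2⟩
      invFun := fun u => ⟨⟨u.1, (Subgroup.mem_inf.1 u.2).1⟩, mem_center_subgroup_iff.2 u.2⟩
      left_inv := fun _ => rfl
      right_inv := fun _ => rfl }

variable {p : ℕ} [hp : Fact p.Prime] (hU : Nat.card U = p ^ 3)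
  (hX : Nat.card (U ⊓ centralizer (U : Set G) : Subgroup G) = p)
include hU hX

theorem exists_mem_conj_eq_mul {u x : G} (hu : u ∈ U) (huX : u ∉ U ⊓ centralizer (U : Set G))
    (hx : x ∈ U ⊓ centralizer (U : Set G)) : ∃ g ∈ U, g * u * g⁻¹ = u * x := by
  obtain ⟨g, hg⟩ := exists_conj_eq_mul_of_card (P := U) hU (card_center_subgroup.trans hX)
    (u := ⟨u, hu⟩) (x := ⟨x, (Subgroup.mem_inf.1 hx).1⟩)
    (fun h => huX (mem_center_subgroup_iff.1 h))
    (mem_center_subgroup_iff.2 hx)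
  exact ⟨g, g.2, congrArg Subtype.val hg⟩

theorem card_inf_centralizer {u : G} (hu : u ∈ U) (huX : u ∉ U ⊓ centralizer (U : Set G)) :
    Nat.card (U ⊓ centralizer {u} : Subgroup G) = p ^ 2 := by
  rw [← card_centralizer_of_card (P := U) hU (card_center_subgroup.trans hX)
    (u := ⟨u, hu⟩) (fun h => huX (mem_center_subgroup_iff.1 h))]
  refine Nat.card_congr
    { toFun := fun g => ⟨⟨g.1, (Subgroup.mem_inf.1 g.2).1⟩, ?_⟩
      invFun := fun g => ⟨g.1.1, Subgroup.mem_inf.2 ⟨g.1.2, ?_⟩⟩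
      left_inv := fun _ => rfl
      right_inv := fun _ => rfl }
  · rw [mem_centralizer_singleton_iff]
    exact Subtype.ext (mem_centralizer_singleton_iff.1 (Subgroup.mem_inf.1 g.2).2)
  · rw [mem_centralizer_singleton_iff]
    exact congrArg Subtype.val (mem_centralizer_singleton_iff.1 g.2)

end SubgroupCenter

namespace ExceptionalPair

variable {G : Type*} [Group G] [Fintype G] [DecidableEq G] {T : Subgroup G} {S : WedderburnSystem G}
  {a b : Fin S.n} (hE : ExceptionalPair S T a b) (hT : IsolatedHall G T)
  {U : Subgroup G} (hU : Nat.card U = 97 ^ 3)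
include hE hT hU

theorem χ_snd_eq_zero {u : G} (hu : u ∈ U) (huX : u ∉ U ⊓ centralizer (U : Set G)) :
    S.χ b u = 0 := by
  classical
  have : Fact (Nat.Prime 97) := ⟨by norm_num⟩
  have hX := hE.card_center hT hU
  set X : Subgroup G := U ⊓ centralizer (U : Set G) with hXdef
  have h0 : ∑ x : X, ((S.ρ b).comp X.subtype x).trace = 0 := by
    change ∑ x : X, S.χ b x = 0
    rw [← Finset.add_sum_erase univ _ (mem_univ (1 : X)), OneMemClass.coe_one, S.χ_one,
      hE.d_snd, Finset.sum_congr rfl fun h hh => hE.χ_snd hT hU h.2 fun h1 =>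
        Finset.ne_of_mem_erase hh (Subtype.ext h1), Finset.sum_const,
      card_erase_of_mem (mem_univ _), card_univ, ← Nat.card_eq_fintype_card, hX]
    norm_num
  have h1 := sum_rep_eq_zero _ h0
  have h2 : ∑ x : X, S.χ b (u * x) = 0 := by
    have : ∀ x : X, S.χ b (u * x) = (S.ρ b u * (S.ρ b).comp X.subtype x).trace := fun x => by
      rw [WedderburnSystem.χ, map_mul]; rfl
    simp only [this]
    rw [← Matrix.trace_sum, ← Finset.mul_sum, h1, mul_zero, Matrix.trace_zero]
  have h3 : ∀ x : X, S.χ b (u * x) = S.χ b u := by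
    intro x
    obtain ⟨g, -, hg⟩ := exists_mem_conj_eq_mul hU hX hu huX x.2
    rw [← hg, S.χ_conj]
  simp only [h3, Finset.sum_const, card_univ, ← Nat.card_eq_fintype_card, nsmul_eq_mul, hX] at h2
  simpa using h2

theorem not_dvd_card_centralizer {u : G} (hu : u ∈ U) (huX : u ∉ U ⊓ centralizer (U : Set G)) :
    ¬ 97 ^ 3 ∣ Nat.card (centralizer {u}) := by
  intro h
  have : Fact (Nat.Prime 97) := ⟨by norm_num⟩
  have hu1 : u ≠ 1 := fun h => huX (h ▸ one_mem _)
  obtain ⟨V, hV⟩ := Sylow.exists_subgroup_card_pow_prime 97 h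
  obtain ⟨W, hWle, hW⟩ : ∃ W : Subgroup G, W ≤ centralizer {u} ∧ Nat.card W = 97 ^ 3 :=
    ⟨V.map (centralizer {u}).subtype, map_subtype_le V,
      by rw [Subgroup.card_map_of_injective (subtype_injective _), hV]⟩
  have hcomm : ∀ w ∈ W, w * u = u * w := fun w hw => mem_centralizer_singleton_iff.1 (hWle hw)
  have hWp : IsPGroup 97 W := IsPGroup.of_card hW
  have hup : IsPGroup 97 (zpowers u) := (IsPGroup.of_card hU).to_le (by rwa [zpowers_le])
  have hsup : IsPGroup 97 (W ⊔ zpowers u : Subgroup G) := by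
    refine hWp.to_sup_of_normal_right' hup ?_
    intro w hw
    rw [mem_normalizer_iff]
    intro z
    have hz : ∀ w ∈ W, ∀ z ∈ zpowers u, w * z * w⁻¹ = z := by
      intro w hw z hz
      obtain ⟨n, rfl⟩ := mem_zpowers_iff.1 hz
      have h1 : Commute w (u ^ n) := Commute.zpow_right (hcomm w hw) n
      rw [h1.eq, mul_inv_cancel_right]
    constructor
    · intro hzz
      rwa [hz w hw z hzz]
    · intro hzz
      have := hz w⁻¹ (inv_mem hw) _ hzz
      have h2 : z = w * z * w⁻¹ := by rw [← this]; group
      rwa [h2]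
  obtain ⟨n, hn⟩ := hsup.exists_card_eq
  have hn3 : n ≤ 3 := by
    by_contra! hlt
    have h1 := Subgroup.card_subgroup_dvd_card (W ⊔ zpowers u)
    rw [hn, hT.card_group] at h1
    have h2 := (pow_dvd_pow 97 hlt).trans h1
    norm_num at h2
  have heq : W = W ⊔ zpowers u := Subgroup.eq_of_le_of_card_ge le_sup_left (by
    rw [hn, hW]; exact Nat.pow_le_pow_right (by norm_num) hn3)
  have huW : u ∈ W := heq ▸ mem_sup_right (mem_zpowers u)
  have h1 := hE.χ_snd hT hW (z := u) (Subgroup.mem_inf.2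
    ⟨huW, mem_centralizer_iff.2 fun w hw => hcomm w hw⟩)
    hu1
  rw [hE.χ_snd_eq_zero hT hU hu huX] at h1
  norm_num at h1

theorem χ_fst_eq_zero_and_card {u x : G} (hu : u ∈ U) (huX : u ∉ U ⊓ centralizer (U : Set G))
    (hx : x ∈ U ⊓ centralizer (U : Set G)) (hx1 : x ≠ 1) :
    ∃ κ k : ℕ, Nat.card (centralizer {x}) = 97 ^ 3 * κ ∧ Nat.card (centralizer {u}) = 97 ^ 2 * k ∧
      κ * k ∣ 98 ∧ 33 ≤ κ := by
  have : Fact (Nat.Prime 97) := ⟨by norm_num⟩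
  have hX := hE.card_center hT hU
  have hu1 : u ≠ 1 := fun h => huX (h ▸ one_mem _)
  have hru := regularFor_of_mem hT hU hu
  have hrx := regularFor_of_mem hT hU (Subgroup.mem_inf.1 hx).1
  obtain ⟨κ, hκ⟩ := dvd_card_centralizer hU hx
  obtain ⟨k, hk⟩ : 97 ^ 2 ∣ Nat.card (centralizer {u}) := by
    rw [← card_inf_centralizer hU hX hu huX]
    exact Subgroup.card_dvd_of_le inf_le_right
  have hbu := hE.χ_snd_eq_zero hT hU hu huX
  have hbx := hE.χ_snd hT hU hx hx1
  have hax := hE.χ_fst_eq_zero hT hU hx hx1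
  obtain ⟨f, hf⟩ := hE.exists_classMul hru hrx
  rw [hbu, hbx, hax, hκ, hk, hT.card_group] at hf
  have hf2 : S.χ a u = 9409 - 97 ^ 2 * ((f * k * κ : ℕ) : ℂ) / 912674 := by
    push_cast at hf ⊢
    linear_combination (1 / (97 ^ 3 * 9313 * 98) : ℂ) * hf
  obtain ⟨n, hn⟩ := exists_int_of_mem_fieldRange (x := S.χ a u)
    ⟨9409 - 97 ^ 2 * ((f * k * κ : ℕ) : ℚ) / 912674, by rw [hf2]; simp⟩ (S.isIntegral_χ a u)
  have hf3 : 912674 * n = 912674 * 9409 - 9409 * ((f * k * κ : ℕ) : ℤ) := by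
    rw [hn] at hf2
    have : ((912674 * n : ℤ) : ℂ) = ((912674 * 9409 - 9409 * ((f * k * κ : ℕ) : ℤ) : ℤ) : ℂ) := by
      push_cast at hf2 ⊢
      linear_combination 912674 * hf2
    exact_mod_cast this
  have hkle : 97 ^ 2 * k ≤ 921984 * 97 ^ 2 := by
    have h1 := hE.card_centralizer_dvd hT hru hu1
    have h2 := hE.not_dvd_card_centralizer hT hU hu huX
    rw [hk] at h1 h2
    have h3 : k ∣ 921984 * 97 := Nat.dvd_of_mul_dvd_mul_left (show 0 < 97 ^ 2 by norm_num)
      (h1.trans (by norm_num))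
    have h4 : ¬ 97 ∣ k := fun h => h2 ((pow_succ 97 2) ▸ Nat.mul_dvd_mul_left _ h)
    have h5 : k ∣ 921984 := by
      refine Nat.Coprime.dvd_of_dvd_mul_right ?_ h3
      exact ((Nat.Prime.coprime_iff_not_dvd (by norm_num)).2 h4).symm
    have := Nat.le_of_dvd (by norm_num) h5
    omega
  have hbes := hE.norm_sq_le hru
  rw [hbu, hn, hk, norm_zero, add_zero] at hbes
  have hn0 : n = 0 := by
    have e1 : ‖(n : ℂ) - 1‖ ^ 2 = ((n : ℝ) - 1) ^ 2 := by
      have : (n : ℂ) - 1 = (((n : ℝ) - 1 : ℝ) : ℂ) := by push_cast; rfl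
      rw [this, Complex.norm_real, Real.norm_eq_abs, sq_abs]
    rw [e1] at hbes
    have h2 : (3104 * (n - 1) ^ 2 : ℤ) ≤ 921984 * 97 ^ 2 := by
      have h3 : (3104 * ((n : ℝ) - 1) ^ 2) ≤ 921984 * 97 ^ 2 := by
        have h4 : ((97 ^ 2 * k : ℕ) : ℝ) ≤ ((921984 * 97 ^ 2 : ℕ) : ℝ) := by exact_mod_cast hkle
        push_cast at hbes h4
        nlinarith [sq_nonneg ‖(n : ℂ)‖]
      exact_mod_cast h3
    have h3 : n < 1700 := by nlinarith
    have h4 : -1700 < n := by nlinarith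
    omega
  refine ⟨κ, k, hκ, hk, ?_, ?_⟩
  · have h1 : f * (κ * k) = 912674 := by
      have : ((f * k * κ : ℕ) : ℤ) = 912674 := by rw [hn0] at hf3; omega
      have h2 : f * k * κ = 912674 := by exact_mod_cast this
      rw [← h2]; ring
    have hx' := hE.card_centralizer_dvd hT hrx hx1
    have hu' := hE.card_centralizer_dvd hT hru hu1
    rw [hκ] at hx'
    rw [hk] at hu'
    have c : (921984 * 912673).Coprime 9313 := by norm_num
    have hcop : (κ * k).Coprime 9313 := Nat.Coprime.mul_left
      (Nat.Coprime.coprime_dvd_left ((Dvd.intro_left _ rfl).trans hx') c)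
      (Nat.Coprime.coprime_dvd_left ((Dvd.intro_left _ rfl).trans hu') c)
    refine hcop.dvd_of_dvd_mul_right (n := 9313) ?_
    exact ⟨f, by rw [mul_comm (κ * k), h1]⟩
  · have h1 := hE.norm_sq_le hrx
    rw [hbx, hax, hκ] at h1
    norm_num at h1
    have : (29820226 : ℝ) ≤ ((912673 * κ : ℕ) : ℝ) := by push_cast; linarith
    have h2 : 29820226 ≤ 912673 * κ := by exact_mod_cast this
    omega

end ExceptionalPair

end

/-! ### The local structure at the prime `97` -/

section

open Subgroup Finset
open scoped commutatorElement

theorem exists_normal_card_eq {C : Type*} [Group C] [Finite C] {n κ : ℕ} (hn : Odd n)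
    (hC : Nat.card C = n * κ) (hκ : κ ∣ 98) :
    ∃ (K : Subgroup C) (m : ℕ), K.Normal ∧ m ∣ 49 ∧ Nat.card K = n * m := by
  have : Fact (Nat.Prime 2) := ⟨Nat.prime_two⟩
  have hκ' : κ ∈ Nat.divisors 98 := Nat.mem_divisors.2 ⟨hκ, by norm_num⟩
  rw [show Nat.divisors 98 = {1, 2, 7, 14, 49, 98} by decide +kernel] at hκ'
  have hcase : κ ∣ 49 ∨ ∃ m, m ∣ 49 ∧ κ = 2 * m := by
    simp only [Finset.mem_insert, Finset.mem_singleton] at hκ'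
    rcases hκ' with rfl | rfl | rfl | rfl | rfl | rfl
    · exact .inl (by norm_num)
    · exact .inr ⟨1, by norm_num⟩
    · exact .inl (by norm_num)
    · exact .inr ⟨7, by norm_num⟩
    · exact .inl (by norm_num)
    · exact .inr ⟨49, by norm_num⟩
  rcases hcase with h | ⟨m, hm, rfl⟩
  · exact ⟨⊤, κ, inferInstance, h, by rw [card_top, hC]⟩
  have hodd : Odd (n * m) := hn.mul (Odd.of_dvd_nat (by decide) hm)
  have hmin : (Nat.card C).minFac = 2 := by
    rw [Nat.minFac_eq_two_iff, hC]; exact ⟨n * m, by ring⟩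
  let P : Sylow 2 C := default
  have hP : Nat.card P = 2 := by
    have h0 : n * m ≠ 0 := hodd.pos.ne'
    rw [P.card_eq_multiplicity, hC, show n * (2 * m) = 2 * (n * m) by ring,
      Nat.factorization_mul two_ne_zero h0]
    simp [Nat.prime_two.factorization, Nat.factorization_eq_zero_of_not_dvd
      (show ¬ 2 ∣ n * m from hodd.not_two_dvd_nat)]
  have hcyc : IsCyclic P := isCyclic_of_prime_card hP
  have h1 := (IsCyclic.isComplement' hmin hcyc).card_mul_card
  rw [hC] at h1
  change _ * Nat.card P = _ at h1
  refine ⟨(MonoidHom.transferSylow P (hcyc.normalizer_le_centralizer hmin)).ker, m,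
    MonoidHom.normal_ker _, hm, Nat.eq_of_mul_eq_mul_right two_pos ?_⟩
  rw [hP] at h1
  rw [h1]; ring

theorem normal_of_card_eq {C : Type*} [Group C] [Finite C] {κ : ℕ}
    (hC : Nat.card C = 97 ^ 3 * κ) (hκ : κ ∣ 98) {W : Subgroup C} (hW : Nat.card W = 97 ^ 3) :
    W.Normal := by
  have : Fact (Nat.Prime 97) := ⟨by norm_num⟩
  obtain ⟨K, m, hK, hm, hKc⟩ := exists_normal_card_eq (by decide) hC hκ
  have hfac : ∀ l, l ∣ 98 → (97 ^ 3 * l).factorization 97 = 3 := by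
    intro l hl
    have h0 : l ≠ 0 := by rintro rfl; norm_num at hl
    have h97 : ¬ 97 ∣ l := fun h => by have := h.trans hl; norm_num at this
    rw [Nat.factorization_mul (by norm_num) h0, Nat.factorization_pow]
    simp [(show Nat.Prime 97 by norm_num).factorization,
      Nat.factorization_eq_zero_of_not_dvd h97]
  let P : Sylow 97 K := default
  have hP : Nat.card P = 97 ^ 3 := by
    rw [P.card_eq_multiplicity, hKc, hfac m (hm.trans (by norm_num))]
  have hone : Nat.card (Sylow 97 K) = 1 := by
    have h1 := P.card_dvd_index
    have h2 : (P : Subgroup K).index = m := by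
      have := Subgroup.card_mul_index (P : Subgroup K)
      change Nat.card P * _ = _ at this
      rw [hP, hKc] at this
      exact Nat.eq_of_mul_eq_mul_left (by norm_num) this
    rw [h2] at h1
    have h3 := card_sylow_modEq_one 97 K
    have h4 := Nat.le_of_dvd (by norm_num) (h1.trans hm)
    rw [Nat.ModEq, Nat.mod_eq_of_lt (by omega)] at h3
    exact h3
  have : Subsingleton (Sylow 97 K) := (Nat.card_eq_one_iff_unique.1 hone).1
  have hchar := Sylow.characteristic_of_subsingleton P
  have hnorm : ((P : Subgroup K).map K.subtype).Normal :=
    ConjAct.normal_of_characteristic_of_normal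
  have hc : Nat.card ((P : Subgroup K).map K.subtype) = 97 ^ 3 := by
    rw [Subgroup.card_map_of_injective (subtype_injective _)]; exact hP
  let Q : Sylow 97 C := Sylow.ofCard ((P : Subgroup K).map K.subtype)
    (by rw [hc, hC, hfac κ hκ])
  let R : Sylow 97 C := Sylow.ofCard W (by rw [hW, hC, hfac κ hκ])
  have := Sylow.unique_of_normal Q (by rwa [Sylow.coe_ofCard])
  have hQR : (R : Subgroup C) = (Q : Subgroup C) := by rw [Subsingleton.elim R Q]
  rw [Sylow.coe_ofCard, Sylow.coe_ofCard] at hQR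
  rwa [hQR]

/-- The local structure at the prime `97` of a group resembling `U₃(97)`. -/
structure UnitaryLocal (G : Type*) [Group G] (U : Subgroup G) : Prop where
  card_group : Nat.card G = 97 ^ 3 * 9408 * 912674
  card : Nat.card U = 97 ^ 3
  card_inf : Nat.card (U ⊓ centralizer (U : Set G) : Subgroup G) = 97
  card_normalizer : Nat.card (normalizer (U : Set G)) = 97 ^ 3 * 9408
  card_centralizer : Nat.card (centralizer ((U ⊓ centralizer (U : Set G) : Subgroup G) : Set G)) =
    97 ^ 3 * 98
  centralizer_le : ∀ u ∈ U, u ∉ U ⊓ centralizer (U : Set G) → centralizer {u} ≤ U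
  mem_normalizer : ∀ u ∈ U, u ≠ 1 → ∀ g, g * u * g⁻¹ ∈ U → g ∈ normalizer (U : Set G)
  eq_top : ∀ N : Subgroup G, N.Normal → 9313 ∣ Nat.card N → N = ⊤

theorem zpowers_eq_of_prime_card {G : Type*} [Group G] {p : ℕ} [hp : Fact p.Prime] {X : Subgroup G}
    (hX : Nat.card X = p) {x : G} (hx : x ∈ X) (hx1 : x ≠ 1) : zpowers x = X := by
  have : Finite X := Nat.finite_of_card_ne_zero (hX ▸ hp.out.ne_zero)
  have h1 := Subgroup.orderOf_dvd_natCard X hx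
  rw [hX, Nat.dvd_prime hp.out, orderOf_eq_one_iff] at h1
  exact eq_of_le_of_card_ge (zpowers_le.2 hx)
    (by rw [hX, Nat.card_zpowers, h1.resolve_left hx1])

theorem centralizer_eq_of_prime_card {G : Type*} [Group G] {p : ℕ} [Fact p.Prime] {X : Subgroup G}
    (hX : Nat.card X = p) {x : G} (hx : x ∈ X) (hx1 : x ≠ 1) :
    centralizer (X : Set G) = centralizer {x} := by
  ext g
  rw [← zpowers_eq_of_prime_card hX hx hx1, mem_centralizer_zpowers, mem_centralizer_singleton_iff]

theorem normalizer_le_normalizer_inf {G : Type*} [Group G] (U : Subgroup G) :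
    normalizer (U : Set G) ≤ normalizer ((U ⊓ centralizer (U : Set G) : Subgroup G) : Set G) := by
  have key : ∀ g ∈ normalizer (U : Set G), ∀ z ∈ U ⊓ centralizer (U : Set G),
      g * z * g⁻¹ ∈ U ⊓ centralizer (U : Set G) := by
    intro g hg z hz
    refine Subgroup.mem_inf.2 ⟨(mem_normalizer_iff.1 hg z).1 (Subgroup.mem_inf.1 hz).1,
      mem_centralizer_iff.2 fun u hu => ?_⟩
    have h1 : g⁻¹ * u * g ∈ U := by
      have := (mem_normalizer_iff.1 (inv_mem hg) u).1 hu
      rwa [inv_inv] at this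
    have h2 := mem_centralizer_iff.1 (Subgroup.mem_inf.1 hz).2 _ h1
    calc u * (g * z * g⁻¹) = g * ((g⁻¹ * u * g) * z) * g⁻¹ := by group
      _ = g * z * g⁻¹ * u := by rw [h2]; group
  intro g hg
  rw [mem_normalizer_iff]
  refine fun z => ⟨key g hg z, fun hz => ?_⟩
  have := key g⁻¹ (inv_mem hg) _ hz
  rwa [inv_inv, show g⁻¹ * (g * z * g⁻¹) * g = z by group] at this

namespace ExceptionalPair

variable {G : Type*} [Group G] [Fintype G] [DecidableEq G] {T : Subgroup G} {S : WedderburnSystem G}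
  {a b : Fin S.n} (hE : ExceptionalPair S T a b) (hT : IsolatedHall G T)
  {U : Subgroup G} (hU : Nat.card U = 97 ^ 3)
include hE hT hU

theorem centralizer_inf_le_normalizer :
    centralizer ((U ⊓ centralizer (U : Set G) : Subgroup G) : Set G) ≤ normalizer (U : Set G) ∧
    ∃ κ, Nat.card (centralizer ((U ⊓ centralizer (U : Set G) : Subgroup G) : Set G)) = 97 ^ 3 * κ ∧
      (κ = 49 ∨ κ = 98) ∧
      (κ = 98 → ∀ u ∈ U, u ∉ U ⊓ centralizer (U : Set G) →
        Nat.card (centralizer {u}) = 97 ^ 2) := by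
  have : Fact (Nat.Prime 97) := ⟨by norm_num⟩
  have hX := hE.card_center hT hU
  set X : Subgroup G := U ⊓ centralizer (U : Set G) with hXdef
  obtain ⟨x, hx, hx97⟩ := exists_orderOf_mem_center hU
  have hx1 : x ≠ 1 := by rintro rfl; simp at hx97
  have hCX : centralizer (X : Set G) = centralizer {x} := centralizer_eq_of_prime_card hX hx hx1
  have key : ∀ u ∈ U, u ∉ X → ∃ κ k : ℕ, Nat.card (centralizer {x}) = 97 ^ 3 * κ ∧
      Nat.card (centralizer {u}) = 97 ^ 2 * k ∧ κ * k ∣ 98 ∧ 33 ≤ κ := fun u hu huX =>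
    hE.χ_fst_eq_zero_and_card hT hU hu huX hx hx1
  obtain ⟨u, hu, huX⟩ : ∃ u ∈ U, u ∉ X := by
    by_contra! h
    have := Subgroup.card_le_of_le (show U ≤ X from h)
    rw [hU, hX] at this
    norm_num at this
  obtain ⟨κ, k, hκ, -, hκk, hκ33⟩ := key u hu huX
  have hκ98 : κ ∣ 98 := (Dvd.intro _ rfl).trans hκk
  have hUC : U ≤ centralizer (X : Set G) := fun u hu => mem_centralizer_iff.2 fun z hz =>
    (mem_centralizer_iff.1 (Subgroup.mem_inf.1 hz).2 u hu).symm
  rw [hCX] at hUC ⊢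
  refine ⟨?_, κ, hκ, ?_, ?_⟩
  · have hn : (U.subgroupOf (centralizer {x})).Normal := normal_of_card_eq hκ hκ98 (by
      rw [Nat.card_congr (subgroupOfEquivOfLe hUC).toEquiv, hU])
    exact (normal_subgroupOf_iff_le_normalizer hUC).1 hn
  · have hκ' : κ ∈ Nat.divisors 98 := Nat.mem_divisors.2 ⟨hκ98, by norm_num⟩
    rw [show Nat.divisors 98 = {1, 2, 7, 14, 49, 98} by decide +kernel] at hκ'
    simp only [Finset.mem_insert, Finset.mem_singleton] at hκ'
    omega
  · rintro rfl v hv hvX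
    obtain ⟨κ', k', h1, h2, h3, -⟩ := key v hv hvX
    have : κ' = 98 := Nat.eq_of_mul_eq_mul_left (by norm_num) (h1.symm.trans hκ)
    subst this
    have hk' : k' = 1 := Nat.dvd_one.1 (Nat.dvd_of_mul_dvd_mul_left (show 0 < 98 by norm_num) h3)
    rw [h2, hk', mul_one]

theorem unitaryLocal : UnitaryLocal G U := by
  have : Fact (Nat.Prime 97) := ⟨by norm_num⟩
  have hX := hE.card_center hT hU
  obtain ⟨hCN, κ, hκ, hκ', hCu⟩ := hE.centralizer_inf_le_normalizer hT hU
  set X : Subgroup G := U ⊓ centralizer (U : Set G) with hXdef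
  have hcyc : IsCyclic X := isCyclic_of_prime_card hX
  obtain ⟨e, he, heN⟩ := X.exists_card_normalizer_eq
  have hNU : Nat.card (normalizer (U : Set G)) ∣ 97 ^ 3 * (κ * e) := by
    rw [← mul_assoc, ← hκ, ← heN]
    exact Subgroup.card_dvd_of_le (normalizer_le_normalizer_inf U)
  have hκN : 97 ^ 3 * κ ∣ Nat.card (normalizer (U : Set G)) := hκ ▸ Subgroup.card_dvd_of_le hCN
  obtain ⟨ν, hν⟩ := hκN
  have he96 : e ∣ 96 := by rwa [hX, Nat.totient_prime (by norm_num)] at he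
  have hν96 : ν ∣ 96 := by
    rw [hν, mul_assoc] at hNU
    have h1 := Nat.dvd_of_mul_dvd_mul_left (by norm_num) hNU
    exact (Nat.dvd_of_mul_dvd_mul_left (by omega) h1).trans he96
  have hsyl : κ * ν * (normalizer (U : Set G)).index = 9408 * 912674 ∧
      (normalizer (U : Set G)).index % 97 = 1 := by
    have h1 := Subgroup.card_mul_index (normalizer (U : Set G))
    rw [hν, hT.card_group] at h1
    refine ⟨by nlinarith, ?_⟩
    let P : Sylow 97 G := Sylow.ofCard U (by
      rw [hU, hT.card_group]
      congr 1
      rw [show 2 ^ 7 * 3 * 7 ^ 4 * 67 * 97 ^ 3 * 139 = 97 ^ 3 * (2 ^ 7 * 3 * 7 ^ 4 * 67 * 139) by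
        norm_num, Nat.factorization_mul (by norm_num) (by norm_num), Nat.factorization_pow]
      simp only [Finsupp.coe_add, Finsupp.coe_smul, Pi.add_apply, Pi.smul_apply]
      rw [(show Nat.Prime 97 by norm_num).factorization, Nat.factorization_eq_zero_of_not_dvd
        (show ¬ 97 ∣ 2 ^ 7 * 3 * 7 ^ 4 * 67 * 139 by norm_num)]
      simp)
    have h2 := P.card_eq_index_normalizer
    have h3 := card_sylow_modEq_one 97 G
    rw [h2, ← Sylow.coe_coe, Sylow.coe_ofCard] at h3
    exact h3
  have hnum : κ = 98 ∧ ν = 96 := by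
    have h1 : (κ * ν) % 97 = 96 := by
      have := congrArg (· % 97) hsyl.1
      simp only [Nat.mul_mod (κ * ν), hsyl.2] at this
      simpa using this
    have hν' : ν ≤ 96 := Nat.le_of_dvd (by norm_num) hν96
    rcases hκ' with rfl | rfl
    · exfalso
      have : ν = 95 := by omega
      subst this
      norm_num at hν96
    · exact ⟨rfl, by omega⟩
  obtain ⟨rfl, rfl⟩ := hnum
  have hfuse : ∀ y ∈ U, y ∉ X → ∀ z ∈ X, z ≠ 1 → ∀ g, g * z * g⁻¹ ≠ y := by
    rintro y hy hyX z hz hz1 g rfl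
    have h1 := hE.χ_snd_eq_zero hT hU hy hyX
    rw [S.χ_conj, hE.χ_snd hT hU hz hz1] at h1
    norm_num at h1
  have hTI1 : ∀ z ∈ X, z ≠ 1 → ∀ g, g * z * g⁻¹ ∈ U → g ∈ normalizer (U : Set G) := by
    intro z hz hz1 g hg
    have h1 : g * z * g⁻¹ ∈ X := by
      by_contra h
      exact hfuse _ hg h z hz hz1 g rfl
    have hNX : normalizer (U : Set G) = normalizer (X : Set G) := by
      refine eq_of_le_of_card_ge (normalizer_le_normalizer_inf U) ?_
      rw [heN, hκ, hν]
      exact Nat.mul_le_mul_left _ (Nat.le_of_dvd (by norm_num) he96)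
    rw [hNX]
    have hmap : X.map (MulAut.conj g).toMonoidHom = X := by
      refine eq_of_le_of_card_ge ?_ ?_
      · rw [← zpowers_eq_of_prime_card hX hz hz1, MonoidHom.map_zpowers, zpowers_le,
          zpowers_eq_of_prime_card hX hz hz1]
        exact h1
      · rw [Subgroup.card_map_of_injective (MulAut.conj g).injective]
    rw [mem_normalizer_iff]
    intro w
    constructor
    · intro hw
      rw [← hmap]
      exact ⟨w, hw, rfl⟩
    · intro hw
      obtain ⟨v, hv, hvw⟩ : g * w * g⁻¹ ∈ X.map (MulAut.conj g).toMonoidHom := by rwa [hmap]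
      have : v = w := (MulAut.conj g).injective hvw
      exact this ▸ hv
  have hle : ∀ u ∈ U, u ∉ X → centralizer {u} ≤ U := by
    intro u hu huX
    have h1 : U ⊓ centralizer {u} = centralizer {u} := by
      refine eq_of_le_of_card_ge inf_le_right ?_
      rw [hCu rfl u hu huX, card_inf_centralizer hU hX hu huX]
    rw [← h1]; exact inf_le_left
  refine ⟨by rw [hT.card_group]; norm_num, hU, hX, by rw [hν, mul_assoc]; norm_num, hκ, hle, ?_,
    fun N hN h => hT.eq_top_of_normal h⟩
  intro u hu hu1 g hg
  by_cases huX : u ∈ X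
  · exact hTI1 u huX hu1 g hg
  have hgX : g * u * g⁻¹ ∉ X := by
    intro h
    have hne : g * u * g⁻¹ ≠ 1 := fun h => hu1 (conj_eq_one_iff.1 h)
    exact hfuse u hu huX _ h hne g⁻¹ (by group)
  obtain ⟨x, hx, hx97⟩ := exists_orderOf_mem_center hU
  have hx1 : x ≠ 1 := by rintro rfl; simp at hx97
  refine hTI1 x hx hx1 g (hle _ hg hgX (mem_centralizer_singleton_iff.2 ?_))
  have h1 := mem_centralizer_iff.1 (Subgroup.mem_inf.1 hx).2 u hu
  calc g * x * g⁻¹ * (g * u * g⁻¹) = g * (x * u) * g⁻¹ := by group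
    _ = _ := by rw [← h1]; group

end ExceptionalPair

theorem exists_unitaryLocal {G : Type*} [Group G] [Finite G]
    (hG : Nat.card G = 2 ^ 7 * 3 * 7 ^ 4 * 67 * 97 ^ 3 * 139) (h67 : gkDegree G 67 = 1)
    (h139 : gkDegree G 139 = 1) : ∃ U : Subgroup G, UnitaryLocal G U := by
  classical
  have := Fintype.ofFinite G
  have : Fact (Nat.Prime 97) := ⟨by norm_num⟩
  obtain ⟨T, hT⟩ := exists_isolatedHall hG h67 h139
  obtain ⟨S, a, b, hE⟩ := hT.exists_exceptionalPair
  obtain ⟨U, hU⟩ := Sylow.exists_subgroup_card_pow_prime (G := G) 97 (n := 3)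
    (by rw [hG]; norm_num)
  exact ⟨U, hE.unitaryLocal hT hU⟩

end

/-! ### Heisenberg pairs -/

section

open Subgroup Finset
open scoped commutatorElement Pointwise

theorem commute_involution_of_card {A : Type*} [Group A] (hA : Nat.card A = 98) {t : A}
    (ht : t * t = 1) (ht1 : t ≠ 1) (hc : ∀ a : A, a * t = t * a) (a b : A) : a * b = b * a := by
  have : Fact (Nat.Prime 7) := ⟨by norm_num⟩
  have : Finite A := Nat.finite_of_card_ne_zero (by rw [hA]; norm_num)
  obtain ⟨Q, hQ⟩ := Sylow.exists_subgroup_card_pow_prime (G := A) 7 (n := 2) (by rw [hA]; norm_num)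
  have hi : Q.index = 2 := by
    have := Q.card_mul_index
    rw [hQ, hA] at this
    omega
  have hcomm := (IsPGroup.isMulCommutative_of_card_eq_prime_sq hQ).is_comm.comm
  have htQ : t ∉ Q := by
    intro h
    have h1 := orderOf_dvd_natCard (⟨t, h⟩ : Q)
    rw [hQ, orderOf_mk, orderOf_eq_prime (by rw [pow_two, ht]) ht1] at h1
    norm_num at h1
  have hd : ∀ a : A, ∃ q ∈ Q, ∃ s : A, (∀ c, c * s = s * c) ∧ a = q * s := by
    intro a
    by_cases h : a ∈ Q
    · exact ⟨a, h, 1, by simp, by simp⟩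
    · refine ⟨a * t, ?_, t, hc, by rw [mul_assoc, ht, mul_one]⟩
      rw [mul_mem_iff_of_index_two hi]
      exact iff_of_false h htQ
  obtain ⟨q, hq, s, hs, rfl⟩ := hd a
  obtain ⟨r, hr, u, hu, rfl⟩ := hd b
  have h1 : q * r = r * q := congrArg Subtype.val (hcomm ⟨q, hq⟩ ⟨r, hr⟩)
  calc q * s * (r * u) = q * (s * r) * u := by group
    _ = q * r * (s * u) := by rw [← hs]; group
    _ = r * q * (u * s) := by rw [h1, hs]
    _ = r * (q * u) * s := by group
    _ = _ := by rw [hu]; group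

/-- A group `P` of order `97³` with center of order `97`, together with a group `A` of `98`
automorphisms acting trivially on the center and freely on the nontrivial cosets of it. -/
structure HeisenbergPair (P : Type*) [Group P] (A : Subgroup (MulAut P)) : Prop where
  card : Nat.card P = 97 ^ 3
  card_center : Nat.card (center P) = 97
  card_aut : Nat.card A = 98
  apply_center : ∀ α ∈ A, ∀ x ∈ center P, α x = x
  free : ∀ α ∈ A, ∀ u, u ∉ center P → u⁻¹ * α u ∈ center P → α = 1

section Center

variable {P : Type*} [Group P]

theorem apply_mem_center (β : MulAut P) {x : P} (hx : x ∈ center P) : β x ∈ center P := by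
  rw [mem_center_iff] at hx ⊢
  intro g
  have := congrArg β (hx (β⁻¹ g))
  simpa using this

theorem apply_mem_center_iff (β : MulAut P) {x : P} : β x ∈ center P ↔ x ∈ center P := by
  refine ⟨fun h => ?_, apply_mem_center β⟩
  simpa using apply_mem_center β⁻¹ h

theorem conj_mem_center {x : P} (hx : x ∈ center P) (g : P) : g * x * g⁻¹ ∈ center P := by
  rwa [mem_center_iff.1 hx g, mul_inv_cancel_right]

theorem mul_mem_center_comm {u v : P} (h : u * v ∈ center P) : v * u ∈ center P := by
  have := conj_mem_center h v
  rwa [show v * (u * v) * v⁻¹ = v * u by group] at this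

theorem mk_eq_mk_iff_mem_center {u v : P} :
    (QuotientGroup.mk u : P ⧸ center P) = QuotientGroup.mk v ↔ u⁻¹ * v ∈ center P :=
  QuotientGroup.eq

end Center

namespace HeisenbergPair

variable {P : Type*} [Group P] {A : Subgroup (MulAut P)} (h : HeisenbergPair P A)
include h

theorem finite : Finite P := Nat.finite_of_card_ne_zero (by rw [h.card]; norm_num)

theorem finite_aut : Finite A := Nat.finite_of_card_ne_zero (by rw [h.card_aut]; norm_num)

theorem mk_comm (u v : P ⧸ center P) : u * v = v * u := by
  have : Fact (Nat.Prime 97) := ⟨by norm_num⟩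
  induction u using QuotientGroup.induction_on with | H u => ?_
  induction v using QuotientGroup.induction_on with | H v => ?_
  rw [← QuotientGroup.mk_mul, ← QuotientGroup.mk_mul, mk_eq_mk_iff_mem_center]
  have := commutator_mem_center_of_card h.card h.card_center v⁻¹ u⁻¹
  rwa [commutatorElement_def, inv_inv, inv_inv,
    show v⁻¹ * u⁻¹ * v * u = (u * v)⁻¹ * (v * u) by group] at this

/-- The commutative group structure on the central quotient. -/
@[reducible] def commGroup : CommGroup (P ⧸ center P) :=
  { (inferInstance : Group (P ⧸ center P)) with mul_comm := h.mk_comm }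

theorem card_quotient : Nat.card (P ⧸ center P) = 97 ^ 2 := by
  have := Subgroup.card_mul_index (center P)
  rw [h.card_center, h.card, Subgroup.index] at this
  exact Nat.eq_of_mul_eq_mul_left (by norm_num) (this.trans (by norm_num))

theorem exists_notMem : ∃ u, u ∉ center P := by
  by_contra! hc
  have h1 : center P = ⊤ := (Subgroup.eq_top_iff' _).2 hc
  have h2 := h.card_center
  rw [h1, card_top, h.card] at h2
  norm_num at h2

theorem exists_involution : ∃ t ∈ A, t * t = 1 ∧ t ≠ 1 := by
  have := h.finite_aut
  have : Fact (Nat.Prime 2) := ⟨Nat.prime_two⟩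
  obtain ⟨t, ht⟩ := exists_prime_orderOf_dvd_card' (G := A) 2 (by rw [h.card_aut]; norm_num)
  refine ⟨t, t.2, ?_, ?_⟩
  · have := pow_orderOf_eq_one t
    rw [ht, pow_two] at this
    exact congrArg Subtype.val this
  · rintro h1
    have : t = 1 := Subtype.ext h1
    rw [this] at ht
    simp at ht

omit h in
theorem mul_apply_mem_center_of {β : MulAut P} (hβ : β * β = 1)
    (hcomm : ∀ u v : P, (u * v)⁻¹ * (v * u) ∈ center P)
    (hfree : ∀ u, u ∉ center P → u⁻¹ * β u ∉ center P) (u : P) : u * β u ∈ center P := by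
  by_contra hu
  refine hfree _ hu ?_
  have : β (β u) = u := by rw [← MulAut.mul_apply, hβ]; rfl
  rw [map_mul, this]
  exact hcomm _ _

theorem comm_mem_center (u v : P) : (u * v)⁻¹ * (v * u) ∈ center P := by
  rw [← mk_eq_mk_iff_mem_center, QuotientGroup.mk_mul, QuotientGroup.mk_mul, h.mk_comm]

theorem mul_apply_mem_center {t : MulAut P} (htA : t ∈ A) (ht : t * t = 1) (ht1 : t ≠ 1) (u : P) :
    u * t u ∈ center P :=
  mul_apply_mem_center_of ht h.comm_mem_center (fun u hu hu' => ht1 (h.free t htA u hu hu')) u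

theorem commute_involution {t : MulAut P} (htA : t ∈ A) (ht : t * t = 1) (ht1 : t ≠ 1)
    {α : MulAut P} (hα : α ∈ A) : α * t = t * α := by
  obtain ⟨u, hu⟩ := h.exists_notMem
  have ht' : t⁻¹ = t := inv_eq_of_mul_eq_one_left ht
  have hinv : ∀ v : P, (QuotientGroup.mk (t v) : P ⧸ center P) = (QuotientGroup.mk v)⁻¹ := by
    intro v
    rw [eq_inv_iff_mul_eq_one, ← QuotientGroup.mk_mul, QuotientGroup.eq_one_iff]
    exact mul_mem_center_comm (h.mul_apply_mem_center htA ht ht1 v)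
  have h1 : t * (α⁻¹ * t * α) = 1 := by
    refine h.free _ (mul_mem htA (mul_mem (mul_mem (inv_mem hα) htA) hα)) u hu ?_
    rw [← mk_eq_mk_iff_mem_center, MulAut.mul_apply, hinv, eq_inv_iff_mul_eq_one,
      ← QuotientGroup.mk_mul, QuotientGroup.eq_one_iff, ← apply_mem_center_iff α, map_mul]
    simpa using h.mul_apply_mem_center htA ht ht1 (α u)
  have h2 : α⁻¹ * t * α = t := (eq_inv_of_mul_eq_one_right h1).trans ht'
  calc α * t = α * (α⁻¹ * t * α) := by rw [h2]
    _ = t * α := by group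

theorem aut_comm {α β : MulAut P} (hα : α ∈ A) (hβ : β ∈ A) : α * β = β * α := by
  obtain ⟨t, htA, ht, ht1⟩ := h.exists_involution
  exact congrArg Subtype.val (commute_involution_of_card h.card_aut (t := ⟨t, htA⟩)
    (Subtype.ext ht) (fun hh => ht1 (congrArg Subtype.val hh))
    (fun a => Subtype.ext (h.commute_involution htA ht ht1 a.2)) ⟨α, hα⟩ ⟨β, hβ⟩)

theorem eq_of_mk_eq {α β : MulAut P} (hα : α ∈ A) (hβ : β ∈ A) {v : P} (hv : v ∉ center P)
    (hαβ : (α v)⁻¹ * β v ∈ center P) : α = β := by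
  have h1 : α⁻¹ * β = 1 := by
    refine h.free _ (mul_mem (inv_mem hα) hβ) v hv ?_
    rw [← apply_mem_center_iff α, map_mul, map_inv]
    simpa using hαβ
  exact inv_mul_eq_one.1 h1

/-- The sum of the points of an orbit of `A` on the central quotient vanishes. -/
theorem center_argument {u v u' v' : P} (hv : v ∉ center P)
    (hα : ∀ α ∈ A, ∃ α' ∈ A, (u * α v)⁻¹ * (u' * α' v') ∈ center P) : u⁻¹ * u' ∈ center P := by
  classical
  let := h.commGroup
  have := h.finite_aut
  have := Fintype.ofFinite A
  have := h.finite
  obtain ⟨t, htA, ht, ht1⟩ := h.exists_involution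
  have hpow : ∀ {z : P ⧸ center P} {n : ℕ}, n.Coprime (97 ^ 2) → z ^ n = 1 → z = 1 := by
    intro z n hn hz
    have h1 := orderOf_dvd_natCard z
    rw [h.card_quotient] at h1
    exact orderOf_eq_one_iff.1 (Nat.eq_one_of_dvd_coprimes hn (orderOf_dvd_of_pow_eq_one hz) h1)
  have hN : ∀ w : P, ∏ α : A, (QuotientGroup.mk (α.1 w) : P ⧸ center P) = 1 := by
    intro w
    refine hpow (n := 2) (by norm_num) ?_
    rw [pow_two]
    nth_rewrite 1 [← Equiv.prod_comp (Equiv.mulLeft (⟨t, htA⟩ : A))]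
    rw [← Finset.prod_mul_distrib]
    refine Finset.prod_eq_one fun α _ => ?_
    rw [← QuotientGroup.mk_mul, QuotientGroup.eq_one_iff]
    exact mul_mem_center_comm (h.mul_apply_mem_center htA ht ht1 _)
  choose! σ hσA hσ using hα
  let τ : A → A := fun α => ⟨σ α, hσA α α.2⟩
  have hinj : Function.Injective τ := by
    intro α β hαβ
    have h1 : σ α = σ β := congrArg Subtype.val hαβ
    have h2 := hσ α α.2
    have h3 := hσ β β.2
    rw [← mk_eq_mk_iff_mem_center] at h2 h3
    rw [h1, ← h3, QuotientGroup.mk_mul, QuotientGroup.mk_mul, mul_right_inj,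
      mk_eq_mk_iff_mem_center] at h2
    exact Subtype.ext (h.eq_of_mk_eq α.2 β.2 hv h2)
  have hbij : Function.Bijective τ := Finite.injective_iff_bijective.1 hinj
  have h1 : ∏ α : A, (QuotientGroup.mk (u * α.1 v) : P ⧸ center P) =
      ∏ α : A, (QuotientGroup.mk (u' * α.1 v') : P ⧸ center P) :=
    Fintype.prod_bijective τ hbij _ _ fun α => mk_eq_mk_iff_mem_center.2 (hσ α α.2)
  simp only [QuotientGroup.mk_mul] at h1
  rw [Finset.prod_mul_distrib, Finset.prod_mul_distrib, hN, hN, mul_one, mul_one,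
    Finset.prod_const, Finset.prod_const, Finset.card_univ, ← Nat.card_eq_fintype_card,
    h.card_aut] at h1
  rw [← QuotientGroup.eq_one_iff]
  refine hpow (n := 98) (by norm_num) ?_
  rw [QuotientGroup.mk_mul, QuotientGroup.mk_inv, mul_pow, inv_pow, h1, inv_mul_cancel]

end HeisenbergPair

end

/-! ### Groups acting on the unital -/

section

open Subgroup Finset
open scoped Pointwise

section OptionPerm

variable {P : Type*} [Group P]

/-- Left translation by `p`, fixing the point at infinity. -/
def shift (p : P) : Equiv.Perm (Option P) := Equiv.optionCongr (Equiv.mulLeft p)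

/-- The extension of an automorphism to a permutation fixing the point at infinity. -/
def extend (β : MulAut P) : Equiv.Perm (Option P) := Equiv.optionCongr β.toEquiv

@[simp] theorem shift_none (p : P) : shift p none = none := rfl
@[simp] theorem shift_some (p v : P) : shift p (some v) = some (p * v) := rfl
@[simp] theorem extend_none (β : MulAut P) : extend β none = none := rfl
@[simp] theorem extend_some (β : MulAut P) (v : P) : extend β (some v) = some (β v) := rfl

theorem shift_inv (p : P) : (shift p)⁻¹ = shift p⁻¹ := by
  rw [inv_eq_iff_mul_eq_one]
  ext o : 1
  cases o <;> simp

theorem extend_mul (α β : MulAut P) : extend (α * β) = extend α * extend β := by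
  ext o : 1
  cases o <;> simp

@[simp] theorem extend_one : extend (1 : MulAut P) = 1 := by
  ext o : 1
  cases o <;> simp

theorem extend_injective : Function.Injective (extend : MulAut P → Equiv.Perm (Option P)) := by
  intro α β h
  ext v
  have := congrArg (· (some v)) h
  simpa using this

theorem extend_inv (α : MulAut P) : extend α⁻¹ = (extend α)⁻¹ := by
  rw [eq_inv_iff_mul_eq_one, ← extend_mul, inv_mul_cancel, extend_one]

/-- The block through infinity and `u`. -/
def lineInf (u : P) : Set (Option P) := {o | ∀ v, o = some v → u⁻¹ * v ∈ center P}

/-- The shift by `u` of the orbit of `v`. -/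
def line (A : Subgroup (MulAut P)) (u v : P) : Set (Option P) := {o | ∃ α ∈ A, o = some (u * α v)}

/-- The blocks of the unital. -/
def blocks (A : Subgroup (MulAut P)) : Set (Set (Option P)) :=
  {B | (∃ u, B = lineInf u) ∨ ∃ u v, v ∉ center P ∧ B = line A u v}

/-- The permutations preserving the blocks and fixing all blocks through a point. -/
def centralPerms (A : Subgroup (MulAut P)) : Set (Equiv.Perm (Option P)) :=
  {σ | (∀ B ∈ blocks A, σ • B ∈ blocks A) ∧ ∃ p, ∀ B ∈ blocks A, p ∈ B → σ • B = B}

@[simp] theorem none_mem_lineInf (u : P) : none ∈ lineInf u := by simp [lineInf]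
@[simp] theorem some_mem_lineInf {u v : P} : some v ∈ lineInf u ↔ u⁻¹ * v ∈ center P := by
  simp [lineInf]

theorem mem_smul_set_perm {σ : Equiv.Perm (Option P)} {B : Set (Option P)} {p : Option P} :
    p ∈ σ • B ↔ σ⁻¹ p ∈ B := Set.mem_smul_set_iff_inv_smul_mem

theorem apply_mem_smul_set {σ : Equiv.Perm (Option P)} {B : Set (Option P)} {p : Option P} :
    σ p ∈ σ • B ↔ p ∈ B := Set.smul_mem_smul_set_iff (a := σ)

theorem shift_smul_lineInf (p u : P) : shift p • lineInf u = lineInf (p * u) := by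
  ext o
  rw [mem_smul_set_perm, shift_inv]
  cases o
  · simp
  · simp [mul_assoc]

theorem shift_smul_line (A : Subgroup (MulAut P)) (p u v : P) :
    shift p • line A u v = line A (p * u) v := by
  ext o
  rw [mem_smul_set_perm, shift_inv]
  cases o
  · simp [line]
  · simp [line, inv_mul_eq_iff_eq_mul, mul_assoc]

theorem shift_smul_lineInf_of_mem {x : P} (hx : x ∈ center P) (u : P) :
    shift x • lineInf u = lineInf u := by
  rw [shift_smul_lineInf]
  ext o
  cases o
  · simp
  · rename_i v
    simp only [some_mem_lineInf, mul_inv_rev]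
    rw [← mem_center_iff.1 (inv_mem hx) u⁻¹ |>.symm, mul_assoc, mul_mem_cancel_left (inv_mem hx)]

theorem shift_smul_mem_blocks {A : Subgroup (MulAut P)} (p : P) {B : Set (Option P)}
    (hB : B ∈ blocks A) : shift p • B ∈ blocks A := by
  rcases hB with ⟨u, rfl⟩ | ⟨u, v, hv, rfl⟩
  · exact .inl ⟨_, shift_smul_lineInf _ _⟩
  · exact .inr ⟨_, v, hv, shift_smul_line _ _ _ _⟩

end OptionPerm

/-- A group of permutations of `P ∪ {∞}` with the properties of the action of `U₃(97)` on the
points of the Hermitian unital. -/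
structure UnitalGroup {P : Type*} [Group P] (A : Subgroup (MulAut P))
    (Γ : Subgroup (Equiv.Perm (Option P))) : Prop extends HeisenbergPair P A where
  shift_mem : ∀ p, shift p ∈ Γ
  mem_iff : ∀ β, β ∈ A ↔ extend β ∈ Γ ∧ ∀ x ∈ center P, β x = x
  exists_ne : ∃ γ ∈ Γ, γ none ≠ none
  exists_extend : ∀ γ ∈ Γ, γ none = none → γ (some 1) = some 1 → ∃ β, γ = extend β
  semiregular : ∀ β, extend β ∈ Γ → ∀ u, u ∉ center P → β u = u → β = 1
  transitive : ∀ u w, u ∉ center P → w ∉ center P →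
    ∃ β, extend β ∈ Γ ∧ ∃ x ∈ center P, w = x * β u
  le_closure : Γ ≤ closure {γ | ∃ g ∈ Γ, ∃ x ∈ center P, γ = g * shift x * g⁻¹}

namespace UnitalGroup

variable {P : Type*} [Group P] {A : Subgroup (MulAut P)} {Γ : Subgroup (Equiv.Perm (Option P))}
  (h : UnitalGroup A Γ)
include h

theorem extend_mem {α : MulAut P} (hα : α ∈ A) : extend α ∈ Γ := ((h.mem_iff α).1 hα).1

theorem exists_apply_none (p : Option P) : ∃ g ∈ Γ, g none = p := by
  cases p with
  | none => exact ⟨1, one_mem _, rfl⟩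
  | some v =>
    obtain ⟨γ, hγ, hne⟩ := h.exists_ne
    obtain ⟨w, hw⟩ := Option.ne_none_iff_exists'.1 hne
    exact ⟨shift (v * w⁻¹) * γ, mul_mem (h.shift_mem _) hγ, by simp [hw]⟩

theorem exists_apply_eq {p q : Option P} (hpq : p ≠ q) :
    ∃ g ∈ Γ, g none = p ∧ g (some 1) = q := by
  obtain ⟨g, hg, hgp⟩ := h.exists_apply_none p
  have : g⁻¹ q ≠ none := by
    intro hh
    apply hpq
    rw [← hgp, ← hh]
    simp
  obtain ⟨v, hv⟩ := Option.ne_none_iff_exists'.1 this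
  refine ⟨g * shift v, mul_mem hg (h.shift_mem v), by simpa using hgp, ?_⟩
  simp [← hv]

omit h in
theorem _root_.coset_involution {P : Type*} [Group P] {s : MulAut P} (hs : s * s = 1) {u x : P}
    (hsu : s u = u * x) (hx : x ^ 97 = 1) : s (u * x ^ 49) = u * x ^ 49 := by
  have h1 : s (s u) = u := by rw [← MulAut.mul_apply, hs]; rfl
  have h2 : x * s x = 1 := by
    rw [hsu, map_mul, hsu, mul_assoc] at h1
    exact mul_eq_left.1 h1
  have h3 : s x = x⁻¹ := eq_inv_of_mul_eq_one_right h2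
  rw [map_mul, map_pow, hsu, h3, mul_assoc]
  congr 1
  rw [inv_pow, mul_inv_eq_iff_eq_mul, ← pow_add, show 49 + 49 = 97 + 1 by norm_num, pow_succ, hx,
    one_mul]

omit h in
theorem _root_.pow_of_mem_center {P : Type*} [Group P] {A : Subgroup (MulAut P)}
    (h : HeisenbergPair P A) {x : P} (hx : x ∈ center P) : x ^ 97 = 1 := by
  have := Subgroup.orderOf_dvd_natCard _ hx
  rwa [h.card_center, orderOf_dvd_iff_pow_eq_one] at this

omit h in
theorem _root_.exists_comm_eq {P : Type*} [Group P] {A : Subgroup (MulAut P)}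
    (h : HeisenbergPair P A) {x : P} (hx : x ∈ center P) : ∃ u v : P, x = u⁻¹ * (v * u * v⁻¹) := by
  have : Fact (Nat.Prime 97) := ⟨by norm_num⟩
  obtain ⟨u, hu⟩ := h.exists_notMem
  obtain ⟨g, hg⟩ := exists_conj_eq_mul_of_card h.card h.card_center hu hx
  exact ⟨u, g, by rw [hg, inv_mul_cancel_left]⟩

omit h in
theorem _root_.apply_center_of_mk {P : Type*} [Group P] {A : Subgroup (MulAut P)}
    (h : HeisenbergPair P A) {r : MulAut P} (hr : ∀ u, u⁻¹ * r u ∈ center P) {x : P}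
    (hx : x ∈ center P) : r x = x := by
  obtain ⟨u, v, rfl⟩ := exists_comm_eq h hx
  have hru : r u = u * (u⁻¹ * r u) := by group
  have hrv : r v = v * (v⁻¹ * r v) := by group
  set a := u⁻¹ * r u with ha
  set b := v⁻¹ * r v with hb
  have ha' := mem_center_iff.1 (hr u)
  have hb' := mem_center_iff.1 (hr v)
  rw [← ha] at ha'
  rw [← hb] at hb'
  rw [map_mul, map_mul, map_mul, map_inv, map_inv, hru, hrv]
  calc (u * a)⁻¹ * (v * b * (u * a) * (v * b)⁻¹)
      = a⁻¹ * u⁻¹ * v * (b * (u * a)) * b⁻¹ * v⁻¹ := by group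
    _ = a⁻¹ * (u⁻¹ * v * u * a) * v⁻¹ := by rw [← hb' (u * a)]; group
    _ = _ := by rw [ha']; group

theorem eq_of_involution {t s : MulAut P} (htA : t ∈ A) (ht : t * t = 1) (ht1 : t ≠ 1)
    (hsΓ : extend s ∈ Γ) (hs : s * s = 1) (hs1 : s ≠ 1) : s = t := by
  have hfree : ∀ u, u ∉ center P → u⁻¹ * s u ∉ center P := by
    intro u hu hc
    refine hs1 (h.semiregular s hsΓ (u * (u⁻¹ * s u) ^ 49) ?_ ?_)
    · rwa [mul_mem_cancel_right (pow_mem hc _)]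
    · exact coset_involution hs (by group)
        (pow_of_mem_center h.toHeisenbergPair hc)
  have hsinv := HeisenbergPair.mul_apply_mem_center_of hs h.comm_mem_center hfree
  have htinv := h.mul_apply_mem_center htA ht ht1
  have hr : ∀ u, u⁻¹ * (s * t) u ∈ center P := by
    intro u
    have h1 := hsinv (t u)
    have h2 := mul_mem_center_comm (htinv u)
    have h3 : u⁻¹ * (s * t) u = u⁻¹ * (t u)⁻¹ * (t u * s (t u)) := by
      rw [MulAut.mul_apply]; group
    rw [h3]
    exact mul_mem (by rw [← mul_inv_rev]; exact inv_mem h2) h1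
  have hA : s * t ∈ A := by
    rw [h.mem_iff, extend_mul]
    exact ⟨mul_mem hsΓ (h.extend_mem htA), fun x hx => apply_center_of_mk h.toHeisenbergPair hr hx⟩
  obtain ⟨u, hu⟩ := h.exists_notMem
  have h1 := h.free _ hA u hu (hr u)
  rw [eq_inv_of_mul_eq_one_left h1]
  exact inv_eq_of_mul_eq_one_left ht

omit h in
theorem mem_lineInf_one {v : P} : some v ∈ lineInf (1 : P) ↔ v ∈ center P := by simp

theorem extend_apply_eq_iff {α : MulAut P} (hα : α ∈ A) (hα1 : α ≠ 1) {p : Option P} :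
    extend α p = p ↔ p ∈ lineInf (1 : P) := by
  cases p with
  | none => simp
  | some v =>
    rw [mem_lineInf_one, extend_some, Option.some_inj]
    refine ⟨fun hv => ?_, h.apply_center α hα v⟩
    by_contra hc
    exact hα1 (h.free α hα v hc (by rw [hv, inv_mul_cancel]; exact one_mem _))

/-- The images of the block through `∞` and `1`. -/
def IsBlock (Γ : Subgroup (Equiv.Perm (Option P))) (B : Set (Option P)) : Prop :=
  ∃ g ∈ Γ, B = g • lineInf 1

omit h in
theorem IsBlock.smul {B : Set (Option P)} (hB : IsBlock Γ B) {g : Equiv.Perm (Option P)}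
    (hg : g ∈ Γ) : IsBlock Γ (g • B) := by
  obtain ⟨k, hk, rfl⟩ := hB
  exact ⟨g * k, mul_mem hg hk, smul_smul _ _ _⟩

theorem IsBlock.eq_lineInf_one {B : Set (Option P)} (hB : IsBlock Γ B) (h1 : none ∈ B)
    (h2 : some 1 ∈ B) : B = lineInf 1 := by
  obtain ⟨t, htA, ht, ht1⟩ := h.exists_involution
  obtain ⟨g, hg, rfl⟩ := hB
  have hfix : ∀ p, (g * extend t * g⁻¹) p = p ↔ p ∈ g • lineInf 1 := by
    intro p
    rw [mem_smul_set_perm, ← h.extend_apply_eq_iff htA ht1, Equiv.Perm.mul_apply,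
      Equiv.Perm.mul_apply]
    exact (Equiv.eq_symm_apply g).symm
  have hmem : g * extend t * g⁻¹ ∈ Γ := mul_mem (mul_mem hg (h.extend_mem htA)) (inv_mem hg)
  obtain ⟨s, hs⟩ := h.exists_extend _ hmem ((hfix _).2 h1) ((hfix _).2 h2)
  have hst : s = t := by
    refine h.eq_of_involution htA ht ht1 (hs ▸ hmem) (extend_injective ?_) ?_
    · rw [extend_mul, extend_one, ← hs]
      calc g * extend t * g⁻¹ * (g * extend t * g⁻¹) = g * (extend t * extend t) * g⁻¹ := by group
        _ = 1 := by rw [← extend_mul, ht]; simp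
    · rintro rfl
      rw [extend_one, conj_eq_one_iff, ← extend_one] at hs
      exact ht1 (extend_injective hs)
  ext p
  rw [← hfix, hs, hst, h.extend_apply_eq_iff htA ht1]

theorem IsBlock.eq {B B' : Set (Option P)} (hB : IsBlock Γ B) (hB' : IsBlock Γ B')
    {p q : Option P} (hpq : p ≠ q) (hp : p ∈ B) (hq : q ∈ B) (hp' : p ∈ B') (hq' : q ∈ B') :
    B = B' := by
  obtain ⟨g, hg, rfl, rfl⟩ := h.exists_apply_eq hpq
  have key : ∀ {C}, IsBlock Γ C → g none ∈ C → g (some 1) ∈ C → g⁻¹ • C = lineInf 1 := by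
    intro C hC h1 h2
    refine IsBlock.eq_lineInf_one h (hC.smul (inv_mem hg)) ?_ ?_ <;>
    · rw [mem_smul_set_perm, inv_inv]; assumption
  have := (key hB hp hq).trans (key hB' hp' hq').symm
  exact smul_left_cancel _ this

theorem exists_isBlock {p q : Option P} (hpq : p ≠ q) : ∃ B, IsBlock Γ B ∧ p ∈ B ∧ q ∈ B := by
  obtain ⟨g, hg, rfl, rfl⟩ := h.exists_apply_eq hpq
  refine ⟨_, ⟨g, hg, rfl⟩, ?_, ?_⟩ <;> rw [apply_mem_smul_set]
  · simp
  · simp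

theorem isBlock_lineInf (u : P) : IsBlock Γ (lineInf u) :=
  ⟨shift u, h.shift_mem u, by rw [shift_smul_lineInf, mul_one]⟩

theorem ncard_lineInf_one : (lineInf (1 : P)).ncard = 98 := by
  have := h.finite
  have h1 : lineInf (1 : P) = insert none (some '' (center P : Set P)) := by
    ext o
    cases o <;> simp
  rw [h1, Set.ncard_insert_of_notMem (by simp) (Set.toFinite _),
    Set.ncard_image_of_injective _ (Option.some_injective _)]
  change Nat.card (center P) + 1 = 98
  rw [h.card_center]

theorem IsBlock.ncard {B : Set (Option P)} (hB : IsBlock Γ B) : B.ncard = 98 := by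
  obtain ⟨g, -, rfl⟩ := hB
  rw [Set.ncard_smul_set, h.ncard_lineInf_one]

end UnitalGroup

end

/-! ### Stabilizers of points of the unital -/

section

open Subgroup Finset
open scoped Pointwise

section OptionPerm

variable {P : Type*} [Group P]

/-- `extend` as a homomorphism. -/
def extendHom (P : Type*) [Group P] : MulAut P →* Equiv.Perm (Option P) where
  toFun := extend
  map_one' := extend_one
  map_mul' := extend_mul

theorem extend_mul_self {t : MulAut P} (ht : t * t = 1) : extend t * extend t = 1 := by
  rw [← extend_mul, ht, extend_one]

theorem mem_of_smul_eq {σ : Equiv.Perm (Option P)} {B : Set (Option P)} (h : σ • B = B)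
    {p : Option P} (hp : p ∈ B) : σ p ∈ B := by
  rw [← h, apply_mem_smul_set]
  exact hp

end OptionPerm

namespace UnitalGroup

variable {P : Type*} [Group P] {A : Subgroup (MulAut P)} {Γ : Subgroup (Equiv.Perm (Option P))}
  (h : UnitalGroup A Γ)
include h

theorem disjoint_of_smul_eq {t : MulAut P} (htA : t ∈ A) (ht : t * t = 1) (ht1 : t ≠ 1)
    {B : Set (Option P)} (hB : IsBlock Γ B) (htB : extend t • B = B) (hne : B ≠ lineInf 1)
    {p : Option P} (hp : p ∈ B) : p ∉ lineInf (1 : P) := by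
  classical
  intro hp1
  have := h.finite
  have := Fintype.ofFinite B
  have : Fact (Nat.Prime 2) := ⟨Nat.prime_two⟩
  apply hne
  have hf : Function.Involutive fun q : B => (⟨extend t q, mem_of_smul_eq htB q.2⟩ : B) :=
    fun q => Subtype.ext (by
      change (extend t * extend t) q = q
      rw [extend_mul_self ht]; rfl)
  obtain ⟨q, hq, hqp⟩ := Equiv.Perm.exists_fixed_point_of_prime' (p := 2) (n := 1)
    (σ := hf.toPerm) (a := ⟨p, hp⟩)
    (by
      rw [← Nat.card_eq_fintype_card]
      change 2 ∣ B.ncard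
      rw [hB.ncard h]; norm_num)
    (by
      rw [pow_one, pow_two]
      ext q : 1
      exact hf q)
    (Subtype.ext ((h.extend_apply_eq_iff htA ht1).2 hp1))
  have hq1 : q.1 ∈ lineInf (1 : P) :=
    (h.extend_apply_eq_iff htA ht1).1 (congrArg Subtype.val hq)
  exact hB.eq h (h.isBlock_lineInf 1) (fun hh => hqp (Subtype.ext hh)) q.2 hp hq1 hp1

theorem exists_smul_eq {t : MulAut P} (htA : t ∈ A) (ht : t * t = 1) (ht1 : t ≠ 1) {v : P}
    (hv : v ∉ center P) : ∃ B, IsBlock Γ B ∧ extend t • B = B ∧ some v ∈ B := by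
  have hne : (some v) ≠ some (t v) := fun hh => hv <| by
    rw [← mem_lineInf_one, ← h.extend_apply_eq_iff htA ht1]
    exact hh.symm
  obtain ⟨B, hB, h1, h2⟩ := h.exists_isBlock hne
  refine ⟨B, hB, ?_, h1⟩
  have h3 : extend t • some v = some (t v) := rfl
  have h4 : extend t • some (t v) = some v := by
    rw [← h3, smul_smul, extend_mul_self ht, one_smul]
  refine (hB.smul (h.extend_mem htA)).eq h hB hne ?_ ?_ h1 h2
  · rw [← h4]; exact Set.smul_mem_smul_set h2
  · rw [← h3]; exact Set.smul_mem_smul_set h1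

/-- The blocks different from `lineInf 1` that are invariant under an involution. -/
abbrev InvBlock (Γ : Subgroup (Equiv.Perm (Option P))) (t : MulAut P) : Type _ :=
  {B : Set (Option P) // IsBlock Γ B ∧ extend t • B = B ∧ B ≠ lineInf 1}

theorem card_invBlock {t : MulAut P} (htA : t ∈ A) (ht : t * t = 1) (ht1 : t ≠ 1) :
    Nat.card (InvBlock Γ t) = 9312 := by
  classical
  have := h.finite
  have : Finite (InvBlock Γ t) := inferInstance
  have hex : ∀ v : {v // v ∉ center P}, ∃ B : InvBlock Γ t, some v.1 ∈ B.1 := by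
    intro v
    obtain ⟨B, hB, h1, h2⟩ := h.exists_smul_eq htA ht ht1 v.2
    exact ⟨⟨B, hB, h1, fun hh => v.2 (by rwa [← mem_lineInf_one, ← hh])⟩, h2⟩
  choose f hf using hex
  have huniq : ∀ (v : {v // v ∉ center P}) (B : InvBlock Γ t), some v.1 ∈ B.1 → f v = B := by
    intro v B hvB
    have hne : (some v.1) ≠ some (t v) := fun hh => v.2 <| by
      rw [← mem_lineInf_one, ← h.extend_apply_eq_iff htA ht1]
      exact hh.symm
    exact Subtype.ext ((f v).2.1.eq h B.2.1 hne (hf v) (mem_of_smul_eq (f v).2.2.1 (hf v)) hvB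
      (mem_of_smul_eq B.2.2.1 hvB))
  have hfib : ∀ B : InvBlock Γ t, Nat.card {v // f v = B} = 98 := by
    intro B
    rw [← B.2.1.ncard h]
    refine Nat.card_congr (Equiv.ofBijective (fun v =>
      ⟨some v.1.1, (congrArg (fun B => some v.1.1 ∈ B.1) v.2).mp (hf v.1)⟩) ⟨?_, ?_⟩)
    · intro v w hvw
      exact Subtype.ext (Subtype.ext (Option.some_injective _ (congrArg Subtype.val hvw)))
    · rintro ⟨p, hp⟩
      have hp1 := h.disjoint_of_smul_eq htA ht ht1 B.2.1 B.2.2.1 B.2.2.2 hp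
      cases p with
      | none => exact absurd (none_mem_lineInf 1) hp1
      | some v =>
        rw [mem_lineInf_one] at hp1
        exact ⟨⟨⟨v, hp1⟩, huniq ⟨v, hp1⟩ B hp⟩, rfl⟩
  have h1 := Nat.card_congr (Equiv.sigmaFiberEquiv f)
  have := Fintype.ofFinite (InvBlock Γ t)
  rw [Nat.card_sigma, Finset.sum_congr rfl fun B _ => hfib B, Finset.sum_const, Finset.card_univ,
    ← Nat.card_eq_fintype_card, smul_eq_mul] at h1
  have h2 : Nat.card {v // v ∉ center P} + Nat.card {v // v ∈ center P} = Nat.card P := by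
    have := Fintype.ofFinite P
    simp only [Nat.card_eq_fintype_card]
    rw [add_comm, ← Fintype.card_sum]
    exact Fintype.card_congr (Equiv.sumCompl _)
  have h3 : Nat.card {v // v ∈ center P} = 97 := h.card_center
  rw [h3, h.card] at h2
  omega

theorem exists_isBlock_line : ∃ v, v ∉ center P ∧ IsBlock Γ (line A 1 v) := by
  classical
  have := h.finite
  have := h.finite_aut
  obtain ⟨t, htA, ht, ht1⟩ := h.exists_involution
  have : Finite (InvBlock Γ t) := inferInstance
  have : Fact (Nat.Prime 7) := ⟨by norm_num⟩
  obtain ⟨Q, hQ⟩ := Sylow.exists_subgroup_card_pow_prime (G := A) 7 (n := 2)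
    (by rw [h.card_aut]; norm_num)
  let act : MulAction Q (InvBlock Γ t) :=
    { smul := fun α B => ⟨extend α.1.1 • B.1, B.2.1.smul (h.extend_mem α.1.2), by
        rw [smul_smul, ← extend_mul, ← h.aut_comm α.1.2 htA, extend_mul, ← smul_smul, B.2.2.1],
        fun hh => B.2.2.2 (by
          have h1 : extend α.1.1 • lineInf (1 : P) = lineInf 1 := by
            ext p
            rw [mem_smul_set_perm, ← extend_inv]
            cases p with
            | none => simp
            | some v =>
              rw [extend_some, mem_lineInf_one, mem_lineInf_one, apply_mem_center_iff]
          exact smul_left_cancel _ (hh.trans h1.symm))⟩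
      one_smul := fun B => Subtype.ext (by
        change extend (1 : MulAut P) • B.1 = B.1
        rw [extend_one, one_smul])
      mul_smul := fun α β B => Subtype.ext (by
        change extend (α.1.1 * β.1.1) • B.1 = extend α.1.1 • extend β.1.1 • B.1
        rw [extend_mul, smul_smul]) }
  have h1 := (IsPGroup.of_card hQ).card_modEq_card_fixedPoints (InvBlock Γ t)
  rw [h.card_invBlock htA ht ht1] at h1
  have h2 : Nat.card (MulAction.fixedPoints Q (InvBlock Γ t)) ≠ 0 := by
    intro h0
    rw [h0] at h1
    exact absurd h1 (by decide)
  obtain ⟨⟨B, hB⟩⟩ : Nonempty (MulAction.fixedPoints Q (InvBlock Γ t)) := by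
    by_contra hne
    rw [not_nonempty_iff] at hne
    exact h2 Nat.card_of_isEmpty
  let S := ((MulAction.stabilizer (Equiv.Perm (Option P)) B.1).comap (extendHom P)).subgroupOf A
  have hQS : Q ≤ S := by
    intro α hα
    rw [mem_subgroupOf]
    exact congrArg Subtype.val (hB ⟨α, hα⟩)
  have htS : (⟨t, htA⟩ : A) ∈ S := by
    rw [mem_subgroupOf]
    exact B.2.2.1
  have hS : S = ⊤ := by
    have d1 := Subgroup.card_dvd_of_le hQS
    have d2 := Subgroup.orderOf_dvd_natCard S htS
    rw [orderOf_mk, orderOf_eq_prime (by rw [pow_two, ht]) ht1] at d2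
    rw [hQ] at d1
    refine Subgroup.eq_top_of_le_card _ ?_
    rw [h.card_aut]
    exact Nat.le_of_dvd Nat.card_pos
      (Nat.Coprime.mul_dvd_of_dvd_of_dvd (m := 2) (n := 49) (by norm_num) d2 d1)
  have hfix : ∀ α ∈ A, extend α • B.1 = B.1 := by
    intro α hα
    have : (⟨α, hα⟩ : A) ∈ S := hS ▸ mem_top _
    exact this
  obtain ⟨p, hp⟩ : B.1.Nonempty := by
    rw [← Set.ncard_pos, B.2.1.ncard h]; norm_num
  have hp1 := h.disjoint_of_smul_eq htA ht ht1 B.2.1 B.2.2.1 B.2.2.2 hp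
  cases p with
  | none => exact absurd (none_mem_lineInf 1) hp1
  | some v =>
    rw [mem_lineInf_one] at hp1
    refine ⟨v, hp1, ?_⟩
    have hsub : line A 1 v ⊆ B.1 := by
      rintro _ ⟨α, hα, rfl⟩
      rw [one_mul]
      exact mem_of_smul_eq (hfix α hα) hp
    have hc : (line A 1 v).ncard = 98 := by
      rw [← h.card_aut]
      refine (Nat.card_congr (Equiv.ofBijective
        (fun α : A => (⟨some (1 * α.1 v), α, α.2, rfl⟩ : line A 1 v)) ⟨?_, ?_⟩)).symm
      · intro α β hαβ
        have h3 : α.1 v = β.1 v := by simpa using congrArg Subtype.val hαβ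
        exact Subtype.ext (h.eq_of_mk_eq α.2 β.2 hp1 (by rw [h3, inv_mul_cancel]; exact one_mem _))
      · rintro ⟨_, α, hα, rfl⟩
        exact ⟨⟨α, hα⟩, rfl⟩
    rw [Set.eq_of_subset_of_ncard_le hsub (by rw [hc, B.2.1.ncard h])]
    exact B.2.1

end UnitalGroup

end

/-! ### Generation by central collineations -/

section

open Subgroup Finset
open scoped Pointwise

namespace UnitalGroup

variable {P : Type*} [Group P] {A : Subgroup (MulAut P)} {Γ : Subgroup (Equiv.Perm (Option P))}
  (h : UnitalGroup A Γ)
include h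

theorem conj_mem {β : MulAut P} (hβ : extend β ∈ Γ) {α : MulAut P} (hα : α ∈ A) :
    β * α * β⁻¹ ∈ A := by
  rw [h.mem_iff, extend_mul, extend_mul, extend_inv]
  refine ⟨mul_mem (mul_mem hβ (h.extend_mem hα)) (inv_mem hβ), fun x hx => ?_⟩
  rw [MulAut.mul_apply, MulAut.mul_apply, h.apply_center α hα _ (apply_mem_center _ hx),
    MulAut.apply_inv_self]

theorem isBlock_line (u : P) {w : P} (hw : w ∉ center P) : IsBlock Γ (line A u w) := by
  obtain ⟨v, hv, hB⟩ := h.exists_isBlock_line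
  obtain ⟨β, hβ, x, hx, rfl⟩ := h.transitive v w hv hw
  have h1 : line A u (x * β v) = (shift (u * x) * extend β) • line A 1 v := by
    ext p
    rw [← smul_smul, mem_smul_set_perm, mem_smul_set_perm, shift_inv, ← extend_inv]
    cases p with
    | none => simp [line]
    | some c =>
      simp only [line, Set.mem_ofPred_eq, shift_some, extend_some, Option.some_inj, one_mul]
      constructor
      · rintro ⟨α, hα, rfl⟩
        have hinv : extend β⁻¹ ∈ Γ := extend_inv β ▸ inv_mem hβ
        refine ⟨β⁻¹ * α * β, by simpa using h.conj_mem hinv hα, ?_⟩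
        rw [map_mul α, h.apply_center α hα x hx]
        simp [mul_assoc]
      · rintro ⟨α, hα, hc⟩
        refine ⟨β * α * β⁻¹, h.conj_mem hβ hα, ?_⟩
        rw [map_mul, h.apply_center _ (h.conj_mem hβ hα) x hx, ← mul_assoc,
          ← inv_mul_eq_iff_eq_mul]
        have := congrArg β hc
        simpa using this
  rw [h1]
  exact hB.smul (mul_mem (h.shift_mem _) hβ)

theorem exists_mk_eq {α : MulAut P} (hα : α ∈ A) (hα1 : α ≠ 1) (w : P) :
    ∃ v : P, (v⁻¹ * α v)⁻¹ * w ∈ center P := by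
  have := h.finite
  let F : P ⧸ center P → P ⧸ center P := fun q => QuotientGroup.mk (q.out⁻¹ * α q.out)
  have hF : Function.Injective F := by
    intro q r hqr
    have h1 : q.out * r.out⁻¹ ∈ center P := by
      by_contra hc
      refine hα1 (h.free α hα _ hc ?_)
      rw [← mk_eq_mk_iff_mem_center]
      have h2 : (QuotientGroup.mk (q.out⁻¹ * α q.out) : P ⧸ center P) =
        QuotientGroup.mk (r.out⁻¹ * α r.out) := hqr
      simp only [QuotientGroup.mk_mul, QuotientGroup.mk_inv, map_mul, map_inv] at h2 ⊢
      rw [eq_mul_inv_iff_mul_eq, mul_assoc, ← h2, mul_inv_cancel_left]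
    have h4 : (QuotientGroup.mk q.out : P ⧸ center P) = QuotientGroup.mk r.out := by
      rw [← inv_mem_iff, mul_inv_rev, inv_inv] at h1
      exact mk_eq_mk_iff_mem_center.2 (by simpa using mul_mem_center_comm h1)
    simpa using h4
  obtain ⟨q, hq⟩ := (Finite.injective_iff_surjective.1 hF) (QuotientGroup.mk w)
  exact ⟨q.out, mk_eq_mk_iff_mem_center.1 hq⟩

theorem notMem_center_of_ne {v w : P} {α : MulAut P} (hα : α ∈ A) (hw : w ∉ center P)
    (hvw : (v⁻¹ * α v)⁻¹ * w ∈ center P) : v ∉ center P := by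
  intro hv
  rw [h.apply_center α hα v hv, inv_mul_cancel, inv_one, one_mul] at hvw
  exact hw hvw

theorem exists_eq_inv_mul {w : P} (hw : w ∉ center P) :
    ∃ α ∈ A, ∃ v, v ∉ center P ∧ w = v⁻¹ * α v := by
  have := h.finite
  have := h.finite_aut
  have hex : ∀ α : {α : A // α ≠ 1}, ∃ v : P, (v⁻¹ * α.1.1 v)⁻¹ * w ∈ center P := fun α =>
    h.exists_mk_eq α.1.2 (fun hh => α.2 (Subtype.ext hh)) w
  choose f hf using hex
  let F : {α : A // α ≠ 1} → center P := fun α => ⟨_, hf α⟩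
  have hF : Function.Injective F := by
    intro α β hαβ
    have h1 : (f α)⁻¹ * α.1.1 (f α) = (f β)⁻¹ * β.1.1 (f β) := by
      have := congrArg Subtype.val hαβ
      exact inv_injective (mul_right_cancel this)
    have hα := h.notMem_center_of_ne α.1.2 hw (hf α)
    have hβ := h.notMem_center_of_ne β.1.2 hw (hf β)
    have hne : some (1 : P) ≠ some ((f α)⁻¹ * α.1.1 (f α)) := by
      intro hh
      have h2 := hf α
      rw [← Option.some_injective _ hh, inv_one, one_mul] at h2
      exact hw h2
    have h3 : line A (f α)⁻¹ (f α) = line A (f β)⁻¹ (f β) := by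
      refine (h.isBlock_line _ hα).eq h (h.isBlock_line _ hβ) hne ⟨1, one_mem _, ?_⟩
        ⟨_, α.1.2, rfl⟩ ⟨1, one_mem _, ?_⟩ ⟨_, β.1.2, by rw [h1]⟩
      · simp
      · simp
    have h4 := h.center_argument (u := (f α)⁻¹) (u' := (f β)⁻¹) (v' := f β) hα fun γ hγ => by
      have h5 : some ((f α)⁻¹ * γ (f α)) ∈ line A (f β)⁻¹ (f β) := h3 ▸ ⟨γ, hγ, rfl⟩
      obtain ⟨δ, hδ, h6⟩ := h5
      refine ⟨δ, hδ, ?_⟩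
      rw [Option.some_injective _ h6, inv_mul_cancel]
      exact one_mem _
    rw [inv_inv] at h4
    have h5 : f β = (f α * (f β)⁻¹)⁻¹ * f α := by group
    have h6 := h.apply_center β.1 β.1.2 _ (inv_mem h4)
    have h7 : (f β)⁻¹ * β.1.1 (f β) = (f α)⁻¹ * β.1.1 (f α) := by
      have h8 : β.1.1 (f β) = (f α * (f β)⁻¹)⁻¹ * β.1.1 (f α) := by
        conv_lhs => rw [h5]
        rw [map_mul, h6]
      rw [h8]; group
    rw [h7, mul_right_inj] at h1
    exact Subtype.ext (Subtype.ext (h.eq_of_mk_eq α.1.2 β.1.2 hα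
      (by rw [h1, inv_mul_cancel]; exact one_mem _)))
  have hbij : Function.Bijective F := by
    refine hF.bijective_of_nat_card_le ?_
    have := Fintype.ofFinite A
    classical
    rw [h.card_center, Nat.card_eq_fintype_card, Fintype.card_subtype_compl,
      ← Nat.card_eq_fintype_card, h.card_aut]
    simp
  obtain ⟨α, hα⟩ := hbij.2 1
  refine ⟨α.1, α.1.2, f α, h.notMem_center_of_ne α.1.2 hw (hf α), ?_⟩
  exact (inv_mul_eq_one.1 (congrArg Subtype.val hα)).symm

theorem eq_lineInf {B : Set (Option P)} (hB : IsBlock Γ B) (h1 : none ∈ B) :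
    ∃ u, B = lineInf u := by
  have := h.finite
  obtain ⟨p, hp, hne⟩ := Set.exists_ne_of_one_lt_ncard (by rw [hB.ncard h]; norm_num) none
  obtain ⟨u, rfl⟩ := Option.ne_none_iff_exists'.1 hne
  exact ⟨u, hB.eq h (h.isBlock_lineInf u) hne hp h1 (by simp) (by simp)⟩

theorem isBlock_iff {B : Set (Option P)} : IsBlock Γ B ↔ B ∈ blocks A := by
  have := h.finite
  constructor
  · intro hB
    by_cases hn : none ∈ B
    · exact .inl (h.eq_lineInf hB hn)
    · right
      obtain ⟨p, q, hp, hq, hpq⟩ := (Set.one_lt_ncard_iff (Set.toFinite B)).1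
        (by rw [hB.ncard h]; norm_num)
      obtain ⟨a, rfl⟩ := Option.ne_none_iff_exists'.1 (fun hh => hn (hh ▸ hp))
      obtain ⟨b, rfl⟩ := Option.ne_none_iff_exists'.1 (fun hh => hn (hh ▸ hq))
      have hw : a⁻¹ * b ∉ center P := by
        intro hc
        rw [hB.eq h (h.isBlock_lineInf a) hpq hp hq (by simp) (by simpa using hc)] at hn
        exact hn (none_mem_lineInf _)
      obtain ⟨α, hα, v, hv, hav⟩ := h.exists_eq_inv_mul hw
      refine ⟨a * v⁻¹, v, hv, hB.eq h (h.isBlock_line _ hv) hpq hp hq ⟨1, one_mem _, by simp⟩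
        ⟨α, hα, ?_⟩⟩
      rw [mul_assoc, ← hav, mul_inv_cancel_left]
  · rintro (⟨u, rfl⟩ | ⟨u, v, hv, rfl⟩)
    · exact h.isBlock_lineInf u
    · exact h.isBlock_line u hv

theorem apply_eq_self_of_apply_eq_self {τ : Equiv.Perm (Option P)}
    (hτ : ∀ B ∈ blocks A, τ • B ∈ blocks A) (hn : τ none = none)
    (hc : ∀ v, ∃ v', τ (some v) = some v' ∧ v⁻¹ * v' ∈ center P) {a b : P}
    (ha : τ (some a) = some a) (hab : a⁻¹ * b ∉ center P) : τ (some b) = some b := by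
  have hne : some a ≠ some b := by
    intro hh
    rw [Option.some_injective _ hh, inv_mul_cancel] at hab
    exact hab (one_mem _)
  obtain ⟨B, hB, hBa, hBb⟩ := h.exists_isBlock hne
  have hnB : none ∉ B := by
    intro hn
    obtain ⟨u, rfl⟩ := h.eq_lineInf hB hn
    rw [some_mem_lineInf] at hBa hBb
    refine hab ?_
    rw [show a⁻¹ * b = (u⁻¹ * a)⁻¹ * (u⁻¹ * b) by group]
    exact mul_mem (inv_mem hBa) hBb
  rw [h.isBlock_iff] at hB
  have hB' := hτ B hB
  obtain ⟨u, v, hv, rfl⟩ := hB.resolve_left (by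
    rintro ⟨u, rfl⟩
    exact hnB (none_mem_lineInf _))
  obtain ⟨u', v', -, h1⟩ := hB'.resolve_left (by
    rintro ⟨u', h1⟩
    have h2 : τ none ∈ τ • line A u v := by
      rw [h1, hn]
      exact none_mem_lineInf _
    exact hnB (apply_mem_smul_set.1 h2))
  have himg : ∀ c, some c ∈ line A u v → ∃ α' ∈ A, τ (some c) = some (u' * α' v') := by
    intro c hcB
    have h2 : τ (some c) ∈ τ • line A u v := apply_mem_smul_set.2 hcB
    rw [h1] at h2
    exact h2
  have hz : u⁻¹ * u' ∈ center P := by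
    refine h.center_argument (v' := v') hv fun α hα => ?_
    obtain ⟨c, hc1, hc2⟩ := hc (u * α v)
    obtain ⟨α', hα', h2⟩ := himg (u * α v) ⟨α, hα, rfl⟩
    rw [hc1] at h2
    rw [Option.some_injective _ h2] at hc2
    exact ⟨α', hα', hc2⟩
  obtain ⟨α₁, hα₁, ha₁⟩ := hBa
  obtain ⟨α₂, hα₂, ha₂⟩ := himg a ⟨α₁, hα₁, ha₁⟩
  obtain ⟨β, hβ, hb⟩ := hBb
  obtain ⟨γ, hγ, hg⟩ := himg b ⟨β, hβ, hb⟩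
  rw [ha] at ha₂
  have e₁ := Option.some_injective _ ha₁
  have e₂ := Option.some_injective _ ha₂
  have e₃ := Option.some_injective _ hb
  have h3 : α₁ v = (u⁻¹ * u') * α₂ v' := by
    rw [mul_assoc, ← e₂, e₁, inv_mul_cancel_left]
  have h4 : v' = (u⁻¹ * u')⁻¹ * (α₂⁻¹ * α₁) v := by
    rw [MulAut.mul_apply, h3, map_mul, h.apply_center _ (inv_mem hα₂) _ hz,
      inv_mul_cancel_left, MulAut.inv_apply_self]
  have h5 : u' * γ v' = u * (γ * (α₂⁻¹ * α₁)) v := by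
    rw [h4, map_mul, h.apply_center _ hγ _ (inv_mem hz), ← MulAut.mul_apply P γ,
      mul_inv_rev, inv_inv,
      mul_assoc, mul_inv_cancel_left]
  rw [hg, h5, e₃]
  obtain ⟨c, hc1, hc2⟩ := hc b
  rw [hg, h5] at hc1
  rw [← Option.some_injective _ hc1, e₃, mul_inv_rev, mul_assoc, inv_mul_cancel_left] at hc2
  rw [← h.eq_of_mk_eq hβ (mul_mem hγ (mul_mem (inv_mem hα₂) hα₁)) hv hc2]

theorem eq_shift {σ : Equiv.Perm (Option P)} (hσ : ∀ B ∈ blocks A, σ • B ∈ blocks A)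
    (hinf : ∀ u : P, σ • lineInf u = lineInf u) : ∃ x ∈ center P, σ = shift x := by
  obtain ⟨d, hd⟩ := h.exists_notMem
  have key : ∀ τ : Equiv.Perm (Option P), (∀ u : P, τ • lineInf u = lineInf u) →
      τ none = none ∧ ∀ v, ∃ v', τ (some v) = some v' ∧ v⁻¹ * v' ∈ center P := by
    intro τ hτ
    have h1 : τ none = none := by
      by_contra hne
      obtain ⟨c, hc⟩ := Option.ne_none_iff_exists'.1 hne
      have h2 := mem_of_smul_eq (hτ 1) (none_mem_lineInf 1)
      have h3 := mem_of_smul_eq (hτ d) (none_mem_lineInf d)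
      rw [hc, some_mem_lineInf] at h2 h3
      rw [inv_one, one_mul] at h2
      rw [mul_mem_cancel_right h2, inv_mem_iff] at h3
      exact hd h3
    refine ⟨h1, fun v => ?_⟩
    have h2 : τ (some v) ≠ none := by
      rw [← h1]
      exact fun hh => Option.some_ne_none _ (τ.injective hh)
    obtain ⟨c, hc⟩ := Option.ne_none_iff_exists'.1 h2
    have h3 := mem_of_smul_eq (hτ v) (p := some v) (by simp)
    rw [hc, some_mem_lineInf] at h3
    exact ⟨c, hc, h3⟩
  obtain ⟨x, hx, hxc⟩ := (key σ hinf).2 1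
  rw [inv_one, one_mul] at hxc
  refine ⟨x, hxc, ?_⟩
  have hτinf : ∀ u : P, (shift x⁻¹ * σ) • lineInf u = lineInf u := fun u => by
    rw [← smul_smul, hinf, shift_smul_lineInf_of_mem (inv_mem hxc)]
  have hτ : ∀ B ∈ blocks A, (shift x⁻¹ * σ) • B ∈ blocks A := fun B hB => by
    rw [← smul_smul]
    exact shift_smul_mem_blocks _ (hσ B hB)
  obtain ⟨k1, k2⟩ := key _ hτinf
  have h1 : (shift x⁻¹ * σ) (some 1) = some 1 := by
    rw [Equiv.Perm.mul_apply, hx, shift_some, inv_mul_cancel]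
  have h2 : ∀ c, c ∉ center P → (shift x⁻¹ * σ) (some c) = some c := fun c hc =>
    h.apply_eq_self_of_apply_eq_self hτ k1 k2 h1 (by rwa [inv_one, one_mul])
  have h3 : shift x⁻¹ * σ = 1 := by
    ext p : 1
    cases p with
    | none => exact k1
    | some c =>
      by_cases hc : c ∈ center P
      · exact h.apply_eq_self_of_apply_eq_self hτ k1 k2 (h2 d hd)
          (by rwa [mul_mem_cancel_right hc, inv_mem_iff])
      · exact h2 c hc
  rw [← shift_inv] at h3
  exact (inv_mul_eq_one.1 h3).symm

theorem smul_mem_blocks {g : Equiv.Perm (Option P)} (hg : g ∈ Γ) {B : Set (Option P)}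
    (hB : B ∈ blocks A) : g • B ∈ blocks A := by
  rw [← h.isBlock_iff] at hB ⊢
  exact hB.smul hg

/-- The group is determined by its set of blocks. -/
theorem eq_closure : Γ = closure (centralPerms A) := by
  apply le_antisymm
  · refine h.le_closure.trans (closure_mono ?_)
    rintro _ ⟨g, hg, x, hx, rfl⟩
    refine ⟨fun B hB => h.smul_mem_blocks
      (mul_mem (mul_mem hg (h.shift_mem x)) (inv_mem hg)) hB, g none, fun B hB hp => ?_⟩
    have h1 : none ∈ g⁻¹ • B := by rwa [mem_smul_set_perm, inv_inv]
    obtain ⟨u, hu⟩ := h.eq_lineInf (h.isBlock_iff.2 (h.smul_mem_blocks (inv_mem hg) hB)) h1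
    rw [← smul_smul, ← smul_smul, hu, shift_smul_lineInf_of_mem hx, ← hu, smul_inv_smul]
  · rw [closure_le]
    rintro σ ⟨hσ, p, hp⟩
    obtain ⟨g, hg, rfl⟩ := h.exists_apply_none p
    obtain ⟨x, hx, h1⟩ := h.eq_shift (σ := g⁻¹ * σ * g) (fun B hB => by
      rw [← smul_smul, ← smul_smul]
      exact h.smul_mem_blocks (inv_mem hg) (hσ _ (h.smul_mem_blocks hg hB))) (fun u => by
      rw [← smul_smul, ← smul_smul, hp _ (h.smul_mem_blocks hg (.inl ⟨u, rfl⟩))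
        (apply_mem_smul_set.2 (none_mem_lineInf u)), inv_smul_smul])
    have h2 : σ = g * shift x * g⁻¹ := by rw [← h1]; group
    rw [h2]
    exact mul_mem (mul_mem hg (h.shift_mem x)) (inv_mem hg)

end UnitalGroup

end

/-! ### The permutation representation -/

section

open Subgroup Finset
open scoped Pointwise commutatorElement

namespace UnitaryLocal

variable {G : Type*} [Group G] {U : Subgroup G} (h : UnitaryLocal G U)
include h

theorem finite : Finite G := Nat.finite_of_card_ne_zero (by rw [h.card_group]; norm_num)

theorem index_normalizer : (normalizer (U : Set G)).index = 912674 := by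
  have := Subgroup.card_mul_index (normalizer (U : Set G))
  rw [h.card_normalizer, h.card_group] at this
  exact Nat.eq_of_mul_eq_mul_left (by norm_num) this

theorem mem_of_pow_eq_one {b : G} (hb : b ∈ normalizer (U : Set G)) (hb1 : b ^ 97 ^ 3 = 1) :
    b ∈ U := by
  have := h.finite
  have h1 := Subgroup.card_mul_index (U.subgroupOf (normalizer (U : Set G)))
  have h2 : Nat.card (U.subgroupOf (normalizer (U : Set G))) = 97 ^ 3 := by
    rw [← h.card]
    exact Nat.card_congr (subgroupOfEquivOfLe le_normalizer).toEquiv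
  rw [h2, h.card_normalizer] at h1
  have h3 := Nat.eq_of_mul_eq_mul_left (by norm_num) h1
  rw [Subgroup.index] at h3
  have h4 : (QuotientGroup.mk (⟨b, hb⟩ : normalizer (U : Set G)) :
      normalizer (U : Set G) ⧸ U.subgroupOf (normalizer (U : Set G))) = 1 := by
    have h5 := orderOf_dvd_natCard (QuotientGroup.mk (⟨b, hb⟩ : normalizer (U : Set G)) :
      normalizer (U : Set G) ⧸ U.subgroupOf (normalizer (U : Set G)))
    rw [h3] at h5
    refine orderOf_eq_one_iff.1 (Nat.eq_one_of_dvd_coprimes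
      (show Nat.Coprime (97 ^ 3) 9408 by norm_num) ?_ h5)
    rw [orderOf_dvd_iff_pow_eq_one, ← QuotientGroup.mk_pow]
    have h6 : (⟨b, hb⟩ : normalizer (U : Set G)) ^ 97 ^ 3 = 1 := Subtype.ext hb1
    rw [h6, QuotientGroup.mk_one]
  rw [QuotientGroup.eq_one_iff, mem_subgroupOf] at h4
  exact h4

theorem pow_card_eq_one {u : G} (hu : u ∈ U) : u ^ 97 ^ 3 = 1 := by
  rw [← h.card, ← orderOf_dvd_iff_pow_eq_one]
  exact Subgroup.orderOf_dvd_natCard U hu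

theorem eq_one_of_conj_mem {u g : G} (hu : u ∈ U) (hg : g ∉ normalizer (U : Set G))
    (hug : g * u * g⁻¹ ∈ normalizer (U : Set G)) : u = 1 := by
  by_contra hu1
  refine hg (h.mem_normalizer u hu hu1 g (h.mem_of_pow_eq_one hug ?_))
  rw [conj_pow, h.pow_card_eq_one hu, mul_one, mul_inv_cancel]

theorem exists_notMem_normalizer : ∃ g, g ∉ normalizer (U : Set G) := by
  by_contra! hc
  have h1 := (Subgroup.eq_top_iff' _).2 hc
  have h2 := h.index_normalizer
  rw [h1, index_top] at h2
  norm_num at h2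

/-- The action on the conjugates of `U`, with the points labelled by `U ∪ {∞}`. -/
theorem exists_perm : ∃ π : G →* Equiv.Perm (Option U),
    (∀ g, π g none = none ↔ g ∈ normalizer (U : Set G)) ∧ (∀ u : U, π u = shift u) ∧
      ∃ g, π g none = some 1 := by
  have := h.finite
  obtain ⟨g₀, hg₀⟩ := h.exists_notMem_normalizer
  let f : Option U → G ⧸ normalizer (U : Set G) := fun o =>
    o.elim (QuotientGroup.mk 1) fun u => QuotientGroup.mk (u.1 * g₀)
  have hnone : f none = QuotientGroup.mk 1 := rfl
  have hsome : ∀ u : U, f (some u) = QuotientGroup.mk (u.1 * g₀) := fun _ => rfl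
  have hne : ∀ u : U, f none ≠ f (some u) := by
    intro u hu
    rw [hnone, hsome, QuotientGroup.eq, inv_one, one_mul,
      mul_mem_cancel_left (le_normalizer u.2)] at hu
    exact hg₀ hu
  have hinj : Function.Injective f := by
    rintro (_ | u) (_ | v) huv
    · rfl
    · exact absurd huv (hne v)
    · exact absurd huv.symm (hne u)
    · rw [hsome, hsome, QuotientGroup.eq] at huv
      have h1 := h.eq_one_of_conj_mem (u := u.1⁻¹ * v.1) (g := g₀⁻¹) (mul_mem (inv_mem u.2) v.2)
        (by rwa [inv_mem_iff]) (by
          rwa [show g₀⁻¹ * (u.1⁻¹ * v.1) * g₀⁻¹⁻¹ = (u.1 * g₀)⁻¹ * (v.1 * g₀) by group])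
      rw [Subtype.ext (inv_mul_eq_one.1 h1)]
  have hcard : Nat.card (G ⧸ normalizer (U : Set G)) ≤ Nat.card (Option U) := by
    have h1 := h.index_normalizer
    rw [Subgroup.index] at h1
    rw [h1, Finite.card_option, h.card]
    norm_num
  let e := Equiv.ofBijective f (hinj.bijective_of_nat_card_le hcard)
  have hπ : ∀ g p q, g • f p = f q →
      (e.symm.permCongrHom.toMonoidHom.comp (MulAction.toPermHom G _)) g p = q := by
    intro g p q hpq
    change e.symm (g • f p) = q
    rw [hpq]
    exact e.symm_apply_apply q
  refine ⟨e.symm.permCongrHom.toMonoidHom.comp (MulAction.toPermHom G _), fun g => ?_, fun u => ?_,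
    g₀, ?_⟩
  · constructor
    · intro hg
      have h1 : g • f none = f none := by
        have h2 : e.symm (g • f none) = none := hg
        rw [Equiv.symm_apply_eq] at h2
        exact h2
      have h3 : (QuotientGroup.mk (g * 1) : G ⧸ normalizer (U : Set G)) = QuotientGroup.mk 1 := h1
      rw [eq_comm, QuotientGroup.eq, inv_one, one_mul] at h3
      simpa using h3
    · intro hg
      apply hπ
      change (QuotientGroup.mk (g * 1) : G ⧸ normalizer (U : Set G)) = QuotientGroup.mk 1
      rw [eq_comm, QuotientGroup.eq]
      simpa using hg
  · ext p : 1
    apply hπ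
    cases p with
    | none =>
      change (QuotientGroup.mk (u.1 * 1) : G ⧸ normalizer (U : Set G)) = QuotientGroup.mk 1
      rw [eq_comm, QuotientGroup.eq]
      simpa using le_normalizer u.2
    | some v =>
      change (QuotientGroup.mk (u.1 * (v.1 * g₀)) : G ⧸ normalizer (U : Set G)) =
        QuotientGroup.mk ((u.1 * v.1) * g₀)
      rw [mul_assoc]
  · apply hπ
    change (QuotientGroup.mk (g₀ * 1) : G ⧸ normalizer (U : Set G)) =
        QuotientGroup.mk ((1 : U).1 * g₀)
    simp

end UnitaryLocal

end

/-! ### The group acts on the unital -/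

section

open Subgroup Finset
open scoped Pointwise commutatorElement

/-- The automorphisms of `P` that induce elements of `Γ` and are trivial on the center. -/
def centralAut {P : Type*} [Group P] (Γ : Subgroup (Equiv.Perm (Option P))) :
    Subgroup (MulAut P) where
  carrier := {β | extend β ∈ Γ ∧ ∀ x ∈ center P, β x = x}
  one_mem' := ⟨by rw [extend_one]; exact one_mem _, fun _ _ => rfl⟩
  mul_mem' := by
    rintro α β ⟨hα, hα'⟩ ⟨hβ, hβ'⟩
    refine ⟨by rw [extend_mul]; exact mul_mem hα hβ, fun x hx => ?_⟩
    rw [MulAut.mul_apply, hβ' x hx, hα' x hx]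
  inv_mem' := by
    rintro α ⟨hα, hα'⟩
    refine ⟨by rw [extend_inv]; exact inv_mem hα, fun x hx => ?_⟩
    nth_rewrite 1 [← hα' x hx]
    exact MulAut.inv_apply_self _ _ _

namespace UnitaryLocal

variable {G : Type*} [Group G] {U : Subgroup G} (h : UnitaryLocal G U)
  {π : G →* Equiv.Perm (Option U)} (ha : ∀ g, π g none = none ↔ g ∈ normalizer (U : Set G))
  (hb : ∀ u : U, π u = shift u) (hc : ∃ g, π g none = some 1)

theorem conj_mem_of_mem_normalizer {g : G} (hg : g ∈ normalizer (U : Set G)) (u : U) :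
    g * u * g⁻¹ ∈ U := (mem_normalizer_iff.1 hg u).1 u.2

include hb in
theorem apply_some {g : G} (hg : g ∈ normalizer (U : Set G)) (hg1 : π g (some 1) = some 1) (u : U) :
    π g (some u) = some ⟨g * u * g⁻¹, conj_mem_of_mem_normalizer hg u⟩ := by
  have h1 : π u (some 1) = some u := by rw [hb, shift_some, mul_one]
  have h2 := hb ⟨g * u * g⁻¹, conj_mem_of_mem_normalizer hg u⟩
  have h3 : g * u = g * u * g⁻¹ * g := by group
  rw [← h1, ← Equiv.Perm.mul_apply, ← map_mul, congrArg π h3, map_mul, Equiv.Perm.mul_apply, hg1]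
  change π (⟨g * u * g⁻¹, conj_mem_of_mem_normalizer hg u⟩ : U) (some 1) = _
  rw [h2, shift_some, mul_one]

include ha hb in
theorem exists_extend {g : G} (hg : π g none = none) (hg1 : π g (some 1) = some 1) :
    ∃ β : MulAut U, π g = extend β ∧ ∀ u : U, (β u : G) = g * u * g⁻¹ := by
  rw [ha] at hg
  refine ⟨U.normalizerMonoidHom ⟨g, hg⟩, ?_, fun u => rfl⟩
  ext p : 1
  cases p with
  | none => rw [(ha g).2 hg, extend_none]
  | some u => rw [apply_some hb hg hg1]; rfl

include ha hb in
theorem coe_apply_of_eq_extend {g : G} {β : MulAut U} (hβ : π g = extend β) (u : U) :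
    (β u : G) = g * u * g⁻¹ := by
  obtain ⟨γ, hγ, hγ'⟩ := exists_extend ha hb (g := g) (by rw [hβ]; simp) (by rw [hβ]; simp)
  rw [← hγ', extend_injective (hβ.symm.trans hγ)]

include h

theorem exists_notMem_center : ∃ u : U, u ∉ center U := by
  by_contra! hc
  have h1 := (Subgroup.eq_top_iff' _).2 hc
  have h2 := card_center_subgroup (U := U)
  rw [h1, card_top, h.card, h.card_inf] at h2
  norm_num at h2

include ha hb in
theorem eq_one_of_extend_apply {g : G} {β : MulAut U} (hβ : π g = extend β) {u : U}
    (hu : u ∉ center U) (hβu : β u = u) : g = 1 := by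
  have h1 := coe_apply_of_eq_extend ha hb hβ u
  rw [hβu, eq_mul_inv_iff_mul_eq] at h1
  have hg : g ∈ U := h.centralizer_le u u.2 (fun hh => hu (mem_center_subgroup_iff.2 hh))
    (mem_centralizer_singleton_iff.2 h1.symm)
  have h2 : π (⟨g, hg⟩ : U) (some 1) = some 1 := by
    change π g (some 1) = _
    rw [hβ, extend_some, map_one]
  rw [hb, shift_some, mul_one] at h2
  exact congrArg Subtype.val (Option.some_injective _ h2)

include ha hb in
theorem injective : Function.Injective π := by
  rw [injective_iff_map_eq_one]
  intro g hg
  obtain ⟨u, hu⟩ := h.exists_notMem_center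
  exact h.eq_one_of_extend_apply ha hb (β := 1) (by rw [hg, extend_one]) hu rfl

theorem centralizer_le_normalizer :
    centralizer ((U ⊓ centralizer (U : Set G) : Subgroup G) : Set G) ≤ normalizer (U : Set G) := by
  intro g hg
  obtain ⟨x, hx, hx1⟩ : ∃ x ∈ U ⊓ centralizer (U : Set G), x ≠ 1 := by
    by_contra! hc
    have h1 := h.card_inf
    rw [(Subgroup.eq_bot_iff_forall _).2 hc, card_bot] at h1
    norm_num at h1
  have hxU := (Subgroup.mem_inf.1 hx).1
  refine h.mem_normalizer x hxU hx1 g ?_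
  rwa [← mem_centralizer_iff.1 hg x hx, mul_inv_cancel_right]

include ha hb in
theorem card_centralAut : Nat.card (centralAut π.range) = 98 := by
  have := h.finite
  set C := centralizer ((U ⊓ centralizer (U : Set G) : Subgroup G) : Set G) with hC
  have hCmem : ∀ g, g ∈ C ↔ ∀ x : U, x ∈ center U → g * x * g⁻¹ = x := by
    intro g
    rw [hC, mem_centralizer_iff]
    constructor
    · intro hg x hx
      rw [mul_inv_eq_iff_eq_mul]
      exact (hg x (mem_center_subgroup_iff.1 hx)).symm
    · intro hg x hx
      exact (mul_inv_eq_iff_eq_mul.1 (hg ⟨x, (Subgroup.mem_inf.1 hx).1⟩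
        (mem_center_subgroup_iff.2 hx))).symm
  have hUC : U ≤ C := by
    intro u hu
    rw [hCmem]
    intro x hx
    rw [mul_inv_eq_iff_eq_mul]
    exact congrArg Subtype.val (mem_center_iff.1 hx ⟨u, hu⟩)
  let F : U × centralAut π.range → Equiv.Perm (Option U) := fun p => shift p.1 * extend p.2.1
  have hF : Function.Injective F := by
    rintro ⟨u, α⟩ ⟨v, β⟩ huv
    change shift u * extend α.1 = shift v * extend β.1 at huv
    have h1 : u = v := by simpa using congrArg (· (some 1)) huv
    subst h1
    rw [Subtype.ext (extend_injective (mul_left_cancel huv))]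
  have hr : Set.range F = π '' C := by
    ext σ
    constructor
    · rintro ⟨⟨u, β, ⟨g, hg⟩, hβ⟩, rfl⟩
      refine ⟨u * g, mul_mem (hUC u.2) ((hCmem g).2 fun x hx => ?_), ?_⟩
      · rw [← coe_apply_of_eq_extend ha hb hg, hβ x hx]
      · rw [map_mul, hb, hg]
    · rintro ⟨g, hg, rfl⟩
      have hgn : π g none = none := (ha g).2 (h.centralizer_le_normalizer hg)
      have hne : π g (some 1) ≠ none := by
        rw [← hgn]
        exact fun hh => Option.some_ne_none _ ((π g).injective hh)
      obtain ⟨u, hu⟩ := Option.ne_none_iff_exists'.1 hne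
      have hu' : π (u.1⁻¹ * g) = shift u⁻¹ * π g := by
        rw [map_mul, ← hb u⁻¹, Subgroup.coe_inv]
      obtain ⟨β, hβ, hβ'⟩ := exists_extend ha hb (g := u.1⁻¹ * g) (by rw [hu']; simp [hgn])
        (by rw [hu']; simp [hu])
      refine ⟨⟨u, β, ⟨_, hβ⟩, fun x hx => Subtype.ext ?_⟩, ?_⟩
      · rw [hβ']
        exact (hCmem _).1 (mul_mem (inv_mem (hUC u.2)) hg) x hx
      · change shift u * extend β = π g
        rw [← hβ, hu', ← shift_inv, mul_inv_cancel_left]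
  have h1 : Nat.card (Set.range F) = Nat.card C := by
    rw [hr]
    exact Nat.card_image_of_injective (h.injective ha hb) _
  rw [Nat.card_range_of_injective hF, Nat.card_prod, h.card, h.card_centralizer] at h1
  exact Nat.eq_of_mul_eq_mul_left (by norm_num) h1

include ha hb in
theorem heisenbergPair : HeisenbergPair U (centralAut π.range) where
  card := h.card
  card_center := by rw [card_center_subgroup, h.card_inf]
  card_aut := h.card_centralAut ha hb
  apply_center := fun α hα => hα.2
  free := by
    have hX : Nat.card (center U) = 97 := by rw [card_center_subgroup, h.card_inf]
    intro α hα u hu hx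
    set x := u⁻¹ * α u with hxdef
    have h1 : ∀ n : ℕ, (α ^ n) u = u * x ^ n := by
      intro n
      induction n with
      | zero => simp
      | succ n ih =>
        rw [pow_succ', MulAut.mul_apply, ih, map_mul, map_pow, hα.2 x hx,
          show α u = u * x by rw [hxdef, mul_inv_cancel_left], pow_succ', mul_assoc]
    have h2 : α ^ 98 = 1 := by
      rw [← h.card_centralAut ha hb, ← orderOf_dvd_iff_pow_eq_one]
      exact Subgroup.orderOf_dvd_natCard _ hα
    have h3 : x ^ 98 = 1 := by
      have := h1 98
      rw [h2, MulAut.one_apply] at this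
      exact (mul_eq_left.1 this.symm)
    have h4 : x ^ 97 = 1 := by
      have := Subgroup.orderOf_dvd_natCard _ hx
      rwa [hX, orderOf_dvd_iff_pow_eq_one] at this
    rw [pow_succ, h4, one_mul] at h3
    obtain ⟨g, hg⟩ := hα.1
    have h5 := h.eq_one_of_extend_apply ha hb hg hu (inv_mul_eq_one.1 h3).symm
    rw [h5, map_one, ← extend_one] at hg
    exact (extend_injective hg).symm

theorem exists_conj_eq {u w : U} (hu : u ∉ center U) (hw : w ∉ center U) :
    ∃ g ∈ normalizer (U : Set G), g * u * g⁻¹ = w := by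
  classical
  have := h.finite
  have : Fact (Nat.Prime 97) := ⟨by norm_num⟩
  have hX : Nat.card (center U) = 97 := by rw [card_center_subgroup, h.card_inf]
  have hsmul : ∀ (b : normalizer (U : Set G)) (v : U), ((b • v : U) : G) = b.1 * v * b.1⁻¹ :=
    fun _ _ => rfl
  have hK : Nat.card (MulAction.stabilizer (normalizer (U : Set G)) u) = 97 ^ 2 := by
    rw [← card_centralizer_of_card h.card hX hu]
    have hmem : ∀ b : normalizer (U : Set G), b ∈ MulAction.stabilizer (normalizer (U : Set G)) u ↔
        b.1 * u = u * b.1 := by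
      intro b
      rw [MulAction.mem_stabilizer_iff, ← mul_inv_eq_iff_eq_mul, ← hsmul]
      exact Subtype.ext_iff
    refine Nat.card_congr (Equiv.ofBijective (fun k => ⟨⟨k.1.1, h.centralizer_le u u.2
      (fun hh => hu (mem_center_subgroup_iff.2 hh))
      (mem_centralizer_singleton_iff.2 ((hmem _).1 k.2))⟩, ?_⟩) ⟨?_, ?_⟩)
    · rw [mem_centralizer_singleton_iff]
      exact Subtype.ext ((hmem _).1 k.2)
    · intro k l hkl
      exact Subtype.ext (Subtype.ext (congrArg (fun z => z.1.1) hkl))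
    · rintro ⟨v, hv⟩
      rw [mem_centralizer_singleton_iff] at hv
      exact ⟨⟨⟨v, le_normalizer v.2⟩, (hmem _).2 (congrArg Subtype.val hv)⟩, rfl⟩
  have hidx : (MulAction.orbit (normalizer (U : Set G)) u).ncard = 912576 := by
    have := Subgroup.card_mul_index (MulAction.stabilizer (normalizer (U : Set G)) u)
    rw [hK, h.card_normalizer, MulAction.index_stabilizer] at this
    exact Nat.eq_of_mul_eq_mul_left (by norm_num) (this.trans (by norm_num))
  have hsub : MulAction.orbit (normalizer (U : Set G)) u ⊆ (center U : Set U)ᶜ := by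
    rintro _ ⟨b, rfl⟩ hb
    exact hu ((apply_mem_center_iff (U.normalizerMonoidHom b)).1 hb)
  have hw' : w ∈ MulAction.orbit (normalizer (U : Set G)) u := by
    rw [Set.eq_of_subset_of_ncard_le hsub ?_]
    · exact hw
    · rw [hidx, Set.ncard_compl, h.card]
      change 97 ^ 3 - Nat.card (center U) ≤ _
      rw [hX]; norm_num
  obtain ⟨b, rfl⟩ := hw'
  exact ⟨b, b.2, rfl⟩

include ha hb hc in
theorem eq_closure : closure {g | ∃ k : G, ∃ x ∈ center U, g = k * x * k⁻¹} = ⊤ := by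
  have := h.finite
  set N := closure {g | ∃ k : G, ∃ x ∈ center U, g = k * (x : U) * k⁻¹} with hN
  have hconj : ∀ k : G, ∀ x ∈ center U, k * (x : U) * k⁻¹ ∈ N := fun k x hx =>
    subset_closure ⟨k, x, hx, rfl⟩
  have hnormal : N.Normal := by
    refine ⟨fun n hn g => ?_⟩
    have hle : N ≤ N.comap (MulAut.conj g).toMonoidHom := by
      rw [hN, closure_le]
      rintro _ ⟨k, x, hx, rfl⟩
      have := hconj (g * k) x hx
      change g * (k * (x : U) * k⁻¹) * g⁻¹ ∈ N
      convert this using 1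
      group
    exact hle hn
  refine h.eq_top N hnormal ?_
  obtain ⟨g₀, hg₀⟩ := hc
  have hg₀' : g₀ ∉ normalizer (U : Set G) := by
    rw [← ha, hg₀]
    exact Option.some_ne_none _
  have hmem : ∀ g, g ∉ normalizer (U : Set G) → ∃ u : U, ∃ b ∈ normalizer (U : Set G),
      g = u * g₀ * b := by
    intro g hg
    rw [← ha] at hg
    obtain ⟨u, hu⟩ := Option.ne_none_iff_exists'.1 hg
    refine ⟨u, g₀⁻¹ * u.1⁻¹ * g, ?_, by group⟩
    have h1 : π (u.1⁻¹) = shift u⁻¹ := hb u⁻¹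
    have h2 : π g₀⁻¹ (some 1) = none := by
      rw [← hg₀, map_inv]
      exact (π g₀).symm_apply_apply none
    rw [← ha, map_mul, map_mul, h1, Equiv.Perm.mul_apply, Equiv.Perm.mul_apply, hu, shift_some,
      inv_mul_cancel, h2]
  obtain ⟨x, hx, hx1⟩ : ∃ x ∈ center U, x ≠ 1 := by
    by_contra! hc
    have h1 := card_center_subgroup (U := U)
    rw [h.card_inf, (Subgroup.eq_bot_iff_forall _).2 hc, card_bot] at h1
    norm_num at h1
  have hn : g₀ * x * g₀⁻¹ ∉ normalizer (U : Set G) := fun hh =>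
    hx1 (Subtype.ext (h.eq_one_of_conj_mem x.2 hg₀' hh))
  have htop : N ⊔ normalizer (U : Set G) = ⊤ := by
    have hBle : normalizer (U : Set G) ≤ N ⊔ normalizer (U : Set G) := le_sup_right
    have h1 : g₀ ∈ N ⊔ normalizer (U : Set G) := by
      obtain ⟨u, b, hb, hub⟩ := hmem _ hn
      have h2 : g₀ = u.1⁻¹ * (g₀ * x * g₀⁻¹) * b⁻¹ := by rw [hub]; group
      rw [h2]
      exact mul_mem (mul_mem (hBle (inv_mem (le_normalizer u.2)))
        ((le_sup_left : N ≤ _) (hconj _ _ hx))) (hBle (inv_mem hb))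
    rw [Subgroup.eq_top_iff']
    intro g
    by_cases hg : g ∈ normalizer (U : Set G)
    · exact hBle hg
    · obtain ⟨u, b, hb, rfl⟩ := hmem g hg
      exact mul_mem (mul_mem (hBle (le_normalizer u.2)) h1) (hBle hb)
  have hidx : N.index ∣ 97 ^ 3 * 9408 := by
    rw [← h.card_normalizer, ← relIndex_top_right, ← htop, relIndex_sup_left]
    exact relIndex_dvd_card _ _
  have hcop : Nat.Coprime 9313 N.index := Nat.Coprime.coprime_dvd_right hidx (by norm_num)
  refine hcop.dvd_of_dvd_mul_right ?_
  rw [Subgroup.card_mul_index, h.card_group]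
  norm_num

include ha hb hc in
theorem unitalGroup : UnitalGroup (centralAut π.range) π.range where
  toHeisenbergPair := h.heisenbergPair ha hb
  shift_mem := fun u => ⟨u, hb u⟩
  mem_iff := fun β => Iff.rfl
  exists_ne := by
    obtain ⟨g, hg⟩ := hc
    exact ⟨π g, ⟨g, rfl⟩, by rw [hg]; exact Option.some_ne_none _⟩
  exists_extend := by
    rintro _ ⟨g, rfl⟩ h1 h2
    obtain ⟨β, hβ, -⟩ := exists_extend ha hb h1 h2
    exact ⟨β, hβ⟩
  semiregular := by
    rintro β ⟨g, hg⟩ u hu hβu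
    rw [h.eq_one_of_extend_apply ha hb hg hu hβu, map_one, ← extend_one] at hg
    exact (extend_injective hg).symm
  transitive := by
    intro u w hu hw
    have : Fact (Nat.Prime 97) := ⟨by norm_num⟩
    have hX : Nat.card (center U) = 97 := by rw [card_center_subgroup, h.card_inf]
    obtain ⟨b, hbN, hbw⟩ := h.exists_conj_eq hu hw
    have hbn : π b none = none := (ha b).2 hbN
    have hne : π b (some 1) ≠ none := by
      rw [← hbn]
      exact fun hh => Option.some_ne_none _ ((π b).injective hh)
    obtain ⟨v, hv⟩ := Option.ne_none_iff_exists'.1 hne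
    have hu' : π (v.1⁻¹ * b) = shift v⁻¹ * π b := by
      rw [map_mul, ← hb v⁻¹, Subgroup.coe_inv]
    obtain ⟨β, hβ, hβ'⟩ := exists_extend ha hb (g := v.1⁻¹ * b) (by rw [hu']; simp [hbn])
      (by rw [hu']; simp [hv])
    refine ⟨β, ⟨_, hβ⟩, ⁅v, β u⁆, commutator_mem_center_of_card h.card hX _ _, Subtype.ext ?_⟩
    rw [commutatorElement_def, inv_mul_cancel_right, ← hbw]
    change b * u * b⁻¹ = v * (β u : G) * (v : G)⁻¹
    rw [hβ']
    group
  le_closure := by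
    have hr : π.range = closure (π '' {g | ∃ k : G, ∃ x ∈ center U, g = k * (x : U) * k⁻¹}) := by
      rw [MonoidHom.range_eq_map, ← h.eq_closure ha hb hc, MonoidHom.map_closure]
    refine hr.le.trans (closure_mono ?_)
    rintro _ ⟨_, ⟨k, x, hx, rfl⟩, rfl⟩
    refine ⟨π k, ⟨k, rfl⟩, x, hx, ?_⟩
    rw [map_mul, map_mul, map_inv, hb]

end UnitaryLocal

end

/-! ### Free actions of groups of order `98` -/

section

open Subgroup Finset
open scoped commutatorElement

section FreeAction

universe u v

variable {A : Type u} {V : Type v} [Group A] [AddCommGroup V] {ρ : A →* AddMonoid.End V}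

/-- A subgroup of `V` invariant under a free action of a group of order `98` is everything, as its
order is a power of `97`. -/
theorem eq_top_of_free_action (hA : Nat.card A = 98) (hV : Nat.card V = 97 ^ 2)
    (hfree : ∀ α v, v ≠ 0 → ρ α v = v → α = 1) {W : AddSubgroup V}
    (hW : ∀ α, ∀ w ∈ W, ρ α w ∈ W) {v : V} (hv : v ≠ 0) (hvW : v ∈ W) : W = ⊤ := by
  have : Finite V := Nat.finite_of_card_ne_zero (by rw [hV]; norm_num)
  have hinj : Function.Injective fun α : A => (⟨ρ α v, hW α v hvW⟩ : W) := by
    intro α β h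
    have h1 : ρ α v = ρ β v := congrArg Subtype.val h
    have h2 : ρ (β⁻¹ * α) v = v := by
      rw [map_mul]
      change ρ β⁻¹ (ρ α v) = v
      rw [h1]
      change (ρ β⁻¹ * ρ β) v = v
      rw [← map_mul, inv_mul_cancel, map_one]
      rfl
    exact (inv_mul_eq_one.1 (hfree _ v hv h2)).symm
  have h1 := Nat.card_le_card_of_injective _ hinj
  rw [hA] at h1
  have h2 := W.card_addSubgroup_dvd_card
  rw [hV] at h2
  obtain ⟨k, hk, hk'⟩ := (Nat.dvd_prime_pow (by norm_num)).1 h2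
  refine AddSubgroup.eq_top_of_card_eq W ?_
  rw [hV, hk']
  interval_cases k <;> omega

open scoped IsMulCommutative in
/-- A free action of an abelian group of order `98` on a group of order `97²` is multiplication by
elements of a field of order `97²`. -/
theorem exists_field_of_free_action (hA : Nat.card A = 98) (hc : ∀ a b : A, a * b = b * a)
    (hV : Nat.card V = 97 ^ 2) (hfree : ∀ α v, v ≠ 0 → ρ α v = v → α = 1) :
    ∃ (R : Type v) (_ : Field R) (f : R ≃+ V) (χ : A →* R),
      Function.Injective χ ∧ ∀ α r, f (χ α * r) = ρ α (f r) := by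
  have : Finite V := Nat.finite_of_card_ne_zero (by rw [hV]; norm_num)
  let R := Subring.closure (Set.range ρ)
  have hcomm : ∀ x ∈ Set.range ρ, ∀ y ∈ Set.range ρ, x * y = y * x := by
    rintro _ ⟨a, rfl⟩ _ ⟨b, rfl⟩
    rw [← map_mul, hc, map_mul]
  have := Subring.isMulCommutative_closure hcomm
  let : CommRing R := inferInstance
  have hmem : ∀ α, ρ α ∈ R := fun α => Subring.subset_closure ⟨α, rfl⟩
  let ev : V → R →+ V := fun v =>
    { toFun := fun r => r.1 v
      map_zero' := rfl
      map_add' := fun _ _ => rfl }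
  have hsurj : ∀ v, v ≠ 0 → Function.Surjective (ev v) := by
    intro v hv
    rw [← AddMonoidHom.range_eq_top]
    refine eq_top_of_free_action hA hV hfree ?_ hv ⟨1, rfl⟩
    rintro α _ ⟨r, rfl⟩
    exact ⟨⟨ρ α, hmem α⟩ * r, rfl⟩
  have hinj : ∀ v, v ≠ 0 → ∀ r : R, r.1 v = 0 → r = 0 := by
    intro v hv r hr
    have h1 : r.1.ker = ⊤ := by
      refine eq_top_of_free_action hA hV hfree ?_ hv hr
      intro α w hw
      have := congrArg Subtype.val (mul_comm r ⟨ρ α, hmem α⟩)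
      have h2 : r.1 (ρ α w) = ρ α (r.1 w) := DFunLike.congr_fun this w
      have hw' : r.1 w = 0 := hw
      change r.1 (ρ α w) = 0
      rw [h2, hw', map_zero]
    ext w
    exact (AddMonoidHom.mem_ker.1 (h1 ▸ AddSubgroup.mem_top w) : r.1 w = 0)
  have : Nontrivial V := by
    rw [← Finite.one_lt_card_iff_nontrivial, hV]
    norm_num
  obtain ⟨v, hv⟩ := exists_ne (0 : V)
  have hfield : IsField R := by
    refine ⟨⟨0, 1, ?_⟩, mul_comm, ?_⟩
    · intro h
      exact hv (DFunLike.congr_fun (congrArg Subtype.val h.symm) v)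
    · intro s hs
      have hsv : s.1 v ≠ 0 := fun h => hs (hinj v hv s h)
      obtain ⟨r, hr⟩ := hsurj _ hsv v
      refine ⟨r, ?_⟩
      rw [mul_comm, ← sub_eq_zero]
      refine hinj v hv _ ?_
      have : r.1 (s.1 v) = v := hr
      change r.1 (s.1 v) - v = 0
      rw [this, sub_self]
  let f : R ≃+ V := AddEquiv.ofBijective (ev v)
    ⟨(injective_iff_map_eq_zero _).2 (fun r hr => hinj v hv r hr), hsurj v hv⟩
  let χ : A →* R :=
    { toFun := fun α => ⟨ρ α, hmem α⟩
      map_one' := Subtype.ext (map_one ρ)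
      map_mul' := fun a b => Subtype.ext (map_mul ρ a b) }
  refine ⟨R, hfield.toField, f, χ, ?_, fun α r => rfl⟩
  refine (injective_iff_map_eq_one _).2 fun α hα => hfree α v hv ?_
  have h1 : ρ α = 1 := congrArg Subtype.val hα
  rw [h1]
  rfl

/-- Two free actions of abelian groups of order `98` on groups of order `97²` are equivalent. -/
theorem exists_equiv_of_free_action {A' V' : Type*} [Group A'] [AddCommGroup V']
    {ρ' : A' →* AddMonoid.End V'} (hA : Nat.card A = 98) (hc : ∀ a b : A, a * b = b * a)
    (hV : Nat.card V = 97 ^ 2) (hfree : ∀ α v, v ≠ 0 → ρ α v = v → α = 1)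
    (hA' : Nat.card A' = 98) (hc' : ∀ a b : A', a * b = b * a)
    (hV' : Nat.card V' = 97 ^ 2) (hfree' : ∀ α v, v ≠ 0 → ρ' α v = v → α = 1) :
    ∃ e : V ≃+ V', ∀ α, ∃ α', ∀ v, e (ρ α v) = ρ' α' (e v) := by
  classical
  obtain ⟨R, _, f, χ, hχ, hf⟩ := exists_field_of_free_action hA hc hV hfree
  obtain ⟨R', _, f', χ', hχ', hf'⟩ := exists_field_of_free_action hA' hc' hV' hfree'
  have hR : Nat.card R = 97 ^ 2 := (Nat.card_congr f.toEquiv).trans hV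
  have hR' : Nat.card R' = 97 ^ 2 := (Nat.card_congr f'.toEquiv).trans hV'
  have : Finite R := Nat.finite_of_card_ne_zero (by rw [hR]; norm_num)
  have : Finite R' := Nat.finite_of_card_ne_zero (by rw [hR']; norm_num)
  have : Finite A := Nat.finite_of_card_ne_zero (by rw [hA]; norm_num)
  have : Finite A' := Nat.finite_of_card_ne_zero (by rw [hA']; norm_num)
  have := Fintype.ofFinite R
  have := Fintype.ofFinite R'
  have := Fintype.ofFinite A'
  let g : R ≃+* R' := FiniteField.ringEquivOfCardEq (by
    rw [← Nat.card_eq_fintype_card, ← Nat.card_eq_fintype_card, hR, hR'])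
  have himg : Finset.univ.image χ' = Polynomial.nthRootsFinset 98 (1 : R') := by
    refine Finset.eq_of_subset_of_card_le ?_ ?_
    · intro r hr
      obtain ⟨a, -, rfl⟩ := Finset.mem_image.1 hr
      rw [Polynomial.mem_nthRootsFinset (by norm_num), ← map_pow, ← hA', pow_card_eq_one', map_one]
    · rw [Finset.card_image_of_injective _ hχ', Finset.card_univ, ← Nat.card_eq_fintype_card, hA',
        Polynomial.nthRootsFinset_def]
      exact (Multiset.toFinset_card_le _).trans (Polynomial.card_nthRoots _ _)
  refine ⟨f.symm.trans (g.toAddEquiv.trans f'), fun α => ?_⟩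
  have h1 : g (χ α) ∈ Finset.univ.image χ' := by
    rw [himg, Polynomial.mem_nthRootsFinset (by norm_num), ← map_pow, ← map_pow, ← hA,
      pow_card_eq_one', map_one, map_one]
  obtain ⟨α', -, hα'⟩ := Finset.mem_image.1 h1
  refine ⟨α', fun v => ?_⟩
  have h2 : f.symm (ρ α v) = χ α * f.symm v := by
    rw [AddEquiv.symm_apply_eq, hf, AddEquiv.apply_symm_apply]
  change f' (g (f.symm (ρ α v))) = ρ' α' (f' (g (f.symm v)))
  rw [h2, map_mul, ← hf', hα']

end FreeAction

end

/-! ### Transport of commutator forms -/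

section

open Subgroup Finset
open scoped commutatorElement

section CommutatorTransport

variable {P P' : Type*} [Group P] [Group P'] {p : ℕ} [hp : Fact p.Prime]

/-- In a group of order `p³`, two elements that do not commute generate the group. -/
theorem closure_pair_eq_top (hP : Nat.card P = p ^ 3) {u g : P} (hgu : ⁅g, u⁆ ≠ 1) :
    closure {u, g} = ⊤ := by
  set K := closure {u, g} with hK
  have : Finite P := Nat.finite_of_card_ne_zero (by rw [hP]; exact pow_ne_zero _ hp.out.ne_zero)
  have hu : u ∈ K := subset_closure (by simp)
  have hg : g ∈ K := subset_closure (by simp)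
  have hK' : ¬ ∀ a b : K, a * b = b * a := by
    intro h
    refine hgu (commutatorElement_eq_one_iff_mul_comm.2 ?_)
    exact congrArg Subtype.val (h ⟨g, hg⟩ ⟨u, hu⟩)
  have h1 := K.card_subgroup_dvd_card
  rw [hP] at h1
  obtain ⟨k, hk, hk'⟩ := (Nat.dvd_prime_pow hp.out).1 h1
  refine Subgroup.eq_top_of_card_eq K ?_
  rw [hk', hP]
  interval_cases k
  · have := (Nat.card_eq_one_iff_unique.1 (hk'.trans (pow_zero p))).1
    exact absurd (fun a b => Subsingleton.elim _ _) hK'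
  · have := isCyclic_of_prime_card (hk'.trans (pow_one p))
    exact absurd (IsCyclic.isMulCommutative (α := K)).is_comm.comm hK'
  · exact absurd (IsPGroup.isMulCommutative_of_card_eq_prime_sq hk').is_comm.comm hK'
  · rfl

theorem exists_notMem_center (hP : Nat.card P = p ^ 3) (hZ : Nat.card (center P) = p) :
    ∃ u : P, u ∉ center P := by
  by_contra! h
  have h1 : center P = ⊤ := (Subgroup.eq_top_iff' _).2 h
  rw [h1, card_top, hP] at hZ
  have := Nat.pow_lt_pow_right hp.out.one_lt (show 1 < 3 by norm_num)
  rw [hZ, pow_one] at this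
  exact this.false

theorem exists_commutator_ne_one {u : P} (hu : u ∉ center P) : ∃ g : P, ⁅g, u⁆ ≠ 1 := by
  by_contra! h
  exact hu (mem_center_iff.2 fun g => commutatorElement_eq_one_iff_mul_comm.1 (h g))

variable (hc : ∀ g h : P, ⁅g, h⁆ ∈ center P) (hc' : ∀ g h : P', ⁅g, h⁆ ∈ center P')

theorem commutatorHom_swap (u v : P) : commutatorHom hc u v = (commutatorHom hc v u)⁻¹ :=
  Subtype.ext (commutatorElement_inv u v).symm

theorem commutatorHom_self (u : P) : commutatorHom hc u u = 1 :=
  Subtype.ext (commutatorElement_self u)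

theorem center_le_ker_commutatorHom (u : P) : center P ≤ (commutatorHom hc u).ker := by
  intro x hx
  refine MonoidHom.mem_ker.2 (Subtype.ext ?_)
  exact commutatorElement_eq_one_iff_mul_comm.2 ((mem_center_iff.1 hx u).symm)

variable (hP : Nat.card P = p ^ 3) (hZ : Nat.card (center P) = p)
  (hP' : Nat.card P' = p ^ 3) (hZ' : Nat.card (center P') = p)
include hP' hZ' hP hZ

/-- An isomorphism between the central quotients of two extraspecial groups of order `p³` is
compatible with the commutator forms, up to an isomorphism between the centers. -/
theorem exists_center_hom (e : P ⧸ center P ≃* P' ⧸ center P') :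
    ∃ f : center P →* center P', Function.Injective f ∧ ∀ u v u' v',
      QuotientGroup.mk u' = e (QuotientGroup.mk u) → QuotientGroup.mk v' = e (QuotientGroup.mk v) →
        f (commutatorHom hc v u) = commutatorHom hc' v' u' := by
  have hfin : Finite P :=
    Nat.finite_of_card_ne_zero (by rw [hP]; exact pow_ne_zero _ hp.out.ne_zero)
  obtain ⟨u, hu⟩ := exists_notMem_center hP hZ
  obtain ⟨g, hgu⟩ := exists_commutator_ne_one hu
  obtain ⟨u₁, hu₁⟩ := QuotientGroup.mk_surjective (e (QuotientGroup.mk u))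
  obtain ⟨g₁, hg₁⟩ := QuotientGroup.mk_surjective (e (QuotientGroup.mk g))
  have : Fact (Nat.card (center P')).Prime := ⟨hZ'.symm ▸ hp.out⟩
  have : Fact (Nat.card (center P)).Prime := ⟨hZ.symm ▸ hp.out⟩
  let f₀ : center P ≃* center P' := mulEquivOfPrimeCardEq (p := p) hZ hZ'
  have hz : f₀ (commutatorHom hc u g) ≠ 1 := by
    intro h
    rw [map_eq_one_iff _ f₀.injective] at h
    exact hgu (congrArg Subtype.val h)
  obtain ⟨k, hk⟩ := mem_zpowers_iff.1
    (mem_zpowers_of_prime_card (p := p) hZ' hz (g' := commutatorHom hc' u₁ g₁))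
  let f : center P →* center P' := 
    { toFun := fun x => f₀ x ^ k
      map_one' := by simp
      map_mul' := fun x y => by
        rw [map_mul]
        exact Commute.mul_zpow (Subtype.ext ((mem_center_iff.1 (f₀ x).2 _).symm)) k }
  have hf : f (commutatorHom hc u g) = commutatorHom hc' u₁ g₁ := hk
  let ψ : P' → P →* center P' := fun w =>
    (QuotientGroup.lift (center P') (commutatorHom hc' w) (center_le_ker_commutatorHom hc' w)).comp
      (e.toMonoidHom.comp (QuotientGroup.mk' (center P)))
  have hψ : ∀ {a a'}, QuotientGroup.mk a' = e (QuotientGroup.mk a) → ∀ w,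
      ψ w a = commutatorHom hc' w a' := by
    intro a a' ha w
    change QuotientGroup.lift _ _ (center_le_ker_commutatorHom hc' w) (e (QuotientGroup.mk a)) = _
    rw [← ha]
    rfl
  have htop := closure_pair_eq_top hP hgu
  have h1 : ∀ {v v'}, f (commutatorHom hc v u) = commutatorHom hc' v' u₁ →
      f (commutatorHom hc v g) = commutatorHom hc' v' g₁ →
      f.comp (commutatorHom hc v) = ψ v' := by
    intro v v' hvu hvg
    refine MonoidHom.eq_of_eqOn_dense htop ?_
    rintro a (rfl | rfl)
    · exact hvu.trans (hψ hu₁ _).symm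
    · exact hvg.trans (hψ hg₁ _).symm
  have h2 := h1 (v := u) (v' := u₁) (by rw [commutatorHom_self, commutatorHom_self, map_one]) hf
  have h3 := h1 (v := g) (v' := g₁)
    (by rw [commutatorHom_swap, map_inv, hf, commutatorHom_swap hc' u₁, inv_inv])
    (by rw [commutatorHom_self, commutatorHom_self, map_one])
  have h4 : ∀ a b a' b', QuotientGroup.mk a' = e (QuotientGroup.mk a) →
      QuotientGroup.mk b' = e (QuotientGroup.mk b) →
        f (commutatorHom hc b a) = commutatorHom hc' b' a' := by
    intro a b a' b' ha hb
    have h5 : f.comp (commutatorHom hc b) = ψ b' := by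
      refine h1 ?_ ?_
      · have := DFunLike.congr_fun h2 b
        rw [hψ hb, MonoidHom.comp_apply] at this
        rw [commutatorHom_swap, map_inv, this, commutatorHom_swap hc' b']
      · have := DFunLike.congr_fun h3 b
        rw [hψ hb, MonoidHom.comp_apply] at this
        rw [commutatorHom_swap, map_inv, this, commutatorHom_swap hc' b']
    rw [← hψ ha, ← h5]
    rfl
  refine ⟨f, ?_, h4⟩
  rw [← MonoidHom.ker_eq_bot_iff]
  refine (f.ker.eq_bot_or_eq_top_of_prime_card).resolve_right fun hker => ?_
  obtain ⟨w, hw⟩ := exists_notMem_center hP' hZ'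
  obtain ⟨w', hw'⟩ := exists_commutator_ne_one hw
  obtain ⟨a, ha⟩ := QuotientGroup.mk_surjective (e.symm (QuotientGroup.mk w))
  obtain ⟨b, hb⟩ := QuotientGroup.mk_surjective (e.symm (QuotientGroup.mk w'))
  have h6 := h4 b a w' w (by rw [hb, e.apply_symm_apply]) (by rw [ha, e.apply_symm_apply])
  rw [MonoidHom.mem_ker.1 (hker ▸ mem_top (commutatorHom hc a b))] at h6
  exact hw' (congrArg Subtype.val h6).symm

end CommutatorTransport

end

/-! ### Uniqueness of Heisenberg pairs -/

section

open Subgroup Finset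
open scoped commutatorElement

namespace HeisenbergPair

section Quotient

variable {P P' : Type*} [Group P] [Group P'] {A' : Subgroup (MulAut P')} {A : Subgroup (MulAut P)}

/-- The action of a group of automorphisms on the central quotient. -/
def quotientAction (h : HeisenbergPair P A) :
    letI := h.commGroup
    A →* AddMonoid.End (Additive (P ⧸ center P)) :=
  letI := h.commGroup
  { toFun := fun α => MonoidHom.toAdditive
      (QuotientGroup.map (center P) (center P) α.1.toMonoidHom
        fun _ hx => apply_mem_center α.1 hx)
    map_one' := by
      ext x
      induction x using Additive.rec with | ofMul x => ?_
      induction x using QuotientGroup.induction_on with | H x => rfl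
    map_mul' := fun a b => by
      ext x
      induction x using Additive.rec with | ofMul x => ?_
      induction x using QuotientGroup.induction_on with | H x => rfl }

theorem quotientAction_free (h : HeisenbergPair P A) (α : A) (v : Additive (P ⧸ center P))
    (hv : v ≠ 0) (hα : h.quotientAction α v = v) : α = 1 := by
  induction v using Additive.rec with | ofMul v => ?_
  induction v using QuotientGroup.induction_on with | H v => ?_
  have h1 : (QuotientGroup.mk (α.1 v) : P ⧸ center P) = QuotientGroup.mk v := hα
  refine Subtype.ext (h.free α α.2 v (fun hv' => hv ?_) (mk_eq_mk_iff_mem_center.1 h1.symm))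
  exact (QuotientGroup.eq_one_iff v).2 hv'

/-- The actions of any two such groups of automorphisms on the central quotients are equivalent. -/
theorem exists_quotient_equiv (h : HeisenbergPair P A) (h' : HeisenbergPair P' A') :
    ∃ e : P ⧸ center P ≃* P' ⧸ center P', ∀ α ∈ A, ∃ α' ∈ A', ∀ u u',
      QuotientGroup.mk u' = e (QuotientGroup.mk u) →
        QuotientGroup.mk (α' u') = e (QuotientGroup.mk (α u)) := by
  let := h.commGroup
  let := h'.commGroup
  obtain ⟨e, he⟩ := exists_equiv_of_free_action (ρ := h.quotientAction) (ρ' := h'.quotientAction)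
    h.card_aut (fun a b => Subtype.ext (h.aut_comm a.2 b.2)) h.card_quotient h.quotientAction_free
    h'.card_aut (fun a b => Subtype.ext (h'.aut_comm a.2 b.2)) h'.card_quotient
    h'.quotientAction_free
  refine ⟨MulEquiv.toAdditive.symm e, fun α hα => ?_⟩
  obtain ⟨α', hα'⟩ := he ⟨α, hα⟩
  refine ⟨α', α'.2, fun u u' hu => ?_⟩
  have h1 := hα' (Additive.ofMul (QuotientGroup.mk u))
  refine Eq.trans ?_ h1.symm
  change _ = h'.quotientAction α' (e (Additive.ofMul (QuotientGroup.mk u)))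
  have h2 : e (Additive.ofMul (QuotientGroup.mk u)) =
      Additive.ofMul (QuotientGroup.mk u') := hu.symm
  rw [h2]
  rfl

end Quotient

section Twist

variable {P : Type*} [Group P] {A : Subgroup (MulAut P)} (h : HeisenbergPair P A)
  {t : MulAut P} (htA : t ∈ A) (ht : t * t = 1) (ht1 : t ≠ 1)
include h htA ht ht1

theorem twist_mul (u v : P) :
    u * v * t (u * v) = ⁅u, v⁆ * (u * t u) * (v * t v) := by
  have hu := mem_center_iff.1 (h.mul_apply_mem_center htA ht ht1 u)
  have h1 : t u = u⁻¹ * (u * t u) := by group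
  have h2 : t v = v⁻¹ * (v * t v) := by group
  have hv := mem_center_iff.1 (h.mul_apply_mem_center htA ht ht1 v)
  set a := u * t u
  set b := v * t v
  rw [map_mul, h1, h2, commutatorElement_def]
  calc u * v * (u⁻¹ * a * (v⁻¹ * b)) = u * v * u⁻¹ * (a * v⁻¹) * b := by group
    _ = _ := by rw [← hu]; group

theorem twist_apply {α : MulAut P} (hα : α ∈ A) (u : P) : α u * t (α u) = u * t u := by
  rw [← MulAut.mul_apply, ← h.commute_involution htA ht ht1 hα, MulAut.mul_apply, ← map_mul]
  exact h.apply_center α hα _ (h.mul_apply_mem_center htA ht ht1 u)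

end Twist

section Iso

theorem twist_identity {C : Type*} [CommGroup C] {c : C} (hc : c ^ 97 = 1) (a b d e : C) :
    (c * a * b) ^ 48 * (c * d * e) ^ 49 = a ^ 48 * d ^ 49 * (b ^ 48 * e ^ 49) := by
  simp only [mul_pow]
  calc _ = c ^ 97 * (a ^ 48 * d ^ 49 * (b ^ 48 * e ^ 49)) := by
        rw [show 97 = 48 + 49 from rfl, pow_add]
        simp only [mul_left_comm, mul_assoc]
    _ = _ := by rw [hc, one_mul]

variable {P P' : Type*} [Group P] [Group P'] {A' : Subgroup (MulAut P')} {A : Subgroup (MulAut P)}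

open scoped IsMulCommutative in
/-- Any two such pairs are isomorphic. -/
theorem exists_mulEquiv (h : HeisenbergPair P A) (h' : HeisenbergPair P' A') :
    ∃ φ : P ≃* P', ∀ α ∈ A, ∃ α' ∈ A', ∀ u, φ (α u) = α' (φ u) := by
  have : Fact (Nat.Prime 97) := ⟨by norm_num⟩
  have hfin := h.finite
  have hfin' := h'.finite
  obtain ⟨e, he⟩ := h.exists_quotient_equiv h'
  have hc := commutator_mem_center_of_card h.card h.card_center
  have hc' := commutator_mem_center_of_card h'.card h'.card_center
  obtain ⟨f, hf, hfe⟩ := exists_center_hom hc hc' h.card h.card_center h'.card h'.card_center e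
  choose E hE using fun u : P => QuotientGroup.mk_surjective (e (QuotientGroup.mk u))
  obtain ⟨t, htA, ht, ht1⟩ := h.exists_involution
  obtain ⟨t', htA', ht', ht1'⟩ := h'.exists_involution
  have hn' := h'.mul_apply_mem_center htA' ht' ht1'
  let n : P → center P := fun u => ⟨u * t u, h.mul_apply_mem_center htA ht ht1 u⟩
  let n' : P' → center P' := fun u => ⟨u * t' u, hn' u⟩
  let s : P' → P' := fun u => u * (n' u ^ 48 : center P')
  have hm : ∀ (u v : P') (x y : center P'), u * x * (v * y) = u * v * (x * y : center P') := by
    intro u v x y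
    calc u * x * (v * y) = u * (x * v) * y := by group
      _ = _ := by rw [← mem_center_iff.1 x.2 v, Subgroup.coe_mul]; group
  have hZp : ∀ x : center P', x ^ 97 = 1 := fun x => Subtype.ext (pow_of_mem_center h' x.2)
  have hs : ∀ {u v}, (QuotientGroup.mk u : P' ⧸ center P') = QuotientGroup.mk v → s u = s v := by
    intro u v huv
    rw [mk_eq_mk_iff_mem_center] at huv
    obtain ⟨x, rfl⟩ : ∃ x : center P', u * x = v := ⟨⟨_, huv⟩, by simp⟩
    have h1 : n' (u * x) = n' u * x ^ 2 := by
      refine Subtype.ext ?_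
      change u * x * t' (u * x) = u * t' u * (x ^ 2 : center P')
      rw [map_mul, h'.apply_center t' htA' x x.2, hm, pow_two]
    change u * (n' u ^ 48 : center P') = u * x * (n' (u * x) ^ 48 : center P')
    rw [h1, mul_assoc, ← Subgroup.coe_mul, mul_pow, ← pow_mul, mul_left_comm, ← pow_succ', hZp,
      mul_one]
  have hnmul' : ∀ u v, n' (u * v) = commutatorHom hc' v u * n' u * n' v := fun u v =>
    Subtype.ext (h'.twist_mul htA' ht' ht1' u v)
  have hnmul : ∀ u v, n (u * v) = commutatorHom hc v u * n u * n v := fun u v =>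
    Subtype.ext (h.twist_mul htA ht ht1 u v)
  let φ₀ : P →* P' := MonoidHom.mk' (fun u => s (E u) * (f (n u) ^ 49 : center P')) (by
    intro u v
    have h1 : s (E (u * v)) = s (E u * E v) := hs (by
      rw [hE, QuotientGroup.mk_mul, QuotientGroup.mk_mul, map_mul, hE, hE])
    rw [h1, hnmul, map_mul, map_mul, hfe u v (E u) (E v) (hE u) (hE v)]
    change _ * ((n' (E u * E v) ^ 48 : center P') : P') * _ =
      _ * ((n' (E u) ^ 48 : center P') : P') * _ * (_ * ((n' (E v) ^ 48 : center P') : P') * _)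
    rw [hnmul']
    simp only [mul_assoc (_ : P') (Subtype.val _) (Subtype.val _), ← Subgroup.coe_mul]
    rw [hm]
    congr 2
    exact twist_identity (hZp _) _ _ _ _)
  have hφ₀ : Function.Injective φ₀ := by
    refine (injective_iff_map_eq_one _).2 fun u hu => ?_
    have hu' : E u * (n' (E u) ^ 48 : center P') * (f (n u) ^ 49 : center P') = 1 := hu
    have h1 : E u ∈ center P' := by
      rw [mul_assoc, ← Subgroup.coe_mul] at hu'
      rw [eq_inv_of_mul_eq_one_left hu']
      exact inv_mem (Subtype.prop _)
    have h2 : u ∈ center P := by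
      rwa [← QuotientGroup.eq_one_iff, ← map_eq_one_iff e e.injective, ← hE,
        QuotientGroup.eq_one_iff]
    have h3 : s (E u) = 1 := by
      have h4 : n' 1 = 1 := Subtype.ext (by simp [n'])
      rw [hs (((QuotientGroup.eq_one_iff _).2 h1).trans (QuotientGroup.mk_one _).symm)]
      simp [s, h4]
    have h4 : n u = ⟨u, h2⟩ ^ 2 := Subtype.ext (by
      change u * t u = u ^ 2
      rw [h.apply_center t htA u h2, pow_two])
    change s (E u) * (f (n u) ^ 49 : center P') = 1 at hu'
    rw [h3, one_mul, h4, map_pow, ← pow_mul, show 2 * 49 = 97 + 1 from rfl, pow_succ, hZp,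
      one_mul] at hu'
    exact congrArg Subtype.val ((map_eq_one_iff f hf).1 (Subtype.ext hu'))
  refine ⟨MulEquiv.ofBijective φ₀ ((Nat.bijective_iff_injective_and_card _).2
    ⟨hφ₀, h.card.trans h'.card.symm⟩), fun α hα => ?_⟩
  obtain ⟨α', hα', hαα⟩ := he α hα
  refine ⟨α', hα', fun u => ?_⟩
  have h1 : n (α u) = n u := Subtype.ext (h.twist_apply htA ht ht1 hα u)
  have h2 : n' (α' (E u)) = n' (E u) := Subtype.ext (h'.twist_apply htA' ht' ht1' hα' (E u))
  change s (E (α u)) * (f (n (α u)) ^ 49 : center P') =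
    α' (E u * (n' (E u) ^ 48 : center P') * (f (n u) ^ 49 : center P'))
  rw [h1, hs ((hE (α u)).trans (hαα u _ (hE u)).symm), map_mul, map_mul,
    h'.apply_center α' hα' _ (Subtype.prop _), h'.apply_center α' hα' _ (Subtype.prop _), ← h2]

end Iso

end HeisenbergPair

end

/-! ### Uniqueness of the unital group -/

section

open Subgroup Finset
open scoped Pointwise

section Transport

variable {P P' : Type*} [Group P] [Group P'] {A' : Subgroup (MulAut P')} {A : Subgroup (MulAut P)}

theorem congr_symm_mem_iff {φ : P ≃* P'} (hφ : ∀ α, MulAut.congr φ α ∈ A' ↔ α ∈ A)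
    (α : MulAut P') : MulAut.congr φ.symm α ∈ A ↔ α ∈ A' := by
  obtain ⟨α, rfl⟩ := (MulAut.congr φ).surjective α
  rw [hφ]
  exact iff_of_eq (congrArg (· ∈ A) ((MulAut.congr φ).symm_apply_apply α))

theorem image_mem_blocks {φ : P ≃* P'} (hφ : ∀ α, MulAut.congr φ α ∈ A' ↔ α ∈ A)
    {B : Set (Option P)} (hB : B ∈ blocks A) :
    Equiv.optionCongr φ.toEquiv '' B ∈ blocks A' := by
  have hcenter : ∀ u, φ u ∈ center P' ↔ u ∈ center P := by
    intro u
    rw [mem_center_iff, mem_center_iff, φ.surjective.forall]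
    simp only [← map_mul, φ.injective.eq_iff]
  rcases hB with ⟨u, rfl⟩ | ⟨u, v, hv, rfl⟩
  · refine Or.inl ⟨φ u, ?_⟩
    ext o
    obtain ⟨o, rfl⟩ := (Equiv.optionCongr φ.toEquiv).surjective o
    rw [(Equiv.injective _).mem_set_image]
    rcases o with _ | w
    · exact iff_of_true (none_mem_lineInf u) (none_mem_lineInf _)
    · change some w ∈ lineInf u ↔ some (φ w) ∈ lineInf (φ u)
      rw [some_mem_lineInf, some_mem_lineInf, ← map_inv, ← map_mul, hcenter]
  · refine Or.inr ⟨φ u, φ v, fun h => hv ((hcenter v).1 h), ?_⟩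
    ext o
    constructor
    · rintro ⟨_, ⟨α, hα, rfl⟩, rfl⟩
      exact ⟨MulAut.congr φ α, (hφ α).2 hα, by simp⟩
    · rintro ⟨α, hα, rfl⟩
      obtain ⟨α, rfl⟩ := (MulAut.congr φ).surjective α
      exact ⟨some (u * α v), ⟨α, (hφ α).1 hα, rfl⟩, by simp⟩

theorem permCongr_mem_centralPerms {φ : P ≃* P'} (hφ : ∀ α, MulAut.congr φ α ∈ A' ↔ α ∈ A)
    {σ : Equiv.Perm (Option P)} (hσ : σ ∈ centralPerms A) :
    (Equiv.optionCongr φ.toEquiv).permCongrHom σ ∈ centralPerms A' := by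
  have hφ' := congr_symm_mem_iff hφ
  set τ := Equiv.optionCongr φ.toEquiv
  have hsurj : ∀ B' ∈ blocks A', ∃ B ∈ blocks A, B' = τ '' B := by
    intro B' hB'
    exact ⟨_, image_mem_blocks hφ' hB', (τ.image_symm_image B').symm⟩
  have hsmul : ∀ B : Set (Option P), τ.permCongrHom σ • (τ '' B) = τ '' (σ • B) := by
    intro B
    rw [← Set.image_smul, ← Set.image_smul, Set.image_image, Set.image_image]
    simp [Equiv.permCongr_apply]
  obtain ⟨h1, p, hp⟩ := hσ
  refine ⟨fun B' hB' => ?_, τ p, fun B' hB' hpB => ?_⟩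
  · obtain ⟨B, hB, rfl⟩ := hsurj B' hB'
    rw [hsmul]
    exact image_mem_blocks hφ (h1 B hB)
  · obtain ⟨B, hB, rfl⟩ := hsurj B' hB'
    rw [hsmul, hp B hB (τ.injective.mem_set_image.1 hpB)]

theorem map_closure_centralPerms {φ : P ≃* P'} (hφ : ∀ α, MulAut.congr φ α ∈ A' ↔ α ∈ A) :
    (closure (centralPerms A)).map (Equiv.optionCongr φ.toEquiv).permCongrHom.toMonoidHom =
      closure (centralPerms A') := by
  rw [MonoidHom.map_closure]
  congr 1
  refine Set.Subset.antisymm ?_ fun σ hσ => ?_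
  · rintro _ ⟨σ, hσ, rfl⟩
    exact permCongr_mem_centralPerms hφ hσ
  · have hφ' := congr_symm_mem_iff hφ
    exact ⟨_, permCongr_mem_centralPerms hφ' hσ,
      (Equiv.optionCongr φ.toEquiv).permCongrHom.apply_symm_apply σ⟩

/-- Groups acting on isomorphic unitals are isomorphic. -/
theorem UnitalGroup.nonempty_mulEquiv {Γ : Subgroup (Equiv.Perm (Option P))}
    {Γ' : Subgroup (Equiv.Perm (Option P'))} (h : UnitalGroup A Γ) (h' : UnitalGroup A' Γ') :
    Nonempty (Γ ≃* Γ') := by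
  classical
  obtain ⟨φ, hφ⟩ := h.toHeisenbergPair.exists_mulEquiv h'.toHeisenbergPair
  have hfin := h'.toHeisenbergPair.finite_aut
  have hmap : A.map (MulAut.congr φ).toMonoidHom = A' := by
    refine eq_of_le_of_card_ge ?_ ?_
    · rintro _ ⟨α, hα, rfl⟩
      obtain ⟨α', hα', hαα⟩ := hφ α hα
      convert hα'
      ext u
      simpa using hαα (φ.symm u)
    · rw [h'.card_aut, ← h.card_aut]
      exact (Nat.card_congr (A.equivMapOfInjective _ (MulAut.congr φ).injective).toEquiv).le
  have hmem : ∀ α, MulAut.congr φ α ∈ A' ↔ α ∈ A := by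
    intro α
    rw [← hmap]
    exact mem_map_iff_mem (f := (MulAut.congr φ).toMonoidHom) (MulAut.congr φ).injective
  rw [h.eq_closure, h'.eq_closure, ← map_closure_centralPerms hmem]
  exact ⟨Subgroup.equivMapOfInjective _ _ (MulEquiv.injective _)⟩

end Transport

end

/-- A group of order `2^7 * 3 * 7^4 * 67 * 97^3 * 139` in which the primes `67` and `139` have
degree `1` in the prime graph is a group generated by central collineations of a unital. -/
theorem exists_unitalGroup {G : Type*} [Group G] [Finite G]
    (hG : Nat.card G = 2 ^ 7 * 3 * 7 ^ 4 * 67 * 97 ^ 3 * 139)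
    (h67 : gkDegree G 67 = 1) (h139 : gkDegree G 139 = 1) :
    ∃ (U : Subgroup G) (A : Subgroup (MulAut U)) (Γ : Subgroup (Equiv.Perm (Option U))),
      UnitalGroup A Γ ∧ Nonempty (G ≃* Γ) := by
  obtain ⟨U, hU⟩ := exists_unitaryLocal hG h67 h139
  obtain ⟨π, hπ, hshift, hg⟩ := hU.exists_perm
  exact ⟨U, _, π.range, hU.unitalGroup hπ hshift hg,
    ⟨MonoidHom.ofInjective (hU.injective hπ hshift)⟩⟩

/-- Any two finite groups of order `2^7 * 3 * 7^4 * 67 * 97^3 * 139` whose prime graphs have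
vertex degrees deg 2 = 3, deg 3 = 2, deg 7 = 3, deg 67 = 1, deg 97 = 2, deg 139 = 1 are isomorphic (the
order and degree pattern of the simple unitary group `U_3(97)`). -/
theorem od_characterization_U_3_97
    (G H : Type*) [Group G] [Finite G] [Group H] [Finite H]
    (hG : Nat.card G = 2^7 * 3 * 7^4 * 67 * 97^3 * 139)
    (hH : Nat.card H = 2^7 * 3 * 7^4 * 67 * 97^3 * 139)
    (hG2 : gkDegree G 2 = 3)
    (hG3 : gkDegree G 3 = 2)
    (hG7 : gkDegree G 7 = 3)
    (hG67 : gkDegree G 67 = 1)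
    (hG97 : gkDegree G 97 = 2)
    (hG139 : gkDegree G 139 = 1)
    (hH2 : gkDegree H 2 = 3)
    (hH3 : gkDegree H 3 = 2)
    (hH7 : gkDegree H 7 = 3)
    (hH67 : gkDegree H 67 = 1)
    (hH97 : gkDegree H 97 = 2)
    (hH139 : gkDegree H 139 = 1) :
    Nonempty (G ≃* H) := by
  obtain ⟨U, A, Γ, hΓ, ⟨e⟩⟩ := exists_unitalGroup hG hG67 hG139
  obtain ⟨V, B, Δ, hΔ, ⟨f⟩⟩ := exists_unitalGroup hH hH67 hH139
  obtain ⟨g⟩ := hΓ.nonempty_mulEquiv hΔ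
  exact ⟨(e.trans g).trans f.symm⟩
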